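/- arXiv:1104.2080 — 2 statements merged into one kernel-verified Lean document; each statement's English description precedes it below -/
import Mathlib

section
/- Fix n ∈ (0,1], β > 0, h ∈ ℝ, an integer K ≥ 1, numbers 0 = q_0 ≤ q_1 ≤ … ≤ q_{K−1} ≤ q_K = 1 and n = m_0 ≤ m_1 ≤ … ≤ m_K ≤ m_{K+1} = 1. Define functions f_a : ℝ → ℝ recursively by f_K(y) = log cosh(βy) and, for a = K, K−1, …, 1, f_{a−1}(y) = (1/m_a) log ∫_ℝ exp( m_a f_a( y + √(q_a − q_{a−1}) z ) ) dμ(z). Then for every N ≥ 1: φ_N(n,β,h) ≤ log 2 + f_0(h) − (β²/4)( 1 − Σ_{a=0}^{K} (m_{a+1} − m_a) q_a² ). -/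
open MeasureTheory ProbabilityTheory Real Filter Topology

noncomputable section

/-- The ±1 spin value attached to a Boolean. -/
def spinVal (b : Bool) : ℝ := if b then 1 else -1

/-- Law of the couplings `J = (J_{ij})`: i.i.d. standard Gaussians. -/
def skMuJ (N : ℕ) : Measure (Fin N × Fin N → ℝ) :=
  Measure.pi fun _ => gaussianReal 0 1

/-- The Sherrington–Kirkpatrick Hamiltonian. -/
def skH (N : ℕ) (h : ℝ) (J : Fin N × Fin N → ℝ) (σ : Fin N → Bool) : ℝ :=
  -(1 / Real.sqrt (N : ℝ)) *
      ∑ p ∈ Finset.univ.filter (fun p : Fin N × Fin N => p.1 < p.2),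
        J p * spinVal (σ p.1) * spinVal (σ p.2)
    - h * ∑ i, spinVal (σ i)

/-- The SK partition function. -/
def skZ (N : ℕ) (β h : ℝ) (J : Fin N × Fin N → ℝ) : ℝ :=
  ∑ σ : Fin N → Bool, Real.exp (-β * skH N h J σ)

/-- Quenched pressure `α_N(β,h) = N⁻¹ E log Z_N`. -/
def skAlpha (N : ℕ) (β h : ℝ) : ℝ :=
  (1 / (N : ℝ)) * ∫ J, Real.log (skZ N β h J) ∂ skMuJ N

/-- Interpolating function `φ_N(n,β,h) = (Nn)⁻¹ log E[Z_N^n]`. -/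
def skPhi (N : ℕ) (n β h : ℝ) : ℝ :=
  (1 / ((N : ℝ) * n)) * Real.log (∫ J, skZ N β h J ^ n ∂ skMuJ N)

variable {S : Type*} [Fintype S]

/-- The law of `√s • w` when `w` has law `μ`. -/
def scaledMeasure (μ : Measure (S → ℝ)) (s : ℝ) : Measure (S → ℝ) :=
  μ.map (√s • ContinuousLinearMap.id ℝ (S → ℝ))

instance (μ : Measure (S → ℝ)) [IsGaussian μ] (s : ℝ) : IsGaussian (scaledMeasure μ s) := by
  unfold scaledMeasure; infer_instance

lemma integral_scaledMeasure (μ : Measure (S → ℝ)) (s : ℝ) {g : (S → ℝ) → ℝ}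
    (hg : Measurable g) : ∫ w, g w ∂scaledMeasure μ s = ∫ w, g (√s • w) ∂μ := by
  unfold scaledMeasure
  rw [integral_map (by fun_prop) hg.aestronglyMeasurable]
  simp

lemma scaledMeasure_conv_scaledMeasure (μ : Measure (S → ℝ)) [IsGaussian μ]
    (hμ : ∀ L : StrongDual ℝ (S → ℝ), μ[L] = 0) {s t : ℝ} (hs : 0 ≤ s) (ht : 0 ≤ t) :
    scaledMeasure μ s ∗ scaledMeasure μ t = scaledMeasure μ (s + t) := by
  apply Measure.ext_of_charFunDual
  ext L
  rw [charFunDual_conv]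
  have key : ∀ r : ℝ, 0 ≤ r → charFunDual (scaledMeasure μ r) L
      = Complex.exp (-(r * Var[L; μ] : ℝ) / 2) := by
    intro r hr
    rw [scaledMeasure, charFunDual_map, IsGaussian.charFunDual_eq_of_forall_strongDual_eq_zero hμ]
    congr 2
    have : (L.comp (√r • ContinuousLinearMap.id ℝ (S → ℝ)) : (S → ℝ) → ℝ) = √r • (L : (S → ℝ) → ℝ) := by
      ext; simp
    rw [this, variance_smul, Real.sq_sqrt hr]
  rw [key s hs, key t ht, key _ (add_nonneg hs ht), ← Complex.exp_add]
  congr 1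
  push_cast
  ring

lemma scaledMeasure_zero {T : Type*} (μ : Measure (T → ℝ)) [IsProbabilityMeasure μ] :
    scaledMeasure μ 0 = Measure.dirac 0 := by
  unfold scaledMeasure
  simp [Pi.zero_def, Measure.map_const]

lemma integrable_exp_mul_norm (μ : Measure (S → ℝ)) [IsGaussian μ] (c : ℝ) :
    Integrable (fun w => exp (c * ‖w‖)) μ := by
  obtain ⟨C, hC, hint⟩ := IsGaussian.exists_integrable_exp_sq μ
  refine (hint.const_mul (exp (c ^ 2 / (4 * C)))).mono' (by fun_prop) (.of_forall fun w => ?_)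
  rw [Real.norm_eq_abs, abs_of_pos (exp_pos _), ← exp_add]
  gcongr
  have : c ^ 2 / (4 * C) + C * ‖w‖ ^ 2 - c * ‖w‖ = (c - 2 * C * ‖w‖) ^ 2 / (4 * C) := by
    field_simp; ring
  have : 0 ≤ (c - 2 * C * ‖w‖) ^ 2 / (4 * C) := by positivity
  linarith

lemma integrable_norm_pow (μ : Measure (S → ℝ)) [IsGaussian μ] (k : ℕ) :
    Integrable (fun w => ‖w‖ ^ k) μ := by
  refine ((integrable_exp_mul_norm μ 1).const_mul (k.factorial : ℝ)).mono' (by fun_prop)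
    (.of_forall fun w => ?_)
  have := Real.pow_div_factorial_le_exp ‖w‖ (norm_nonneg _) k
  rw [div_le_iff₀ (by positivity)] at this
  rw [one_mul, Real.norm_eq_abs, abs_of_nonneg (by positivity)]
  linarith

lemma integrable_norm_pow_mul_exp (μ : Measure (S → ℝ)) [IsGaussian μ] (k : ℕ) :
    Integrable (fun w => ‖w‖ ^ k * exp ‖w‖) μ := by
  refine ((integrable_exp_mul_norm μ 2).const_mul (k.factorial : ℝ)).mono' (by fun_prop)
    (.of_forall fun w => ?_)
  have := Real.pow_div_factorial_le_exp ‖w‖ (norm_nonneg _) k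
  rw [div_le_iff₀ (by positivity)] at this
  rw [two_mul, exp_add, Real.norm_eq_abs, abs_of_nonneg (by positivity)]
  nlinarith [exp_pos ‖w‖]

/-- The Parisi step `F ↦ m⁻¹ log E exp (m F(· + w))`, with `w` of law `μ`. -/
def parisiStep (μ : Measure (S → ℝ)) (m : ℝ) (F : (S → ℝ) → ℝ) (x : S → ℝ) : ℝ :=
  1 / m * log (∫ w, exp (m * F (x + w)) ∂μ)

/-- One-sided form of being `1`-Lipschitz for the supremum norm. -/
def LipOne (F : (S → ℝ) → ℝ) : Prop := ∀ x y, F x ≤ F y + ‖x - y‖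

namespace LipOne

variable {F G : (S → ℝ) → ℝ} {μ ν : Measure (S → ℝ)} {m : ℝ}

lemma abs_sub_le (hF : LipOne F) (x y : S → ℝ) : |F x - F y| ≤ ‖x - y‖ := by
  rw [abs_sub_le_iff]
  have h1 := hF x y
  have h2 := hF y x
  rw [norm_sub_rev] at h2
  constructor <;> linarith

lemma continuous (hF : LipOne F) : Continuous F := by
  have : LipschitzWith 1 F := LipschitzWith.of_dist_le_mul fun x y => by
    simpa [dist_eq_norm] using hF.abs_sub_le x y
  exact this.continuous

lemma integrable_exp (hF : LipOne F) [IsGaussian μ] (m : ℝ) (x : S → ℝ) :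
    Integrable (fun w => exp (m * F (x + w))) μ := by
  have hc := hF.continuous
  refine ((integrable_exp_mul_norm μ |m|).const_mul (exp (m * F x))).mono' (by fun_prop)
    (.of_forall fun w => ?_)
  rw [Real.norm_eq_abs, abs_of_pos (exp_pos _), ← exp_add]
  gcongr
  have h1 := hF.abs_sub_le (x + w) x
  rw [add_sub_cancel_left] at h1
  have h2 : m * (F (x + w) - F x) ≤ |m| * ‖w‖ := by
    refine (le_abs_self _).trans ?_
    rw [abs_mul]; gcongr
  linarith

lemma integral_exp_pos (hF : LipOne F) [IsGaussian μ] (m : ℝ) (x : S → ℝ) :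
    0 < ∫ w, exp (m * F (x + w)) ∂μ :=
  MeasureTheory.integral_exp_pos (hF.integrable_exp m x)

lemma exp_parisiStep (hF : LipOne F) [IsGaussian μ] (hm : 0 < m) (x : S → ℝ) :
    exp (m * parisiStep μ m F x) = ∫ w, exp (m * F (x + w)) ∂μ := by
  rw [parisiStep, ← mul_assoc, mul_one_div_cancel hm.ne', one_mul,
    exp_log (hF.integral_exp_pos m x)]

lemma parisiStep_le (hF : LipOne F) (hG : LipOne G) [IsGaussian μ] (hm : 0 < m)
    {x y : S → ℝ} {c : ℝ} (h : ∀ w, F (x + w) ≤ G (y + w) + c) :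
    parisiStep μ m F x ≤ parisiStep μ m G y + c := by
  have h1 : exp (m * parisiStep μ m F x) ≤ exp (m * (parisiStep μ m G y + c)) := by
    rw [mul_add, exp_add, hF.exp_parisiStep hm, hG.exp_parisiStep hm, ← integral_mul_const]
    refine integral_mono (hF.integrable_exp m x) ((hG.integrable_exp m y).mul_const _) fun w => ?_
    dsimp only
    rw [← exp_add, ← mul_add]
    gcongr
    exact h w
  exact le_of_mul_le_mul_left (exp_le_exp.mp h1) hm

lemma parisiStep (hF : LipOne F) [IsGaussian μ] (hm : 0 < m) : LipOne (parisiStep μ m F) :=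
  fun x y => hF.parisiStep_le hF hm fun w => by simpa using hF (x + w) (y + w)

lemma parisiStep_parisiStep (hF : LipOne F) [IsGaussian μ] [IsGaussian ν] (hm : 0 < m) :
    _root_.parisiStep μ m (_root_.parisiStep ν m F) = _root_.parisiStep (μ ∗ ν) m F := by
  ext x
  rw [_root_.parisiStep, _root_.parisiStep, integral_conv (hF.integrable_exp m x)]
  simp_rw [hF.exp_parisiStep hm, add_assoc]

lemma parisiStep_comm (hF : LipOne F) [IsGaussian μ] [IsGaussian ν] (hm : 0 < m) :
    _root_.parisiStep μ m (_root_.parisiStep ν m F)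
      = _root_.parisiStep ν m (_root_.parisiStep μ m F) := by
  rw [hF.parisiStep_parisiStep hm, hF.parisiStep_parisiStep hm, Measure.conv_comm]

end LipOne

lemma parisiStep_scaledMeasure_zero (μ : Measure (S → ℝ)) [IsProbabilityMeasure μ] {m : ℝ}
    (hm : m ≠ 0) (F : (S → ℝ) → ℝ) : parisiStep (scaledMeasure μ 0) m F = F := by
  ext x
  simp [parisiStep, scaledMeasure_zero, hm]

lemma abs_dotProduct_le_norm {p : S → ℝ} (hp : p ∈ stdSimplex ℝ S) (v : S → ℝ) :
    |p ⬝ᵥ v| ≤ ‖v‖ := by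
  calc |p ⬝ᵥ v| ≤ ∑ σ, |p σ * v σ| := Finset.abs_sum_le_sum_abs _ _
    _ ≤ ∑ σ, p σ * ‖v‖ := by
        refine Finset.sum_le_sum fun σ _ => ?_
        rw [abs_mul, abs_of_nonneg (hp.1 σ)]
        exact mul_le_mul_of_nonneg_left (norm_le_pi_norm v σ) (hp.1 σ)
    _ = ‖v‖ := by rw [← Finset.sum_mul, hp.2, one_mul]

/-- `F` is `1`-Lipschitz and has a gradient field `P` with values in the standard simplex,
with a uniform quadratic bound on the first-order Taylor remainder. -/
structure HasSimplexGradient (c : ℝ) (F : (S → ℝ) → ℝ) (P : (S → ℝ) → S → ℝ) : Prop where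
  lip : LipOne F
  measurable : Measurable P
  mem : ∀ x, P x ∈ stdSimplex ℝ S
  approx : ∀ x v, |F (x + v) - F x - P x ⬝ᵥ v| ≤ c * ‖v‖ ^ 2

lemma abs_sub_integral_le_of_exp_eq {Ω : Type*} [MeasurableSpace Ω] (ν : Measure Ω)
    [IsProbabilityMeasure ν] {Y : Ω → ℝ} (hY : Measurable Y) {r m D : ℝ} (hr : r ≤ 1)
    (hYr : ∀ w, |Y w| ≤ r) (hm : 0 < m) (hm1 : m ≤ 1)
    (hD : exp (m * D) = ∫ w, exp (m * Y w) ∂ν) : |D - ∫ w, Y w ∂ν| ≤ r ^ 2 := by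
  have hYi : Integrable Y ν := Integrable.of_bound hY.aestronglyMeasurable r (.of_forall hYr)
  have hmY : ∀ w, |m * Y w| ≤ 1 := fun w => by
    rw [abs_mul, abs_of_pos hm]
    nlinarith [hYr w, abs_nonneg (Y w)]
  have hei : Integrable (fun w => exp (m * Y w)) ν :=
    Integrable.of_bound (by fun_prop) (exp 1) (.of_forall fun w => by
      rw [Real.norm_eq_abs, abs_of_pos (exp_pos _)]
      exact exp_le_exp.mpr (le_of_abs_le (hmY w)))
  set a := ∫ w, Y w ∂ν with ha
  have hYa : Integrable (fun w => Y w - a) ν := hYi.sub (integrable_const a)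
  have low : exp (m * a) ≤ exp (m * D) := by
    rw [hD]
    have h1 : ∫ w, exp (m * a) * (1 + m * (Y w - a)) ∂ν = exp (m * a) := by
      rw [integral_const_mul, integral_add (integrable_const _) (hYa.const_mul m),
        integral_const_mul, integral_sub hYi (integrable_const _)]
      simp [← ha]
    rw [← h1]
    refine integral_mono ?_ hei fun w => ?_
    · exact ((integrable_const 1).add (hYa.const_mul m)).const_mul _
    · have h2 : exp (m * Y w) = exp (m * a) * exp (m * (Y w - a)) := by
        rw [← exp_add]; ring_nf
      dsimp only
      rw [h2]
      gcongr
      linarith [add_one_le_exp (m * (Y w - a))]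
  have up : exp (m * D) ≤ exp (m * (a + r ^ 2)) := by
    rw [hD]
    calc ∫ w, exp (m * Y w) ∂ν ≤ ∫ w, (1 + m * r ^ 2 + m * Y w) ∂ν := by
          refine integral_mono hei ((integrable_const _).add (hYi.const_mul m)) fun w => ?_
          have h1 := le_of_abs_le (abs_exp_sub_one_sub_id_le (hmY w))
          have h2 : (m * Y w) ^ 2 ≤ m * r ^ 2 := by
            have h3 : Y w ^ 2 ≤ r ^ 2 := sq_le_sq' (neg_le_of_abs_le (hYr w)) (le_of_abs_le (hYr w))
            have h4 : m ^ 2 ≤ m := by nlinarith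
            rw [mul_pow]
            exact mul_le_mul h4 h3 (sq_nonneg _) hm.le
          dsimp only
          linarith
      _ = 1 + m * r ^ 2 + m * a := by
          rw [integral_add (integrable_const _) (hYi.const_mul m), integral_const_mul]
          simp [← ha]
      _ ≤ exp (m * (a + r ^ 2)) := by linarith [add_one_le_exp (m * (a + r ^ 2))]
  have l := le_of_mul_le_mul_left (exp_le_exp.mp low) hm
  have u := le_of_mul_le_mul_left (exp_le_exp.mp up) hm
  rw [abs_le]
  constructor <;> nlinarith [sq_nonneg r]

namespace HasSimplexGradient

variable {F G : (S → ℝ) → ℝ} {P Q : (S → ℝ) → S → ℝ} {μ ν : Measure (S → ℝ)} {m c c' : ℝ}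

lemma mono (hF : HasSimplexGradient c F P) (hcc : c ≤ c') : HasSimplexGradient c' F P where
  lip := hF.lip
  measurable := hF.measurable
  mem := hF.mem
  approx := fun x v => (hF.approx x v).trans (by gcongr)

lemma integrable_gradient (hF : HasSimplexGradient c F P) [IsProbabilityMeasure ν] (x : S → ℝ)
    (σ : S) : Integrable (fun w => P (x + w) σ) ν := by
  have := hF.measurable
  refine Integrable.of_bound (Measurable.aestronglyMeasurable (by fun_prop)) 1
    (.of_forall fun w => ?_)
  have := mem_Icc_of_mem_stdSimplex (hF.mem (x + w)) σ
  rw [Real.norm_eq_abs, abs_of_nonneg this.1]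
  exact this.2

lemma parisiStep (hF : HasSimplexGradient c F P) (hc : 0 ≤ c) [IsGaussian μ] (hm : 0 < m)
    (hm1 : m ≤ 1) :
    HasSimplexGradient (c + 2) (parisiStep μ m F)
      (fun x σ => ∫ w, P (x + w) σ ∂μ.tilted fun w => m * F (x + w)) := by
  have hprob : ∀ x, IsProbabilityMeasure (μ.tilted fun w => m * F (x + w)) := fun x =>
    isProbabilityMeasure_tilted (hF.lip.integrable_exp m x)
  have hFc := hF.lip.continuous
  have hPm := hF.measurable
  have hmem : ∀ x, (fun σ => ∫ w, P (x + w) σ ∂μ.tilted fun w => m * F (x + w))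
      ∈ stdSimplex ℝ S := fun x => by
    have := hprob x
    refine ⟨fun σ => integral_nonneg fun w => (hF.mem _).1 σ, ?_⟩
    rw [← integral_finsetSum _ fun σ _ => hF.integrable_gradient x σ]
    simp [(hF.mem _).2]
  have hlip := hF.lip.parisiStep (μ := μ) hm
  refine ⟨hlip, ?_, hmem, fun x v => ?_⟩
  · refine measurable_pi_lambda _ fun σ => ?_
    simp_rw [integral_tilted]
    refine StronglyMeasurable.measurable ?_
    refine StronglyMeasurable.integral_prod_right (f := fun x w =>
      (rexp (m * F (x + w)) / ∫ w, rexp (m * F (x + w)) ∂μ) • P (x + w) σ) ?_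
    refine Measurable.stronglyMeasurable ?_
    have hZ : Measurable fun x => ∫ w, rexp (m * F (x + w)) ∂μ := by
      refine StronglyMeasurable.measurable (StronglyMeasurable.integral_prod_right
        (f := fun x w => rexp (m * F (x + w))) ?_)
      refine Continuous.stronglyMeasurable ?_
      unfold Function.uncurry
      fun_prop
    unfold Function.uncurry
    have hPσ : Measurable fun p : (S → ℝ) × (S → ℝ) => P (p.1 + p.2) σ := by fun_prop
    have hE : Measurable fun p : (S → ℝ) × (S → ℝ) => rexp (m * F (p.1 + p.2)) :=
      Continuous.measurable (by fun_prop)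
    exact (hE.div (hZ.comp measurable_fst)).smul hPσ
  · have h1 := abs_dotProduct_le_norm (hmem x) v
    rcases le_or_gt ‖v‖ 1 with hv | hv
    · have := hprob x
      set ρ := μ.tilted fun w => m * F (x + w) with hρ
      have hYb : ∀ w, |F (x + v + w) - F (x + w)| ≤ ‖v‖ := fun w => by
        have := hF.lip.abs_sub_le (x + v + w) (x + w)
        rwa [show x + v + w - (x + w) = v by abel] at this
      have hYm : Measurable fun w => F (x + v + w) - F (x + w) :=
        Continuous.measurable (by fun_prop)
      have key := abs_sub_integral_le_of_exp_eq ρ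
        (Y := fun w => F (x + v + w) - F (x + w)) (r := ‖v‖) (m := m)
        (D := _root_.parisiStep μ m F (x + v) - _root_.parisiStep μ m F x)
        hYm hv hYb hm hm1 (by
          rw [hρ, integral_exp_tilted, mul_sub, exp_sub, hF.lip.exp_parisiStep hm,
            hF.lip.exp_parisiStep hm]
          congr 1
          refine integral_congr_ae (.of_forall fun w => ?_)
          change _ = rexp (m * F (x + w) + m * (F (x + v + w) - F (x + w)))
          ring_nf)
      have hYi : Integrable (fun w => F (x + v + w) - F (x + w)) ρ :=
        Integrable.of_bound hYm.aestronglyMeasurable ‖v‖ (.of_forall hYb)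
      have h2 : (fun σ => ∫ w, P (x + w) σ ∂ρ) ⬝ᵥ v = ∫ w, P (x + w) ⬝ᵥ v ∂ρ := by
        simp only [dotProduct]
        rw [integral_finsetSum _ fun σ _ => (hF.integrable_gradient x σ).mul_const _]
        simp_rw [integral_mul_const]
      have hPi : Integrable (fun w => P (x + w) ⬝ᵥ v) ρ := by
        simp only [dotProduct]
        exact integrable_finsetSum _ fun σ _ => (hF.integrable_gradient x σ).mul_const _
      have h3 : |(∫ w, (F (x + v + w) - F (x + w)) ∂ρ) - ∫ w, P (x + w) ⬝ᵥ v ∂ρ|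
          ≤ c * ‖v‖ ^ 2 := by
        rw [← integral_sub hYi hPi]
        have hb : ∀ w, ‖F (x + v + w) - F (x + w) - P (x + w) ⬝ᵥ v‖ ≤ c * ‖v‖ ^ 2 := fun w => by
          have := hF.approx (x + w) v
          rwa [add_right_comm] at this
        simpa using norm_integral_le_of_norm_le_const (μ := ρ) (.of_forall hb)
      rw [h2]
      have h4 := abs_le.mp h3
      have h5 := abs_le.mp key
      rw [abs_le]
      constructor <;> nlinarith [sq_nonneg ‖v‖]
    · have h2 := hlip.abs_sub_le (x + v) x
      rw [add_sub_cancel_left] at h2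
      have h4 := abs_le.mp h1
      have h5 := abs_le.mp h2
      have h6 : 0 ≤ c * ‖v‖ ^ 2 := by positivity
      rw [abs_le]
      constructor <;> nlinarith

lemma abs_dotProduct_sub_le (hF : HasSimplexGradient c F P) (hG : HasSimplexGradient c G Q)
    {K s : ℝ} (hs : 0 < s) (hFG : ∀ x, |G x - F x| ≤ K * s) (x w : S → ℝ) :
    |Q x ⬝ᵥ w - P x ⬝ᵥ w| ≤ (2 * K + 2 * c) * √s * ‖w‖ := by
  rcases eq_or_ne w 0 with rfl | hw
  · simp
  have hw' : 0 < ‖w‖ := norm_pos_iff.mpr hw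
  have hs' : 0 < √s := Real.sqrt_pos.mpr hs
  have hss : √s ^ 2 = s := Real.sq_sqrt hs.le
  have hn : ‖(√s / ‖w‖) • w‖ = √s := by
    rw [norm_smul, Real.norm_eq_abs, abs_of_pos (by positivity)]
    field_simp
  have h1 := hF.approx x ((√s / ‖w‖) • w)
  have h2 := hG.approx x ((√s / ‖w‖) • w)
  rw [hn, hss, dotProduct_smul, smul_eq_mul] at h1 h2
  have h3 := hFG x
  have h4 := hFG (x + (√s / ‖w‖) • w)
  have h5 : |√s / ‖w‖ * (Q x ⬝ᵥ w - P x ⬝ᵥ w)| ≤ (2 * K + 2 * c) * s := by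
    rw [abs_le] at *
    constructor <;> nlinarith
  rw [abs_mul, abs_of_pos (by positivity), ← mul_le_mul_iff_right₀ (show 0 < ‖w‖ by positivity)] at h5
  rw [← mul_le_mul_iff_right₀ hs']
  calc √s * |Q x ⬝ᵥ w - P x ⬝ᵥ w| = ‖w‖ * (√s / ‖w‖ * |Q x ⬝ᵥ w - P x ⬝ᵥ w|) := by field_simp
    _ ≤ _ := h5
    _ = _ := by nth_rewrite 1 [← hss]; ring

end HasSimplexGradient

lemma abs_exp_sub_quadratic_le (u : ℝ) :
    |exp u - 1 - u - u ^ 2 / 2| ≤ |u| ^ 3 * exp |u| := by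
  have h := Complex.norm_exp_sub_sum_le_norm_mul_exp (u : ℂ) 3
  simp only [Finset.sum_range_succ, Finset.sum_range_zero, Complex.norm_real, Real.norm_eq_abs] at h
  rw [← Real.norm_eq_abs, ← Complex.norm_real]
  convert h using 2
  push_cast
  norm_num [Nat.factorial]
  ring

lemma abs_log_sub_le {A a : ℝ} (ha : 0 < a) (hA : a ≤ A) : |log A - (A - 1)| ≤ (A - 1) ^ 2 / a := by
  have hA' : 0 < A := ha.trans_le hA
  have h1 := Real.log_le_sub_one_of_pos hA'
  have h2 := Real.one_sub_inv_le_log_of_pos hA'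
  have h3 : (A - 1) - (1 - A⁻¹) = (A - 1) ^ 2 / A := by field_simp
  have h4 : (A - 1) ^ 2 / A ≤ (A - 1) ^ 2 / a := by gcongr
  rw [abs_le]
  constructor <;> linarith [div_nonneg (sq_nonneg (A - 1)) ha.le]

lemma abs_log_div_sub_le {A a e v m δ k₁ k₂ k₃ : ℝ} (hm : 0 < m) (hm1 : m ≤ 1) (hδ0 : 0 ≤ δ)
    (hδ1 : δ ≤ 1) (ha0 : 0 < a) (haA : a ≤ A) (hk₃ : 0 ≤ k₃)
    (heb : |e| ≤ k₁ * δ ^ 2) (hv0 : 0 ≤ v) (hvb : v ≤ δ ^ 2 * k₂)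
    (hA1 : |A - 1 - m * e - m ^ 2 / 2 * v| ≤ m * δ ^ 3 * k₃) :
    |log A / m - e - m / 2 * v| ≤ ((k₁ + k₂ + k₃) ^ 2 / a + k₃) * δ ^ 3 := by
  set B := k₁ + k₂ + k₃ with hB
  have hAB : |A - 1| ≤ m * δ ^ 2 * B := by
    have h1 : |m * e| ≤ m * (k₁ * δ ^ 2) := by
      rw [abs_mul, abs_of_pos hm]; gcongr
    have h2 : |m ^ 2 / 2 * v| ≤ m * (δ ^ 2 * k₂) := by
      rw [abs_of_nonneg (by positivity)]
      have : m ^ 2 / 2 ≤ m := by nlinarith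
      gcongr
    have h4 : m * δ ^ 3 * k₃ ≤ m * δ ^ 2 * k₃ := by
      have : δ ^ 3 ≤ δ ^ 2 := pow_le_pow_of_le_one hδ0 hδ1 (by norm_num)
      gcongr
    calc |A - 1| = |(A - 1 - m * e - m ^ 2 / 2 * v) + (m * e + m ^ 2 / 2 * v)| := by ring_nf
      _ ≤ m * δ ^ 2 * k₃ + (m * (k₁ * δ ^ 2) + m * (δ ^ 2 * k₂)) :=
        (abs_add_le _ _).trans (add_le_add (hA1.trans h4)
          ((abs_add_le _ _).trans (add_le_add h1 h2)))
      _ = _ := by rw [hB]; ring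
  have hsq : (A - 1) ^ 2 / a ≤ m * (B ^ 2 / a * δ ^ 3) := by
    have h1 : (A - 1) ^ 2 ≤ (m * δ ^ 2 * B) ^ 2 := by
      rw [← sq_abs]; exact pow_le_pow_left₀ (abs_nonneg _) hAB 2
    have h2 : m ^ 2 * δ ^ 4 ≤ m * δ ^ 3 :=
      mul_le_mul (by nlinarith) (pow_le_pow_of_le_one hδ0 hδ1 (by norm_num)) (by positivity) hm.le
    calc (A - 1) ^ 2 / a ≤ (m * δ ^ 2 * B) ^ 2 / a := by gcongr
      _ = m ^ 2 * δ ^ 4 * (B ^ 2 / a) := by ring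
      _ ≤ m * δ ^ 3 * (B ^ 2 / a) := by gcongr
      _ = _ := by ring
  have h1 : log A / m - e - m / 2 * v
      = ((log A - (A - 1)) + (A - 1 - m * e - m ^ 2 / 2 * v)) / m := by field_simp; ring
  rw [h1, abs_div, abs_of_pos hm, div_le_iff₀ hm]
  refine (abs_add_le _ _).trans ((add_le_add ((abs_log_sub_le ha0 haA).trans hsq) hA1).trans ?_)
  exact le_of_eq (by ring)

lemma integral_dotProduct_eq_zero (μ : Measure (S → ℝ))
    (hμ : ∀ L : StrongDual ℝ (S → ℝ), μ[L] = 0) (p : S → ℝ) : ∫ w, p ⬝ᵥ w ∂μ = 0 := by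
  have := hμ (∑ σ, p σ • ContinuousLinearMap.proj (R := ℝ) σ)
  simpa [dotProduct] using this

lemma integrable_dotProduct_sq (μ : Measure (S → ℝ)) [IsGaussian μ] {p : S → ℝ}
    (hp : p ∈ stdSimplex ℝ S) : Integrable (fun w => (p ⬝ᵥ w) ^ 2) μ := by
  refine (integrable_norm_pow μ 2).mono' (Continuous.aestronglyMeasurable ?_)
    (.of_forall fun w => ?_)
  · simp only [dotProduct]; fun_prop
  · rw [norm_pow, Real.norm_eq_abs]
    exact pow_le_pow_left₀ (abs_nonneg _) (abs_dotProduct_le_norm hp w) 2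

lemma exists_parisiStep_expansion (μ : Measure (S → ℝ)) [IsGaussian μ]
    (hμ : ∀ L : StrongDual ℝ (S → ℝ), μ[L] = 0) {c : ℝ} (hc : 0 ≤ c) :
    ∃ C, 0 ≤ C ∧ ∀ F P, HasSimplexGradient c F P → ∀ s, 0 ≤ s → s ≤ 1 → ∀ x,
      |∫ w, F (x + √s • w) ∂μ - F x| ≤ C * s ∧ ∀ m, 0 < m → m ≤ 1 →
      |parisiStep (scaledMeasure μ s) m F x - ∫ w, F (x + √s • w) ∂μ
        - m / 2 * (s * ∫ w, (P x ⬝ᵥ w) ^ 2 ∂μ)| ≤ C * (s * √s) := by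
  have hi2 := integrable_norm_pow μ 2
  have hi3 := integrable_norm_pow μ 3
  have hi3e := integrable_norm_pow_mul_exp μ 3
  have hie := integrable_exp_mul_norm μ (-1)
  set M₂ := ∫ w, ‖w‖ ^ 2 ∂μ with hM₂
  set M₃ := ∫ w, ‖w‖ ^ 3 ∂μ with hM₃
  set M := ∫ w, ‖w‖ ^ 3 * exp ‖w‖ ∂μ with hM
  set a := ∫ w, exp (-1 * ‖w‖) ∂μ with ha
  have ha0 : 0 < a := integral_exp_pos hie
  have hM₂0 : 0 ≤ M₂ := integral_nonneg fun w => by positivity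
  have hM₃0 : 0 ≤ M₃ := integral_nonneg fun w => by positivity
  have hM0 : 0 ≤ M := integral_nonneg fun w => by positivity
  set B := c * M₂ + M₂ + M with hB
  have hB0 : 0 ≤ B := by positivity
  refine ⟨B ^ 2 / a + M + 2 * c * M₃ + c * M₂, by positivity, fun F P hF s hs0 hs1 x => ?_⟩
  have hFc := hF.lip.continuous
  set δ := √s with hδ
  have hδ0 : 0 ≤ δ := Real.sqrt_nonneg s
  have hδ1 : δ ≤ 1 := Real.sqrt_le_one.mpr hs1
  have hδs : s = δ ^ 2 := (Real.sq_sqrt hs0).symm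
  set X : (S → ℝ) → ℝ := fun w => F (x + δ • w) - F x with hX
  have hXc : Continuous X := by fun_prop
  have hXb : ∀ w, |X w| ≤ δ * ‖w‖ := fun w => by
    have := hF.lip.abs_sub_le (x + δ • w) x
    rwa [add_sub_cancel_left, norm_smul, Real.norm_eq_abs, abs_of_nonneg hδ0] at this
  have hXb' : ∀ w, |X w| ≤ ‖w‖ := fun w => (hXb w).trans (by nlinarith [norm_nonneg w])
  have hPw : ∀ w, |P x ⬝ᵥ w| ≤ ‖w‖ := abs_dotProduct_le_norm (hF.mem x)
  have hPc : Continuous fun w => P x ⬝ᵥ w := by simp only [dotProduct]; fun_prop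
  have hXP : ∀ w, |X w - δ * (P x ⬝ᵥ w)| ≤ c * δ ^ 2 * ‖w‖ ^ 2 := fun w => by
    have := hF.approx x (δ • w)
    rwa [dotProduct_smul, norm_smul, Real.norm_eq_abs, abs_of_nonneg hδ0, mul_pow, ← mul_assoc,
      smul_eq_mul] at this
  have hi1 : Integrable (fun w => ‖w‖) μ := by simpa using integrable_norm_pow μ 1
  have hXi : Integrable X μ := hi1.mono' hXc.aestronglyMeasurable (.of_forall hXb')
  have hX2i : Integrable (fun w => X w ^ 2) μ :=
    hi2.mono' (hXc.pow 2).aestronglyMeasurable (.of_forall fun w => by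
      rw [norm_pow]; exact pow_le_pow_left₀ (norm_nonneg _) (hXb' w) 2)
  have hPi : Integrable (fun w => P x ⬝ᵥ w) μ :=
    hi1.mono' hPc.aestronglyMeasurable (.of_forall hPw)
  have hP2i := integrable_dotProduct_sq μ (hF.mem x)
  set e := ∫ w, X w ∂μ with he
  set v := ∫ w, X w ^ 2 ∂μ with hv
  have he' : ∫ w, F (x + δ • w) ∂μ = F x + e := by
    have : (fun w => F (x + δ • w)) = fun w => F x + X w := by ext w; simp [hX]
    rw [this, integral_add (integrable_const _) hXi]
    simp [← he]
  have heb : |e| ≤ c * M₂ * δ ^ 2 := by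
    have h1 : e = ∫ w, (X w - δ * (P x ⬝ᵥ w)) ∂μ := by
      rw [integral_sub hXi (hPi.const_mul _), integral_const_mul,
        integral_dotProduct_eq_zero μ hμ, mul_zero, sub_zero]
    have hb : ∀ w, ‖X w - δ * (P x ⬝ᵥ w)‖ ≤ c * δ ^ 2 * ‖w‖ ^ 2 := hXP
    rw [h1]
    refine (norm_integral_le_of_norm_le (hi2.const_mul (c * δ ^ 2))
      (.of_forall hb)).trans (le_of_eq ?_)
    rw [integral_const_mul]; ring
  have hv0 : 0 ≤ v := integral_nonneg fun w => sq_nonneg _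
  have hvb : v ≤ δ ^ 2 * M₂ := by
    rw [hv, hM₂, ← integral_const_mul]
    refine integral_mono hX2i (hi2.const_mul _) fun w => ?_
    dsimp only
    rw [← mul_pow, ← sq_abs]
    exact pow_le_pow_left₀ (abs_nonneg _) (hXb w) 2
  have hvP : |v - δ ^ 2 * ∫ w, (P x ⬝ᵥ w) ^ 2 ∂μ| ≤ 2 * c * M₃ * δ ^ 3 := by
    rw [hv, ← integral_const_mul, ← integral_sub hX2i (hP2i.const_mul _)]
    have hb : ∀ w, ‖X w ^ 2 - δ ^ 2 * (P x ⬝ᵥ w) ^ 2‖ ≤ 2 * c * δ ^ 3 * ‖w‖ ^ 3 := fun w => by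
      have h1 : X w ^ 2 - δ ^ 2 * (P x ⬝ᵥ w) ^ 2
          = (X w - δ * (P x ⬝ᵥ w)) * (X w + δ * (P x ⬝ᵥ w)) := by ring
      have h2 : |X w + δ * (P x ⬝ᵥ w)| ≤ 2 * δ * ‖w‖ := by
        refine (abs_add_le _ _).trans ?_
        rw [abs_mul, abs_of_nonneg hδ0]
        nlinarith [hXb w, mul_le_mul_of_nonneg_left (hPw w) hδ0]
      rw [h1, Real.norm_eq_abs, abs_mul]
      calc _ ≤ (c * δ ^ 2 * ‖w‖ ^ 2) * (2 * δ * ‖w‖) :=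
            mul_le_mul (hXP w) h2 (abs_nonneg _) (by positivity)
        _ = _ := by ring
    refine (norm_integral_le_of_norm_le (hi3.const_mul (2 * c * δ ^ 3))
      (.of_forall hb)).trans (le_of_eq ?_)
    rw [integral_const_mul]; ring
  rw [he', hδs]
  refine ⟨?_, fun m hm hm1 => ?_⟩
  · rw [add_sub_cancel_left]
    refine heb.trans ?_
    gcongr
    linarith [show 0 ≤ B ^ 2 / a + M + 2 * c * M₃ by positivity]
  have hmX : ∀ w, |m * X w| ≤ ‖w‖ := fun w => by
    rw [abs_mul, abs_of_pos hm]
    exact (mul_le_of_le_one_left (abs_nonneg _) hm1).trans (hXb' w)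
  have hexpi : Integrable (fun w => exp (m * X w)) μ := by
    refine (integrable_exp_mul_norm μ 1).mono' (by fun_prop) (.of_forall fun w => ?_)
    rw [Real.norm_eq_abs, abs_of_pos (exp_pos _)]
    rw [one_mul]
    exact exp_le_exp.mpr (le_of_abs_le (hmX w))
  set A := ∫ w, exp (m * X w) ∂μ with hA
  have haA : a ≤ A := by
    refine integral_mono hie hexpi fun w => ?_
    dsimp only
    rw [neg_one_mul]
    exact exp_le_exp.mpr (neg_le_of_abs_le (hmX w))
  have hstep : parisiStep (scaledMeasure μ (δ ^ 2)) m F x = F x + log A / m := by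
    have h1 : exp (m * parisiStep (scaledMeasure μ (δ ^ 2)) m F x) = exp (m * F x) * A := by
      rw [hF.lip.exp_parisiStep hm, integral_scaledMeasure _ _ (by fun_prop), hA,
        ← integral_const_mul, Real.sqrt_sq hδ0]
      congr 1
      ext w
      rw [← exp_add]
      simp only [hX]
      ring_nf
    have h2 := congrArg log h1
    rw [log_exp, log_mul (exp_pos _).ne' (ha0.trans_le haA).ne', log_exp] at h2
    field_simp
    linarith
  have hA1 : |A - 1 - m * e - m ^ 2 / 2 * v| ≤ m * δ ^ 3 * M := by
    have h1 : A - 1 - m * e - m ^ 2 / 2 * v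
        = ∫ w, (exp (m * X w) - 1 - m * X w - m ^ 2 / 2 * X w ^ 2) ∂μ := by
      have i1 : Integrable (fun w => exp (m * X w) - 1) μ := hexpi.sub (integrable_const 1)
      have i2 : Integrable (fun w => exp (m * X w) - 1 - m * X w) μ := i1.sub (hXi.const_mul m)
      rw [integral_sub i2 (hX2i.const_mul _), integral_sub i1 (hXi.const_mul m),
        integral_sub hexpi (integrable_const 1), integral_const_mul, integral_const_mul]
      simp [← hA, ← he, ← hv]
    rw [h1]
    have hb : ∀ w, ‖exp (m * X w) - 1 - m * X w - m ^ 2 / 2 * X w ^ 2‖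
        ≤ m * δ ^ 3 * (‖w‖ ^ 3 * exp ‖w‖) := fun w => by
      have h2 := abs_exp_sub_quadratic_le (m * X w)
      rw [show (m * X w) ^ 2 / 2 = m ^ 2 / 2 * X w ^ 2 by ring] at h2
      refine h2.trans ?_
      rw [abs_mul, abs_of_pos hm]
      have h3 : m * |X w| ≤ ‖w‖ :=
        (mul_le_of_le_one_left (abs_nonneg _) hm1).trans (hXb' w)
      have h4 : (m * |X w|) ^ 3 ≤ m * δ ^ 3 * ‖w‖ ^ 3 := by
        have h5 : |X w| ^ 3 ≤ (δ * ‖w‖) ^ 3 := pow_le_pow_left₀ (abs_nonneg _) (hXb w) 3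
        have h6 : m ^ 3 ≤ m := pow_le_of_le_one hm.le hm1 (by norm_num)
        calc (m * |X w|) ^ 3 = m ^ 3 * |X w| ^ 3 := by ring
          _ ≤ m * (δ * ‖w‖) ^ 3 := mul_le_mul h6 h5 (by positivity) hm.le
          _ = _ := by ring
      calc _ ≤ m * δ ^ 3 * ‖w‖ ^ 3 * exp ‖w‖ := by gcongr
        _ = _ := by ring
    refine (norm_integral_le_of_norm_le (hi3e.const_mul (m * δ ^ 3))
      (.of_forall hb)).trans (le_of_eq ?_)
    rw [integral_const_mul]
  have hfin' := abs_log_div_sub_le hm hm1 hδ0 hδ1 ha0 haA hM0 heb hv0 hvb hA1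
  rw [← hB] at hfin'
  rw [hstep]
  have hvP' : |m / 2 * v - m / 2 * (δ ^ 2 * ∫ w, (P x ⬝ᵥ w) ^ 2 ∂μ)| ≤ 2 * c * M₃ * δ ^ 3 := by
    rw [← mul_sub, abs_mul, abs_of_pos (by positivity)]
    nlinarith [abs_nonneg (v - δ ^ 2 * ∫ w, (P x ⬝ᵥ w) ^ 2 ∂μ)]
  have hlast : 0 ≤ c * M₂ * δ ^ 3 := by positivity
  have hsplit : F x + log A / m - (F x + e) - m / 2 * (δ ^ 2 * ∫ w, (P x ⬝ᵥ w) ^ 2 ∂μ)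
      = (log A / m - e - m / 2 * v)
        + (m / 2 * v - m / 2 * (δ ^ 2 * ∫ w, (P x ⬝ᵥ w) ^ 2 ∂μ)) := by ring
  rw [hsplit, show δ ^ 2 * δ = δ ^ 3 by ring]
  refine (abs_add_le _ _).trans ((add_le_add hfin' hvP').trans ?_)
  linarith

lemma abs_integral_dotProduct_sq_sub_le (μ : Measure (S → ℝ)) [IsGaussian μ] {p p' : S → ℝ}
    (hp : p ∈ stdSimplex ℝ S) (hp' : p' ∈ stdSimplex ℝ S) {r : ℝ}
    (h : ∀ w, |p ⬝ᵥ w - p' ⬝ᵥ w| ≤ r * ‖w‖) :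
    |∫ w, (p ⬝ᵥ w) ^ 2 ∂μ - ∫ w, (p' ⬝ᵥ w) ^ 2 ∂μ| ≤ 2 * r * ∫ w, ‖w‖ ^ 2 ∂μ := by
  have hb : ∀ w, ‖(p ⬝ᵥ w) ^ 2 - (p' ⬝ᵥ w) ^ 2‖ ≤ 2 * r * ‖w‖ ^ 2 := fun w => by
    rw [Real.norm_eq_abs, sq_sub_sq, abs_mul]
    have h1 : |p ⬝ᵥ w + p' ⬝ᵥ w| ≤ 2 * ‖w‖ := by
      refine (abs_add_le _ _).trans ?_
      linarith [abs_dotProduct_le_norm hp w, abs_dotProduct_le_norm hp' w]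
    calc _ ≤ 2 * ‖w‖ * (r * ‖w‖) := mul_le_mul h1 (h w) (abs_nonneg _) (by positivity)
      _ = _ := by ring
  rw [← integral_sub (integrable_dotProduct_sq μ hp) (integrable_dotProduct_sq μ hp'),
    ← integral_const_mul]
  exact norm_integral_le_of_norm_le ((integrable_norm_pow μ 2).const_mul (2 * r)) (.of_forall hb)

lemma exists_parisiStep_exponent_change (μ ν : Measure (S → ℝ)) [IsGaussian μ] [IsGaussian ν]
    (hμ : ∀ L : StrongDual ℝ (S → ℝ), μ[L] = 0) (hν : ∀ L : StrongDual ℝ (S → ℝ), ν[L] = 0)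
    {q κ c K : ℝ} (hq : 0 ≤ q) (hq1 : q ≤ 1) (hc : 0 ≤ c) (hK : 0 ≤ K)
    (hκ : ∀ p ∈ stdSimplex ℝ S,
      q * ∫ w, (p ⬝ᵥ w) ^ 2 ∂ν - ∫ w, (p ⬝ᵥ w) ^ 2 ∂μ ≤ 2 * κ) :
    ∃ C, 0 ≤ C ∧ ∀ F P G Q, HasSimplexGradient c F P → HasSimplexGradient c G Q →
      ∀ s, 0 < s → s ≤ 1 → (∀ x, |G x - F x| ≤ K * s) →
      ∀ m m', 0 < m' → m' ≤ m → m ≤ 1 → ∀ x,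
      parisiStep (scaledMeasure μ s) m' G x - parisiStep (scaledMeasure μ s) m G x
        ≤ parisiStep (scaledMeasure ν (s * q)) m' F x - parisiStep (scaledMeasure ν (s * q)) m F x
          + (m - m') * κ * s + C * (s * √s) := by
  obtain ⟨C₁, hC₁, h₁⟩ := exists_parisiStep_expansion μ hμ hc
  obtain ⟨C₂, hC₂, h₂⟩ := exists_parisiStep_expansion ν hν hc
  have hM : 0 ≤ ∫ w, ‖w‖ ^ 2 ∂μ := integral_nonneg fun w => by positivity
  refine ⟨2 * C₁ + 2 * C₂ + (2 * K + 2 * c) * ∫ w, ‖w‖ ^ 2 ∂μ, by positivity, ?_⟩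
  intro F P G Q hF hG s hs hs1 hFG m m' hm' hmm hm1 x
  have hm : 0 < m := hm'.trans_le hmm
  have hsq0 : 0 ≤ s * q := by positivity
  have hsqs : s * q ≤ s := mul_le_of_le_one_right hs.le hq1
  have e1 := (h₁ G Q hG s hs.le hs1 x).2 m hm hm1
  have e2 := (h₁ G Q hG s hs.le hs1 x).2 m' hm' (hmm.trans hm1)
  have e3 := (h₂ F P hF (s * q) hsq0 (hsqs.trans hs1) x).2 m hm hm1
  have e4 := (h₂ F P hF (s * q) hsq0 (hsqs.trans hs1) x).2 m' hm' (hmm.trans hm1)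
  have hr : s * q * √(s * q) ≤ s * √s :=
    mul_le_mul hsqs (Real.sqrt_le_sqrt hsqs) (Real.sqrt_nonneg _) hs.le
  have hr2 : C₂ * (s * q * √(s * q)) ≤ C₂ * (s * √s) := by gcongr
  have hV := le_of_abs_le (abs_integral_dotProduct_sq_sub_le μ (hF.mem x) (hG.mem x)
    (r := (2 * K + 2 * c) * √s) fun w => by
      rw [abs_sub_comm]; exact hF.abs_dotProduct_sub_le hG hs hFG x w)
  have hk := hκ _ (hF.mem x)
  have a1 := neg_le_of_abs_le e1
  have a2 := le_of_abs_le e2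
  have a3 := le_of_abs_le e3
  have a4 := neg_le_of_abs_le e4
  clear e1 e2 e3 e4 h₁ h₂
  set VF := ∫ w, (P x ⬝ᵥ w) ^ 2 ∂μ
  set VG := ∫ w, (Q x ⬝ᵥ w) ^ 2 ∂μ
  set WF := ∫ w, (P x ⬝ᵥ w) ^ 2 ∂ν
  set M := ∫ w, ‖w‖ ^ 2 ∂μ
  have key : (m - m') / 2 * s * (q * WF - VG)
      ≤ (m - m') * κ * s + (2 * K + 2 * c) * M * (s * √s) := by
    have b1 : q * WF - VG ≤ 2 * κ + 2 * ((2 * K + 2 * c) * √s) * M := by linarith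
    have b2 : 0 ≤ (m - m') / 2 * s := mul_nonneg (by linarith) hs.le
    have b3 : 0 ≤ (2 * K + 2 * c) * M * (s * √s) := by positivity
    have b4 : (m - m') * ((2 * K + 2 * c) * M * (s * √s)) ≤ (2 * K + 2 * c) * M * (s * √s) :=
      mul_le_of_le_one_left b3 (by linarith)
    have b5 := mul_le_mul_of_nonneg_left b1 b2
    linarith
  linarith

lemma exists_abs_parisiStep_sub_le (μ : Measure (S → ℝ)) [IsGaussian μ]
    (hμ : ∀ L : StrongDual ℝ (S → ℝ), μ[L] = 0) {c : ℝ} (hc : 0 ≤ c) :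
    ∃ C, 0 ≤ C ∧ ∀ F P, HasSimplexGradient c F P → ∀ s, 0 ≤ s → s ≤ 1 → ∀ m, 0 < m → m ≤ 1 →
      ∀ x, |parisiStep (scaledMeasure μ s) m F x - F x| ≤ C * s := by
  obtain ⟨C, hC, h⟩ := exists_parisiStep_expansion μ hμ hc
  have hM : 0 ≤ ∫ w, ‖w‖ ^ 2 ∂μ := integral_nonneg fun w => by positivity
  refine ⟨2 * C + ∫ w, ‖w‖ ^ 2 ∂μ, by positivity, fun F P hF s hs hs1 m hm hm1 x => ?_⟩
  obtain ⟨h1, h2⟩ := h F P hF s hs hs1 x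
  have h3 := h2 m hm hm1
  have hV0 : 0 ≤ ∫ w, (P x ⬝ᵥ w) ^ 2 ∂μ := integral_nonneg fun w => sq_nonneg _
  have hV : ∫ w, (P x ⬝ᵥ w) ^ 2 ∂μ ≤ ∫ w, ‖w‖ ^ 2 ∂μ := by
    refine integral_mono (integrable_dotProduct_sq μ (hF.mem x)) (integrable_norm_pow μ 2)
      fun w => ?_
    dsimp only
    rw [← sq_abs]
    exact pow_le_pow_left₀ (abs_nonneg _) (abs_dotProduct_le_norm (hF.mem x) w) 2
  have h4 : s * √s ≤ s := mul_le_of_le_one_right hs (Real.sqrt_le_one.mpr hs1)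
  have h5 : C * (s * √s) ≤ C * s := by gcongr
  have h6 : m / 2 * (s * ∫ w, (P x ⬝ᵥ w) ^ 2 ∂μ) ≤ (∫ w, ‖w‖ ^ 2 ∂μ) * s := by
    calc _ ≤ 1 * (s * ∫ w, ‖w‖ ^ 2 ∂μ) := by gcongr; linarith
      _ = _ := by ring
  have h7 : 0 ≤ m / 2 * (s * ∫ w, (P x ⬝ᵥ w) ^ 2 ∂μ) := by positivity
  have a1 := abs_le.mp h1
  have a3 := abs_le.mp h3
  rw [abs_le]
  constructor <;> linarith

lemma parisiStep_scaledMeasure_add (μ : Measure (S → ℝ)) [IsGaussian μ]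
    (hμ : ∀ L : StrongDual ℝ (S → ℝ), μ[L] = 0) {F : (S → ℝ) → ℝ} (hF : LipOne F) {m s t : ℝ}
    (hm : 0 < m) (hs : 0 ≤ s) (ht : 0 ≤ t) :
    parisiStep (scaledMeasure μ s) m (parisiStep (scaledMeasure μ t) m F)
      = parisiStep (scaledMeasure μ (s + t)) m F := by
  rw [hF.parisiStep_parisiStep hm, scaledMeasure_conv_scaledMeasure μ hμ hs ht]

/-- The Parisi recursion with field law `ν`, with all variances multiplied by `1 - t`. -/
def parisiCascade (ν : Measure (S → ℝ)) (q m : ℕ → ℝ) (F : (S → ℝ) → ℝ) (t : ℝ) :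
    ℕ → (S → ℝ) → ℝ
  | 0 => F
  | k + 1 => parisiStep (scaledMeasure ν ((1 - t) * (q k - q (k + 1)))) (m (k + 1))
      (parisiCascade ν q m F t k)

lemma exists_hasSimplexGradient_parisiCascade (ν : Measure (S → ℝ)) [IsGaussian ν]
    {q m : ℕ → ℝ} {F : (S → ℝ) → ℝ} {P : (S → ℝ) → S → ℝ} {c : ℝ} (hc : 0 ≤ c)
    (hF : HasSimplexGradient c F P) {L : ℕ} (hm : ∀ k ≤ L + 1, 0 < m k ∧ m k ≤ 1) (t : ℝ) :
    ∀ k ≤ L, ∃ Q, HasSimplexGradient (c + 2 * k) (parisiCascade ν q m F t k) Q := by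
  intro k
  induction k with
  | zero => exact fun _ => ⟨P, by simpa [parisiCascade] using hF⟩
  | succ k ih =>
    intro hk
    obtain ⟨Q, hQ⟩ := ih (by omega)
    obtain ⟨h0, h1⟩ := hm (k + 1) (by omega)
    refine ⟨_, (hQ.parisiStep (by positivity) h0 h1).mono (le_of_eq ?_)⟩
    push_cast; ring

/-- Structural hypotheses on the parameters of a Parisi cascade of depth `L`. -/
structure CascadeParams (L : ℕ) (q m : ℕ → ℝ) : Prop where
  m_pos : ∀ k ≤ L + 1, 0 < m k
  m_le_one : ∀ k ≤ L + 1, m k ≤ 1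
  m_anti : ∀ k ≤ L, m (k + 1) ≤ m k
  q_nonneg : ∀ k ≤ L, 0 ≤ q k
  q_le_one : ∀ k ≤ L, q k ≤ 1
  q_anti : ∀ k < L, q (k + 1) ≤ q k

section Cascade

variable {μ ν : Measure (S → ℝ)} [IsGaussian μ] [IsGaussian ν] {q m κ : ℕ → ℝ}
  {F : (S → ℝ) → ℝ} {P : (S → ℝ) → S → ℝ} {c c₀ : ℝ} {L : ℕ}

lemma lipOne_parisiCascade (hp : CascadeParams L q m) (hc : 0 ≤ c)
    (hF : HasSimplexGradient c F P) (t : ℝ) {k : ℕ} (hk : k ≤ L) :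
    LipOne (parisiCascade ν q m F t k) :=
  (exists_hasSimplexGradient_parisiCascade ν hc hF
    (fun j hj => ⟨hp.m_pos j hj, hp.m_le_one j hj⟩) t k hk).choose_spec.lip

lemma exists_abs_parisiCascade_sub_le (hν : ∀ L : StrongDual ℝ (S → ℝ), ν[L] = 0)
    (hp : CascadeParams L q m) (hc : 0 ≤ c) (hF : HasSimplexGradient c F P) :
    ∀ k ≤ L, ∃ C, 0 ≤ C ∧ ∀ t s, 0 ≤ t → 0 < s → t + s ≤ 1 → ∀ x,
      |parisiCascade ν q m F (t + s) k x - parisiCascade ν q m F t k x| ≤ C * s := by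
  intro k
  induction k with
  | zero => exact fun _ => ⟨0, le_rfl, fun t s _ _ _ x => by simp [parisiCascade]⟩
  | succ k ih =>
    intro hk
    obtain ⟨C, hC, h⟩ := ih (by omega)
    obtain ⟨C', hC', h'⟩ := exists_abs_parisiStep_sub_le ν hν (c := c + 2 * k) (by positivity)
    refine ⟨C + C', by positivity, fun t s ht hs hts x => ?_⟩
    set Δ := q k - q (k + 1) with hΔ
    have hΔ0 : 0 ≤ Δ := by linarith [hp.q_anti k (by omega)]
    have hΔ1 : Δ ≤ 1 := by linarith [hp.q_le_one k (by omega), hp.q_nonneg (k + 1) hk]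
    have hm := hp.m_pos (k + 1) (by omega)
    obtain ⟨Q, hQ⟩ := exists_hasSimplexGradient_parisiCascade ν (q := q) hc hF
      (fun j hj => ⟨hp.m_pos j hj, hp.m_le_one j hj⟩) t k (by omega : k ≤ L)
    have hl := lipOne_parisiCascade (ν := ν) hp hc hF t (by omega : k ≤ L)
    have hl' := lipOne_parisiCascade (ν := ν) hp hc hF (t + s) (by omega : k ≤ L)
    have hsΔ : s * Δ ≤ s := mul_le_of_le_one_right hs.le hΔ1
    have hd : ∀ y, |parisiCascade ν q m F (t + s) k y
        - parisiStep (scaledMeasure ν (s * Δ)) (m (k + 1)) (parisiCascade ν q m F t k) y|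
        ≤ (C + C') * s := fun y => by
      have h1 := abs_le.mp (h t s ht hs hts y)
      have h2 := abs_le.mp (h' _ _ hQ (s * Δ) (by positivity) (by linarith) (m (k + 1)) hm
        (hp.m_le_one _ (by omega)) y)
      have h3 : C' * (s * Δ) ≤ C' * s := by gcongr
      rw [abs_le]
      constructor <;> linarith
    have e : parisiCascade ν q m F t (k + 1)
        = parisiStep (scaledMeasure ν ((1 - (t + s)) * Δ)) (m (k + 1))
          (parisiStep (scaledMeasure ν (s * Δ)) (m (k + 1)) (parisiCascade ν q m F t k)) := by
      rw [parisiStep_scaledMeasure_add ν hν hl hm (mul_nonneg (by linarith) hΔ0) (by positivity),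
        parisiCascade]
      congr 2; ring
    have hl2 := hl.parisiStep (μ := scaledMeasure ν (s * Δ)) hm
    rw [e, abs_sub_le_iff, parisiCascade]
    constructor
    · have := hl'.parisiStep_le (μ := scaledMeasure ν ((1 - (t + s)) * Δ)) hl2 hm (x := x)
        (y := x) (c := (C + C') * s) fun w => by linarith [(abs_le.mp (hd (x + w))).2]
      linarith
    · have := hl2.parisiStep_le (μ := scaledMeasure ν ((1 - (t + s)) * Δ)) hl' hm (x := x)
        (y := x) (c := (C + C') * s) fun w => by linarith [(abs_le.mp (hd (x + w))).1]
      linarith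

lemma exists_parisiStep_parisiCascade_le_of_exponent
    (hμ : ∀ L : StrongDual ℝ (S → ℝ), μ[L] = 0) (hν : ∀ L : StrongDual ℝ (S → ℝ), ν[L] = 0)
    (hp : CascadeParams L q m) (hc : 0 ≤ c) (hF : HasSimplexGradient c F P)
    (hκ : ∀ k ≤ L, ∀ p ∈ stdSimplex ℝ S,
      q k * ∫ w, (p ⬝ᵥ w) ^ 2 ∂ν - ∫ w, (p ⬝ᵥ w) ^ 2 ∂μ ≤ 2 * κ k) {k : ℕ} (hk : k ≤ L) {b : ℝ}
    (h : ∃ C, 0 ≤ C ∧ ∀ t s, 0 ≤ t → 0 < s → t + s ≤ 1 → ∀ x,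
      parisiStep (scaledMeasure μ s) (m k) (parisiCascade ν q m F (t + s) k) x
        ≤ parisiStep (scaledMeasure ν (s * q k)) (m k) (parisiCascade ν q m F t k) x
          + b * s + C * (s * √s)) :
    ∃ C, 0 ≤ C ∧ ∀ t s, 0 ≤ t → 0 < s → t + s ≤ 1 → ∀ x,
      parisiStep (scaledMeasure μ s) (m (k + 1)) (parisiCascade ν q m F (t + s) k) x
        ≤ parisiStep (scaledMeasure ν (s * q k)) (m (k + 1)) (parisiCascade ν q m F t k) x
          + (b + (m k - m (k + 1)) * κ k) * s + C * (s * √s) := by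
  obtain ⟨C, hC, h⟩ := h
  obtain ⟨K, hK, hd⟩ := exists_abs_parisiCascade_sub_le hν hp hc hF k hk
  obtain ⟨C', hC', h'⟩ := exists_parisiStep_exponent_change μ ν hμ hν (hp.q_nonneg k hk)
    (hp.q_le_one k hk) (c := c + 2 * k) (by positivity) hK (hκ k hk)
  refine ⟨C + C', by positivity, fun t s ht hs hts x => ?_⟩
  have hreg := fun t => exists_hasSimplexGradient_parisiCascade ν (q := q) hc hF
    (fun j hj => ⟨hp.m_pos j hj, hp.m_le_one j hj⟩) t k hk
  obtain ⟨Q, hQ⟩ := hreg t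
  obtain ⟨Q', hQ'⟩ := hreg (t + s)
  have h1 := h' _ _ _ _ hQ hQ' s hs (by linarith) (hd t s ht hs hts) (m k) (m (k + 1))
    (hp.m_pos _ (by omega)) (hp.m_anti k hk) (hp.m_le_one k (by omega)) x
  have h2 := h t s ht hs hts x
  linarith

lemma exists_parisiStep_parisiCascade_le
    (hμ : ∀ L : StrongDual ℝ (S → ℝ), μ[L] = 0) (hν : ∀ L : StrongDual ℝ (S → ℝ), ν[L] = 0)
    (hp : CascadeParams L q m) (hc : 0 ≤ c) (hF : HasSimplexGradient c F P)
    (hκ : ∀ k ≤ L, ∀ p ∈ stdSimplex ℝ S,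
      q k * ∫ w, (p ⬝ᵥ w) ^ 2 ∂ν - ∫ w, (p ⬝ᵥ w) ^ 2 ∂μ ≤ 2 * κ k)
    (h₀ : ∀ s, 0 ≤ s → ∀ x, parisiStep (scaledMeasure μ s) (m 0) F x
      ≤ parisiStep (scaledMeasure ν (s * q 0)) (m 0) F x + c₀ * s) :
    ∀ k ≤ L, ∃ C, 0 ≤ C ∧ ∀ t s, 0 ≤ t → 0 < s → t + s ≤ 1 → ∀ x,
      parisiStep (scaledMeasure μ s) (m k) (parisiCascade ν q m F (t + s) k) x
        ≤ parisiStep (scaledMeasure ν (s * q k)) (m k) (parisiCascade ν q m F t k) x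
          + (c₀ + ∑ j ∈ Finset.range k, (m j - m (j + 1)) * κ j) * s + C * (s * √s) := by
  intro k
  induction k with
  | zero =>
    refine fun _ => ⟨0, le_rfl, fun t s _ hs _ x => ?_⟩
    simpa [parisiCascade] using h₀ s hs.le x
  | succ k ih =>
    intro hk
    obtain ⟨C, hC, h⟩ := exists_parisiStep_parisiCascade_le_of_exponent hμ hν hp hc hF hκ
      (by omega : k ≤ L) (ih (by omega))
    refine ⟨C, hC, fun t s ht hs hts x => ?_⟩
    have hm := hp.m_pos (k + 1) (by omega)
    have hl := lipOne_parisiCascade (ν := ν) hp hc hF t (by omega : k ≤ L)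
    have hl' := lipOne_parisiCascade (ν := ν) hp hc hF (t + s) (by omega : k ≤ L)
    have hΔ : 0 ≤ q k - q (k + 1) := by linarith [hp.q_anti k (by omega)]
    have hq := hp.q_nonneg k (by omega)
    have hq' := hp.q_nonneg (k + 1) hk
    have e : parisiStep (scaledMeasure ν (s * q (k + 1))) (m (k + 1))
          (parisiCascade ν q m F t (k + 1))
        = parisiStep (scaledMeasure ν ((1 - (t + s)) * (q k - q (k + 1)))) (m (k + 1))
          (parisiStep (scaledMeasure ν (s * q k)) (m (k + 1)) (parisiCascade ν q m F t k)) := by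
      rw [parisiCascade, parisiStep_scaledMeasure_add ν hν hl hm (by positivity)
        (mul_nonneg (by linarith) hΔ), parisiStep_scaledMeasure_add ν hν hl hm
        (mul_nonneg (by linarith) hΔ) (by positivity)]
      congr 2; ring
    rw [e, parisiCascade, hl'.parisiStep_comm hm, Finset.sum_range_succ, ← add_assoc, add_assoc
      (parisiStep _ _ _ _)]
    refine (hl'.parisiStep hm).parisiStep_le (hl.parisiStep hm) hm fun w => ?_
    rw [← add_assoc]
    exact h t s ht hs hts _

end Cascade

lemma le_add_of_forall_increment_le {Ψ : ℝ → ℝ} {b C : ℝ}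
    (h : ∀ t s, 0 ≤ t → 0 < s → t + s ≤ 1 → Ψ (t + s) ≤ Ψ t + b * s + C * (s * √s)) :
    Ψ 1 ≤ Ψ 0 + b := by
  have key : ∀ R : ℕ, 0 < R → Ψ 1 ≤ Ψ 0 + b + C * √(1 / (R : ℝ)) := fun R hR => by
    have hR' : (0 : ℝ) < R := by exact_mod_cast hR
    have hj : ∀ j : ℕ, j ≤ R → Ψ (j / R) ≤ Ψ 0 + j * (b * (1 / R) + C * (1 / R * √(1 / R))) := by
      intro j
      induction j with
      | zero => simp
      | succ j ih =>
        intro hj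
        have h1 : (j : ℝ) / R + 1 / R ≤ 1 := by
          rw [← add_div, div_le_one hR']; exact_mod_cast hj
        have h2 := h (j / R) (1 / R) (by positivity) (by positivity) h1
        have h3 := ih (by omega)
        rw [← add_div] at h2
        push_cast
        linarith
    have := hj R le_rfl
    rw [div_self hR'.ne'] at this
    refine this.trans (le_of_eq ?_)
    field_simp
    ring
  have hlim : Tendsto (fun R : ℕ => Ψ 0 + b + C * √(1 / (R : ℝ))) atTop (𝓝 (Ψ 0 + b)) := by
    have h1 := (Real.continuous_sqrt.tendsto 0).comp (tendsto_one_div_atTop_nhds_zero_nat (𝕜 := ℝ))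
    simpa using (h1.const_mul C).const_add (Ψ 0 + b)
  refine ge_of_tendsto hlim ?_
  filter_upwards [eventually_gt_atTop 0] with R hR using key R hR

theorem parisiStep_le_parisiCascade {μ ν : Measure (S → ℝ)} [IsGaussian μ] [IsGaussian ν]
    {q m κ : ℕ → ℝ} {F : (S → ℝ) → ℝ} {P : (S → ℝ) → S → ℝ} {c c₀ : ℝ} {L : ℕ}
    (hμ : ∀ L : StrongDual ℝ (S → ℝ), μ[L] = 0) (hν : ∀ L : StrongDual ℝ (S → ℝ), ν[L] = 0)
    (hp : CascadeParams L q m) (hqL : q L = 0) (hc : 0 ≤ c) (hF : HasSimplexGradient c F P)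
    (hκ : ∀ k ≤ L, ∀ p ∈ stdSimplex ℝ S,
      q k * ∫ w, (p ⬝ᵥ w) ^ 2 ∂ν - ∫ w, (p ⬝ᵥ w) ^ 2 ∂μ ≤ 2 * κ k)
    (h₀ : ∀ s, 0 ≤ s → ∀ x, parisiStep (scaledMeasure μ s) (m 0) F x
      ≤ parisiStep (scaledMeasure ν (s * q 0)) (m 0) F x + c₀ * s) (x : S → ℝ) :
    parisiStep (scaledMeasure μ 1) (m (L + 1)) F x
      ≤ parisiCascade ν q m F 0 L x
        + (c₀ + ∑ j ∈ Finset.range (L + 1), (m j - m (j + 1)) * κ j) := by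
  obtain ⟨C, hC, h⟩ := exists_parisiStep_parisiCascade_le_of_exponent hμ hν hp hc hF hκ le_rfl
    (exists_parisiStep_parisiCascade_le hμ hν hp hc hF hκ h₀ L le_rfl)
  have hm := hp.m_pos (L + 1) le_rfl
  have hone : ∀ k ≤ L, parisiCascade ν q m F 1 k = F := by
    intro k
    induction k with
    | zero => exact fun _ => rfl
    | succ k ih =>
      intro hk
      rw [parisiCascade, ih (by omega), sub_self, zero_mul,
        parisiStep_scaledMeasure_zero ν (hp.m_pos _ (by omega)).ne']
  have key := le_add_of_forall_increment_le (C := C)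
    (b := c₀ + ∑ j ∈ Finset.range (L + 1), (m j - m (j + 1)) * κ j)
    (Ψ := fun t => parisiStep (scaledMeasure μ t) (m (L + 1)) (parisiCascade ν q m F t L) x)
    fun t s ht hs hts => by
      have hl := lipOne_parisiCascade (ν := ν) hp hc hF t le_rfl
      have hl' := lipOne_parisiCascade (ν := ν) hp hc hF (t + s) le_rfl
      rw [← parisiStep_scaledMeasure_add μ hμ hl' hm ht hs.le, add_assoc (parisiStep _ _ _ _)]
      refine (hl'.parisiStep hm).parisiStep_le hl hm fun w => ?_
      have := h t s ht hs hts (x + w)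
      rw [hqL, mul_zero, parisiStep_scaledMeasure_zero ν hm.ne'] at this
      rw [Finset.sum_range_succ]
      linarith
  rwa [hone L le_rfl, parisiStep_scaledMeasure_zero μ hm.ne'] at key

section GaussianField

variable {ι : Type*} [Fintype ι]

/-- The standard Gaussian measure on `ι → ℝ`. -/
abbrev stdGaussianPi (ι : Type*) [Fintype ι] : Measure (ι → ℝ) :=
  Measure.pi fun _ => gaussianReal 0 1

instance : IsGaussian (stdGaussianPi ι) := by
  have h : stdGaussianPi ι = (stdGaussian (EuclideanSpace ℝ ι)).map
      (EuclideanSpace.equiv ι ℝ : EuclideanSpace ℝ ι →L[ℝ] (ι → ℝ)) := by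
    rw [← map_pi_eq_stdGaussian, Measure.map_map (by fun_prop) (by fun_prop)]
    exact Measure.map_id.symm
  rw [h]; infer_instance

lemma integral_sum_mul_stdGaussianPi (a : ι → ℝ) : ∫ z, ∑ i, a i * z i ∂stdGaussianPi ι = 0 := by
  rw [integral_finsetSum]
  · simp [integral_const_mul, integral_eval]
  · exact fun i _ => (integrable_eval IsGaussian.integrable_id).const_mul _

lemma integral_sum_mul_sq_stdGaussianPi (a : ι → ℝ) :
    ∫ z, (∑ i, a i * z i) ^ 2 ∂stdGaussianPi ι = ∑ i, a i ^ 2 := by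
  have h := variance_sum_pi (μ := fun _ : ι => gaussianReal 0 1) (X := fun i x => a i * id x)
    fun i => IsGaussian.memLp_two_id.const_mul _
  simp_rw [variance_const_mul, variance_id_gaussianReal] at h
  rw [variance_of_integral_eq_zero] at h
  · simpa using h
  · exact Measurable.aemeasurable (by fun_prop)
  · simpa using integral_sum_mul_stdGaussianPi a

lemma integral_exp_sum_mul_stdGaussianPi (a : ι → ℝ) :
    ∫ z, exp (∑ i, a i * z i) ∂stdGaussianPi ι = exp ((∑ i, a i ^ 2) / 2) := by
  simp_rw [exp_sum]
  rw [integral_fintype_prod_eq_prod (f := fun i x => exp (a i * x)), Finset.sum_div, exp_sum]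
  refine Finset.prod_congr rfl fun i _ => ?_
  have h := mgf_gaussianReal (p := gaussianReal 0 1) (X := id) Measure.map_id (a i)
  simpa [mgf] using h

lemma integrable_exp_sum_mul_stdGaussianPi (a : ι → ℝ) :
    Integrable (fun z => exp (∑ i, a i * z i)) (stdGaussianPi ι) :=
  not_imp_comm.mp integral_undef (by rw [integral_exp_sum_mul_stdGaussianPi]; positivity)

/-- The linear map `z ↦ (σ ↦ ∑ i, A σ i * z i)`. -/
def linearField (A : S → ι → ℝ) : (ι → ℝ) →L[ℝ] (S → ℝ) :=
  ContinuousLinearMap.pi fun σ => ∑ i, A σ i • ContinuousLinearMap.proj (R := ℝ) i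

@[simp]
lemma linearField_apply {T : Type*} (A : T → ι → ℝ) (z : ι → ℝ) (σ : T) :
    linearField A z σ = ∑ i, A σ i * z i := by
  simp [linearField]

/-- The law of the centred Gaussian field `∑ i, A σ i * z i` with `z` standard Gaussian. -/
def gaussianField (A : S → ι → ℝ) : Measure (S → ℝ) := (stdGaussianPi ι).map (linearField A)

instance (A : S → ι → ℝ) : IsGaussian (gaussianField A) := by
  unfold gaussianField; infer_instance

lemma integral_gaussianField (A : S → ι → ℝ) {g : (S → ℝ) → ℝ} (hg : Measurable g) :
    ∫ w, g w ∂gaussianField A = ∫ z, g (linearField A z) ∂stdGaussianPi ι :=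
  integral_map (by fun_prop) hg.aestronglyMeasurable

lemma dotProduct_linearField (A : S → ι → ℝ) (p : S → ℝ) (z : ι → ℝ) :
    p ⬝ᵥ linearField A z = ∑ i, (∑ σ, p σ * A σ i) * z i := by
  simp only [dotProduct, linearField_apply, Finset.mul_sum, Finset.sum_mul]
  rw [Finset.sum_comm]
  simp only [mul_assoc]

lemma integral_dual_gaussianField (A : S → ι → ℝ) (L : StrongDual ℝ (S → ℝ)) :
    (gaussianField A)[L] = 0 := by
  classical
  rw [integral_gaussianField A L.continuous.measurable]
  have h : ∀ z, L (linearField A z)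
      = (fun σ => L fun j => if σ = j then 1 else 0) ⬝ᵥ linearField A z := fun z => by
    refine (L.toLinearMap.pi_apply_eq_sum_univ (linearField A z)).trans ?_
    exact Finset.sum_congr rfl fun σ _ => mul_comm _ _
  simp_rw [h, dotProduct_linearField]
  exact integral_sum_mul_stdGaussianPi _

lemma integral_dotProduct_sq_gaussianField (A : S → ι → ℝ) (p : S → ℝ) :
    ∫ w, (p ⬝ᵥ w) ^ 2 ∂gaussianField A = ∑ i, (∑ σ, p σ * A σ i) ^ 2 := by
  rw [integral_gaussianField A (Continuous.measurable (by simp only [dotProduct]; fun_prop))]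
  simp_rw [dotProduct_linearField]
  exact integral_sum_mul_sq_stdGaussianPi _

end GaussianField

/-- The free energy `log ∑ σ, exp (x σ)`. -/
def logSumExp (x : S → ℝ) : ℝ := log (∑ σ, exp (x σ))

lemma exp_logSumExp [Nonempty S] (x : S → ℝ) : exp (logSumExp x) = ∑ σ, exp (x σ) :=
  exp_log (Finset.sum_pos (fun _ _ => exp_pos _) Finset.univ_nonempty)

lemma lipOne_logSumExp [Nonempty S] : LipOne (logSumExp (S := S)) := fun x y => by
  rw [← exp_le_exp, exp_add, exp_logSumExp, exp_logSumExp, Finset.sum_mul]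
  refine Finset.sum_le_sum fun σ _ => ?_
  rw [← exp_add, exp_le_exp]
  have := (le_abs_self _).trans (norm_le_pi_norm (x - y) σ)
  simp only [Pi.sub_apply] at this
  linarith

lemma hasSimplexGradient_logSumExp [Nonempty S] :
    HasSimplexGradient 2 (logSumExp (S := S)) fun x σ => exp (x σ - logSumExp x) := by
  have hmem : ∀ x : S → ℝ, (fun σ => exp (x σ - logSumExp x)) ∈ stdSimplex ℝ S := fun x => by
    refine ⟨fun σ => (exp_pos _).le, ?_⟩
    simp_rw [exp_sub, ← Finset.sum_div]
    rw [exp_logSumExp, div_self]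
    exact (Finset.sum_pos (fun _ _ => exp_pos _) Finset.univ_nonempty).ne'
  have hlip := lipOne_logSumExp (S := S)
  have hc := hlip.continuous
  refine ⟨hlip, measurable_pi_lambda _ fun σ => ?_, hmem, fun x v => ?_⟩
  · exact Continuous.measurable (by fun_prop)
  set p := fun σ => exp (x σ - logSumExp x) with hp
  have h1 := abs_le.mp (abs_dotProduct_le_norm (hmem x) v)
  have h2 := abs_le.mp (hlip.abs_sub_le (x + v) x)
  rw [add_sub_cancel_left] at h2
  rcases le_or_gt ‖v‖ 1 with hv | hv
  · have e : exp (logSumExp (x + v) - logSumExp x) = ∑ σ, p σ * exp (v σ) := by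
      rw [exp_sub, exp_logSumExp (x + v), Finset.sum_div]
      refine Finset.sum_congr rfl fun σ _ => ?_
      rw [Pi.add_apply, exp_add, hp]
      dsimp only
      rw [exp_sub]; ring
    have low : exp (p ⬝ᵥ v) ≤ exp (logSumExp (x + v) - logSumExp x) := by
      rw [e]
      exact convexOn_exp.map_sum_le (fun σ _ => (hmem x).1 σ) (hmem x).2 fun σ _ => Set.mem_univ _
    have up : exp (logSumExp (x + v) - logSumExp x) ≤ 1 + p ⬝ᵥ v + ‖v‖ ^ 2 := by
      rw [e]
      have hσ : ∀ σ, p σ * exp (v σ) ≤ p σ * 1 + p σ * v σ + p σ * ‖v‖ ^ 2 := fun σ => by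
        have a1 : |v σ| ≤ ‖v‖ := norm_le_pi_norm v σ
        have a2 := le_of_abs_le (abs_exp_sub_one_sub_id_le (a1.trans hv))
        have a3 : v σ ^ 2 ≤ ‖v‖ ^ 2 := by
          rw [← sq_abs]; exact pow_le_pow_left₀ (abs_nonneg _) a1 2
        rw [← mul_add, ← mul_add]
        exact mul_le_mul_of_nonneg_left (by linarith) ((hmem x).1 σ)
      refine (Finset.sum_le_sum fun σ _ => hσ σ).trans (le_of_eq ?_)
      rw [Finset.sum_add_distrib, Finset.sum_add_distrib, ← Finset.sum_mul, ← Finset.sum_mul,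
        (hmem x).2, one_mul, one_mul, dotProduct]
    have low' := exp_le_exp.mp low
    have up' := (add_one_le_exp (logSumExp (x + v) - logSumExp x)).trans up
    rw [abs_le]
    constructor <;> nlinarith [sq_nonneg ‖v‖]
  · rw [abs_le]
    constructor <;> nlinarith

lemma parisiStep_one_logSumExp [Nonempty S] {ι : Type*} [Fintype ι] {A : S → ι → ℝ} {V : ℝ}
    (hA : ∀ σ, ∑ i, A σ i ^ 2 = V) {s : ℝ} (hs : 0 ≤ s) (x : S → ℝ) :
    parisiStep (scaledMeasure (gaussianField A) s) 1 logSumExp x = logSumExp x + s * V / 2 := by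
  have hc := (lipOne_logSumExp (S := S)).continuous
  rw [← exp_eq_exp, ← one_mul (parisiStep _ _ _ _), lipOne_logSumExp.exp_parisiStep one_pos,
    exp_add, exp_logSumExp, integral_scaledMeasure _ _ (Continuous.measurable (by fun_prop)),
    integral_gaussianField _ (Continuous.measurable (by fun_prop))]
  simp only [one_mul, exp_logSumExp, Pi.add_apply, Pi.smul_apply, linearField_apply, smul_eq_mul,
    exp_add, Finset.mul_sum, ← mul_assoc]
  rw [integral_finsetSum _ fun σ _ => (integrable_exp_sum_mul_stdGaussianPi _).const_mul _,
    Finset.sum_mul]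
  refine Finset.sum_congr rfl fun σ _ => ?_
  rw [integral_const_mul, integral_exp_sum_mul_stdGaussianPi]
  simp_rw [mul_pow, Real.sq_sqrt hs]
  rw [← Finset.mul_sum, hA]

lemma spinVal_sq (b : Bool) : spinVal b ^ 2 = 1 := by
  cases b <;> simp [spinVal]

lemma sum_prod_eq_two_mul_sum_lt {N : ℕ} (g : Fin N × Fin N → ℝ) (hg : ∀ i j, g (i, j) = g (j, i)) :
    ∑ p, g p = 2 * (∑ p, if p.1 < p.2 then g p else 0) + ∑ i, g (i, i) := by
  have h1 : ∀ p, g p = (if p.1 < p.2 then g p else 0) + (if p.2 < p.1 then g p else 0)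
      + if p.1 = p.2 then g p else 0 := fun p => by
    rcases lt_trichotomy p.1 p.2 with h | h | h
    · simp [h, h.not_gt, h.ne]
    · simp [h]
    · simp [h, h.not_gt, h.ne']
  have h2 : (∑ p, if p.2 < p.1 then g p else 0) = ∑ p, if p.1 < p.2 then g p else 0 := by
    rw [← (Equiv.prodComm (Fin N) (Fin N)).sum_comp]
    refine Finset.sum_congr rfl fun p _ => ?_
    simp [Equiv.prodComm_apply, Prod.swap, hg p.2 p.1]
  have h3 : (∑ p : Fin N × Fin N, if p.1 = p.2 then g p else 0) = ∑ i, g (i, i) := by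
    simp [Fintype.sum_prod_type]
  rw [Finset.sum_congr rfl fun p _ => h1 p, Finset.sum_add_distrib, Finset.sum_add_distrib, h2, h3]
  ring

lemma sum_sq_sum_mul_eq {κ : Type*} [Fintype κ] (p : S → ℝ) (u : S → κ → ℝ) :
    ∑ k, (∑ σ, p σ * u σ k) ^ 2 = ∑ σ, ∑ σ', p σ * p σ' * ∑ k, u σ k * u σ' k := by
  simp_rw [sq, Finset.sum_mul_sum, Finset.mul_sum]
  rw [Finset.sum_comm]
  refine Finset.sum_congr rfl fun σ _ => ?_
  rw [Finset.sum_comm]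
  exact Finset.sum_congr rfl fun σ' _ => Finset.sum_congr rfl fun k _ => by ring

lemma sum_mul_sub_sq (p : S → ℝ) (R : S → S → ℝ) (r : ℝ) :
    ∑ σ, ∑ σ', p σ * p σ' * R σ σ' ^ 2 - 2 * r * ∑ σ, ∑ σ', p σ * p σ' * R σ σ'
      + r ^ 2 * ∑ σ, ∑ σ', p σ * p σ' = ∑ σ, ∑ σ', p σ * p σ' * (R σ σ' - r) ^ 2 := by
  simp only [Finset.mul_sum, ← Finset.sum_sub_distrib, ← Finset.sum_add_distrib]
  exact Finset.sum_congr rfl fun σ _ => Finset.sum_congr rfl fun σ' _ => by ring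

/-- Coefficients of the Sherrington–Kirkpatrick field in the couplings. -/
def skField (N : ℕ) (β : ℝ) (σ : Fin N → Bool) (p : Fin N × Fin N) : ℝ :=
  if p.1 < p.2 then β / √N * spinVal (σ p.1) * spinVal (σ p.2) else 0

/-- Coefficients of a random linear magnetic field. -/
def cavityField (N : ℕ) (β : ℝ) (σ : Fin N → Bool) (i : Fin N) : ℝ := β * spinVal (σ i)

lemma sum_cavityField_sq (N : ℕ) (β : ℝ) (σ : Fin N → Bool) :
    ∑ i, cavityField N β σ i ^ 2 = β ^ 2 * N := by
  simp [cavityField, mul_pow, spinVal_sq, mul_comm]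

lemma sum_skField_sq {N : ℕ} (hN : 1 ≤ N) (β : ℝ) (σ : Fin N → Bool) :
    ∑ p, skField N β σ p ^ 2 = β ^ 2 * (N - 1) / 2 := by
  have hN' : (0 : ℝ) < N := by exact_mod_cast hN
  have h1 : ∀ p, skField N β σ p ^ 2 = if p.1 < p.2 then β ^ 2 / N else 0 := fun p => by
    unfold skField
    split_ifs
    · rw [mul_pow, mul_pow, spinVal_sq, spinVal_sq, div_pow, Real.sq_sqrt hN'.le]; ring
    · simp
  have h2 := sum_prod_eq_two_mul_sum_lt (N := N) (fun _ => β ^ 2 / N) fun _ _ => rfl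
  rw [Finset.sum_congr rfl fun p _ => h1 p]
  simp only [Finset.sum_const, Finset.card_univ, Fintype.card_prod, Fintype.card_fin,
    nsmul_eq_mul, Nat.cast_mul] at h2
  field_simp at h2 ⊢
  linarith

lemma cavityField_sub_skField_le {N : ℕ} (hN : 1 ≤ N) (β q : ℝ) {p : (Fin N → Bool) → ℝ}
    (hp : p ∈ stdSimplex ℝ (Fin N → Bool)) :
    q * ∫ w, (p ⬝ᵥ w) ^ 2 ∂gaussianField (cavityField N β)
      - ∫ w, (p ⬝ᵥ w) ^ 2 ∂gaussianField (skField N β) ≤ 2 * (β ^ 2 * (N * q ^ 2 + 1) / 4) := by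
  have hN' : (0 : ℝ) < N := by exact_mod_cast hN
  rw [integral_dotProduct_sq_gaussianField, integral_dotProduct_sq_gaussianField]
  set a := fun i => ∑ σ, p σ * spinVal (σ i) with ha
  set b := fun k : Fin N × Fin N => ∑ σ, p σ * (spinVal (σ k.1) * spinVal (σ k.2)) with hb
  have h1 : ∑ i, (∑ σ, p σ * cavityField N β σ i) ^ 2 = β ^ 2 * ∑ i, a i ^ 2 := by
    rw [Finset.mul_sum]
    refine Finset.sum_congr rfl fun i _ => ?_
    rw [← mul_pow, ha, Finset.mul_sum]
    congr 1
    exact Finset.sum_congr rfl fun σ _ => by rw [cavityField]; ring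
  have h2 : ∑ k, (∑ σ, p σ * skField N β σ k) ^ 2
      = β ^ 2 / N * ∑ k, if k.1 < k.2 then b k ^ 2 else 0 := by
    rw [Finset.mul_sum]
    refine Finset.sum_congr rfl fun k _ => ?_
    unfold skField
    split_ifs
    · rw [← Real.sq_sqrt hN'.le, ← div_pow, ← mul_pow, hb, Finset.mul_sum, Real.sq_sqrt hN'.le]
      congr 1
      exact Finset.sum_congr rfl fun σ _ => by ring
    · simp
  have h3 := sum_prod_eq_two_mul_sum_lt (fun k => b k ^ 2) fun i j => by
    simp only [hb, mul_comm]
  have h4 : ∀ i, b (i, i) = 1 := fun i => by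
    simp only [hb, ← sq, spinVal_sq, mul_one, hp.2]
  simp only [h4, one_pow, Finset.sum_const, Finset.card_univ, Fintype.card_fin, nsmul_eq_mul,
    mul_one] at h3
  have h5 : 0 ≤ ∑ k, b k ^ 2 - 2 * (N * q) * ∑ i, a i ^ 2 + (N * q) ^ 2 := by
    have e1 := sum_sq_sum_mul_eq p fun (σ : Fin N → Bool) i => spinVal (σ i)
    have e2 := sum_sq_sum_mul_eq p fun (σ : Fin N → Bool) (k : Fin N × Fin N) =>
      spinVal (σ k.1) * spinVal (σ k.2)
    have e3 : (1 : ℝ) = ∑ σ, ∑ σ', p σ * p σ' := by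
      rw [← Finset.sum_mul_sum, hp.2, one_mul]
    have e4 : ∀ σ σ' : Fin N → Bool, ∑ k : Fin N × Fin N,
        spinVal (σ k.1) * spinVal (σ k.2) * (spinVal (σ' k.1) * spinVal (σ' k.2))
        = (∑ i, spinVal (σ i) * spinVal (σ' i)) ^ 2 := fun σ σ' => by
      rw [sq, Finset.sum_mul_sum, Fintype.sum_prod_type]
      exact Finset.sum_congr rfl fun i _ => Finset.sum_congr rfl fun j _ => by ring
    simp only [e4] at e2
    have e5 : ∑ k, b k ^ 2 - 2 * (N * q) * ∑ i, a i ^ 2 + (N * q) ^ 2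
        = ∑ σ, ∑ σ', p σ * p σ' * (∑ i, spinVal (σ i) * spinVal (σ' i) - N * q) ^ 2 := by
      rw [← mul_one ((N * q : ℝ) ^ 2), e3]
      simp only [ha, hb]
      rw [e1, e2]
      exact sum_mul_sub_sq p _ _
    rw [e5]
    exact Finset.sum_nonneg fun σ _ => Finset.sum_nonneg fun σ' _ =>
      mul_nonneg (mul_nonneg (hp.1 σ) (hp.1 σ')) (sq_nonneg _)
  rw [h1, h2]
  have h6 : 2 * (β ^ 2 * (N * q ^ 2 + 1) / 4) - (q * (β ^ 2 * ∑ i, a i ^ 2)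
      - β ^ 2 / N * ∑ k, if k.1 < k.2 then b k ^ 2 else 0)
      = β ^ 2 / (2 * N) * (∑ k, b k ^ 2 - 2 * (N * q) * ∑ i, a i ^ 2 + (N * q) ^ 2) := by
    rw [h3]; field_simp; ring
  have h7 : 0 ≤ β ^ 2 / (2 * N) * (∑ k, b k ^ 2 - 2 * (N * q) * ∑ i, a i ^ 2 + (N * q) ^ 2) :=
    mul_nonneg (by positivity) h5
  linarith

lemma mul_skPhi_eq {N : ℕ} (hN : 1 ≤ N) {n : ℝ} (β h : ℝ) :
    N * skPhi N n β h = parisiStep (scaledMeasure (gaussianField (skField N β)) 1) n logSumExp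
      fun σ => β * ∑ i, h * spinVal (σ i) := by
  have hN' : (0 : ℝ) < N := by exact_mod_cast hN
  have hc := (lipOne_logSumExp (S := Fin N → Bool)).continuous
  rw [parisiStep, integral_scaledMeasure _ _ (Continuous.measurable (by fun_prop)),
    integral_gaussianField _ (Continuous.measurable (by fun_prop)), skPhi, one_div_mul_eq_div,
    one_div_mul_eq_div, ← mul_div_assoc, mul_div_mul_left _ _ hN'.ne']
  congr 3
  ext J
  have e : skZ N β h J = exp (logSumExp ((fun σ : Fin N → Bool => β * ∑ i, h * spinVal (σ i))
      + √1 • linearField (skField N β) J)) := by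
    rw [exp_logSumExp, skZ]
    refine Finset.sum_congr rfl fun σ _ => ?_
    simp only [Pi.add_apply, linearField_apply, Real.sqrt_one, one_smul, skH,
      skField, ite_mul, zero_mul, ← Finset.sum_filter, ← Finset.mul_sum]
    congr 1
    have : ∑ p ∈ Finset.univ.filter (fun p : Fin N × Fin N => p.1 < p.2),
        β / √N * spinVal (σ p.1) * spinVal (σ p.2) * J p
        = β / √N * ∑ p ∈ Finset.univ.filter (fun p : Fin N × Fin N => p.1 < p.2),
          J p * spinVal (σ p.1) * spinVal (σ p.2) := by
      rw [Finset.mul_sum]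
      exact Finset.sum_congr rfl fun p _ => by ring
    rw [this]; ring
  rw [e, ← exp_mul, mul_comm]

lemma logSumExp_cavityField (N : ℕ) (β : ℝ) (y : Fin N → ℝ) :
    logSumExp (linearField (cavityField N β) y) = N * log 2 + ∑ i, log (cosh (β * y i)) := by
  have h : ∑ σ, exp (linearField (cavityField N β) y σ) = ∏ i, (2 * cosh (β * y i)) := by
    have h1 : ∀ i, 2 * cosh (β * y i) = ∑ b : Bool, exp (β * spinVal b * y i) := fun i => by
      rw [Fintype.sum_bool, cosh_eq]
      simp only [spinVal, if_true, Bool.false_eq_true, if_false]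
      ring_nf
    simp_rw [h1]
    rw [Finset.prod_univ_sum, Fintype.piFinset_univ]
    simp only [linearField_apply, cavityField, exp_sum]
  rw [logSumExp, h, log_prod fun i _ => (mul_pos two_pos (cosh_pos _)).ne']
  simp_rw [log_mul two_ne_zero (cosh_pos _).ne']
  simp [Finset.sum_add_distrib]

lemma parisiStep_cavityField {N : ℕ} {β m s b : ℝ} {F : ((Fin N → Bool) → ℝ) → ℝ} {g g' : ℝ → ℝ}
    (hF : LipOne F) (hm : 0 < m)
    (hg : ∀ y, F (linearField (cavityField N β) y) = b + ∑ i, g (y i))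
    (hg' : ∀ y, g' y = 1 / m * log (∫ z, exp (m * g (y + √s * z)) ∂gaussianReal 0 1))
    (y : Fin N → ℝ) :
    parisiStep (scaledMeasure (gaussianField (cavityField N β)) s) m F
      (linearField (cavityField N β) y) = b + ∑ i, g' (y i) := by
  have hc := hF.continuous
  have h1 := hF.exp_parisiStep (μ := scaledMeasure (gaussianField (cavityField N β)) s) hm
    (linearField (cavityField N β) y)
  rw [integral_scaledMeasure _ _ (Continuous.measurable (by fun_prop)),
    integral_gaussianField _ (Continuous.measurable (by fun_prop))] at h1
  simp_rw [← map_smul, ← map_add, hg, mul_add, exp_add, Finset.mul_sum, exp_sum] at h1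
  simp only [Pi.add_apply, Pi.smul_apply, smul_eq_mul] at h1
  rw [integral_const_mul, integral_fintype_prod_eq_prod
    (f := fun i z => exp (m * g (y i + √s * z)))] at h1
  have h2 : ∏ i, ∫ z, exp (m * g (y i + √s * z)) ∂gaussianReal 0 1 ≠ 0 := fun h => by
    rw [h, mul_zero] at h1
    exact (exp_pos _).ne' h1
  have h3 := congrArg log h1
  rw [log_exp, log_mul (exp_pos _).ne' h2, log_exp,
    log_prod fun i hi => Finset.prod_ne_zero_iff.mp h2 i hi] at h3
  simp_rw [hg', ← Finset.mul_sum]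
  field_simp
  linarith

lemma le_of_forall_le_succ {u : ℕ → ℝ} {M : ℕ} (hu : ∀ a < M, u a ≤ u (a + 1)) {a b : ℕ}
    (hab : a ≤ b) (hb : b ≤ M) : u a ≤ u b := by
  induction b, hab using Nat.le_induction with
  | base => exact le_rfl
  | succ b _ ih => exact (ih (by omega)).trans (hu b (by omega))

/-- the `K`-level broken replica (Parisi) bound. With overlaps
`0 = q_0 ≤ … ≤ q_K = 1`, exponents `n = m_0 ≤ m_1 ≤ … ≤ m_K ≤ m_{K+1} = 1`, and
`f_a` defined by the Parisi recursion downward from `f_K(y) = log cosh(βy)`, one has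
`φ_N(n,β,h) ≤ log 2 + f_0(h) - (β²/4)(1 - Σ_{a=0}^K (m_{a+1} - m_a) q_a²)` for every `N ≥ 1`. -/
theorem stmt13 (n β h : ℝ) (hn : n ∈ Set.Ioc (0:ℝ) 1) (hβ : 0 < β)
    (K : ℕ) (hK : 1 ≤ K) (q m : ℕ → ℝ) (f : ℕ → ℝ → ℝ)
    (hq0 : q 0 = 0) (hqK : q K = 1) (hqmono : ∀ a < K, q a ≤ q (a + 1))
    (hm0 : m 0 = n) (hmtop : m (K + 1) = 1) (hmmono : ∀ a ≤ K, m a ≤ m (a + 1))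
    (hfK : ∀ y, f K y = Real.log (Real.cosh (β * y)))
    (hfrec : ∀ a, 1 ≤ a → a ≤ K → ∀ y,
      f (a - 1) y = (1 / m a) *
        Real.log (∫ z, Real.exp (m a * f a (y + Real.sqrt (q a - q (a - 1)) * z))
          ∂ gaussianReal 0 1)) :
    ∀ N : ℕ, 1 ≤ N →
      skPhi N n β h ≤
        Real.log 2 + f 0 h -
          β ^ 2 / 4 * (1 - ∑ a ∈ Finset.range (K + 1), (m (a + 1) - m a) * q a ^ 2) := by
  intro N hN
  have hN' : (0 : ℝ) < N := by exact_mod_cast hN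
  have hmle : ∀ a b, a ≤ b → b ≤ K + 1 → m a ≤ m b := fun a b =>
    le_of_forall_le_succ fun a ha => hmmono a (by omega)
  have hqle : ∀ a b, a ≤ b → b ≤ K → q a ≤ q b := fun a b => le_of_forall_le_succ hqmono
  set q' : ℕ → ℝ := fun k => q (K - k) with hq'
  set m' : ℕ → ℝ := fun k => m (K + 1 - k) with hm'
  have hp : CascadeParams K q' m' :=
    { m_pos := fun k _ => hn.1.trans_le (hm0 ▸ hmle 0 _ (by omega) (by omega))
      m_le_one := fun k _ => hmtop ▸ hmle _ _ (by omega) le_rfl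
      m_anti := fun k _ => hmle _ _ (by omega) (by omega)
      q_nonneg := fun k _ => hq0 ▸ hqle 0 _ (by omega) (by omega)
      q_le_one := fun k _ => hqK ▸ hqle _ _ (by omega) le_rfl
      q_anti := fun k _ => hqle _ _ (by omega) (by omega) }
  have hF := hasSimplexGradient_logSumExp (S := Fin N → Bool)
  have hcascade : ∀ k ≤ K, ∀ y, parisiCascade (gaussianField (cavityField N β)) q' m' logSumExp 0 k
      (linearField (cavityField N β) y) = N * log 2 + ∑ i, f (K - k) (y i) := by
    intro k
    induction k with
    | zero =>
      intro _ y
      simp only [parisiCascade, logSumExp_cavityField, Nat.sub_zero, hfK]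
    | succ k ih =>
      intro hk y
      refine parisiStep_cavityField (lipOne_parisiCascade hp zero_le_two hF 0 (by omega))
        (hp.m_pos (k + 1) (by omega)) (ih (by omega)) (fun y => ?_) y
      have := hfrec (K - k) (by omega) (by omega) y
      rw [sub_zero, one_mul]
      simpa only [hq', hm', Nat.sub_sub, Nat.add_sub_add_right] using this
  have main := parisiStep_le_parisiCascade (μ := gaussianField (skField N β))
    (ν := gaussianField (cavityField N β)) (κ := fun k => β ^ 2 * (N * q' k ^ 2 + 1) / 4)
    (c₀ := -(β ^ 2 * (N + 1) / 4)) (integral_dual_gaussianField _) (integral_dual_gaussianField _)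
    hp (by simpa [hq'] using hq0) zero_le_two hF
    (fun k _ p hp => cavityField_sub_skField_le hN β _ hp)
    (fun s hs x => by
      have e1 : m' 0 = 1 := hmtop
      have e2 : q' 0 = 1 := hqK
      rw [e1, e2, mul_one, parisiStep_one_logSumExp (sum_skField_sq hN β) hs,
        parisiStep_one_logSumExp (sum_cavityField_sq N β) hs]
      exact le_of_eq (by ring))
    (linearField (cavityField N β) fun _ => h)
  rw [hcascade K le_rfl] at main
  have hx : (linearField (cavityField N β) fun _ => h) = fun σ => β * ∑ i, h * spinVal (σ i) := by
    ext σ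
    rw [linearField_apply, Finset.mul_sum]
    exact Finset.sum_congr rfl fun i _ => by rw [cavityField]; ring
  have hend : m' (K + 1) = n := by simp [hm', hm0]
  rw [hx, hend, ← mul_skPhi_eq hN] at main
  have hsum : ∑ j ∈ Finset.range (K + 1), (m' j - m' (j + 1)) * (β ^ 2 * (N * q' j ^ 2 + 1) / 4)
      = β ^ 2 * N / 4 * ∑ a ∈ Finset.range (K + 1), (m (a + 1) - m a) * q a ^ 2
        + β ^ 2 / 4 * (1 - n) := by
    have htel := Finset.sum_range_sub m (K + 1)
    rw [hmtop, hm0] at htel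
    rw [← htel, Finset.mul_sum, Finset.mul_sum, ← Finset.sum_add_distrib,
      ← Finset.sum_range_reflect _ (K + 1)]
    refine Finset.sum_congr rfl fun a ha => ?_
    have ha' : a ≤ K := by have := Finset.mem_range.mp ha; omega
    simp only [hq', hm']
    rw [show K + 1 - (K + 1 - 1 - a) = a + 1 by omega,
      show K + 1 - (K + 1 - 1 - a + 1) = a by omega, show K - (K + 1 - 1 - a) = a by omega]
    ring
  rw [hsum] at main
  simp only [Finset.sum_const, Finset.card_univ, Fintype.card_fin, nsmul_eq_mul, Nat.sub_self]
    at main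
  rw [← mul_le_mul_iff_right₀ hN']
  have hpos : 0 ≤ β ^ 2 / 4 * n := by have := hn.1; positivity
  linarith
end
end

section
/- Fix n ∈ (0,1], β > 0, h ∈ ℝ, an integer K ≥ 1, numbers 0 = q_0 ≤ q_1 ≤ … ≤ q_K = 1 and n ≤ m_1 ≤ … ≤ m_K ≤ 1, and let f_0 be defined by the K-level Parisi recursion: f_K(y) = log cosh(βy), f_{a−1}(y) = (1/m_a) log ∫_ℝ exp( m_a f_a( y + √(q_a − q_{a−1}) z ) ) dμ(z) for a = K,…,1. Define α_P(β,h,x_n) = log 2 + nβ²/4 + f_0(h) − (β²/4) Σ_{a=1}^{K} m_a ( q_a² − q_{a−1}² ). Then the thermodynamic limit φ(n,β,h) = lim_{N→∞} φ_N(n,β,h) exists and satisfies φ(n,β,h) ≤ α_P(β,h,x_n). -/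
open MeasureTheory ProbabilityTheory Real Filter Topology

noncomputable section

/-- `f` grows at most exponentially. -/
def ExpGrowth {E F : Type} [NormedAddCommGroup E] [NormedAddCommGroup F] (f : E → F) : Prop :=
  ∃ C : ℝ, 0 ≤ C ∧ ∀ x, ‖f x‖ ≤ exp (C * (1 + ‖x‖))

/-- `f` is of class `C^k` and its derivatives up to order `k` grow at most exponentially. -/
def ExpSmooth {E : Type} [NormedAddCommGroup E] [NormedSpace ℝ E] :
    ℕ → ∀ {F : Type} [NormedAddCommGroup F] [NormedSpace ℝ F], (E → F) → Prop
  | 0, _, _, _, f => Continuous f ∧ ExpGrowth f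
  | k + 1, _, _, _, f => Differentiable ℝ f ∧ ExpGrowth f ∧ ExpSmooth k (fderiv ℝ f)

section ExpGrowth

variable {E F G H : Type} [NormedAddCommGroup E] [NormedAddCommGroup F] [NormedAddCommGroup G]
  [NormedAddCommGroup H]

lemma ExpGrowth.of_le {f : E → F} {g : E → G} (hg : ExpGrowth g) (h : ∀ x, ‖f x‖ ≤ ‖g x‖) :
    ExpGrowth f := by
  obtain ⟨C, hC, hb⟩ := hg
  exact ⟨C, hC, fun x => (h x).trans (hb x)⟩

lemma le_exp_mul_one_add {C : ℝ} (hC : 0 ≤ C) {t : ℝ} (ht : 0 ≤ t) : C ≤ exp (C * (1 + t)) := by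
  have := add_one_le_exp (C * (1 + t))
  nlinarith [mul_nonneg hC ht]

lemma ExpGrowth.const (c : F) : ExpGrowth (fun _ : E => c) :=
  ⟨‖c‖, norm_nonneg _, fun _ => le_exp_mul_one_add (norm_nonneg _) (norm_nonneg _)⟩

lemma ExpGrowth.of_linear {f : E → F} {C : ℝ} (hC : 0 ≤ C) (h : ∀ x, ‖f x‖ ≤ C * (1 + ‖x‖)) :
    ExpGrowth f :=
  ⟨C, hC, fun x => (h x).trans (by linarith [add_one_le_exp (C * (1 + ‖x‖))])⟩

lemma ExpGrowth.add {f g : E → F} (hf : ExpGrowth f) (hg : ExpGrowth g) :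
    ExpGrowth (fun x => f x + g x) := by
  obtain ⟨C, hC, hf⟩ := hf
  obtain ⟨D, hD, hg⟩ := hg
  refine ⟨C + D + 1, by positivity, fun x => (norm_add_le _ _).trans ?_⟩
  have hx := norm_nonneg x
  have h1 : ‖f x‖ ≤ exp ((C + D) * (1 + ‖x‖)) :=
    (hf x).trans (exp_le_exp.2 (by nlinarith [mul_nonneg hD hx]))
  have h2 : ‖g x‖ ≤ exp ((C + D) * (1 + ‖x‖)) :=
    (hg x).trans (exp_le_exp.2 (by nlinarith [mul_nonneg hC hx]))
  have h3 : (2 : ℝ) ≤ exp (1 + ‖x‖) := by linarith [add_one_le_exp (1 + ‖x‖)]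
  rw [add_mul, exp_add _ (1 * _), one_mul]
  nlinarith [exp_pos ((C + D) * (1 + ‖x‖))]

lemma ExpGrowth.mul_bound {f : E → F} {g : E → G} {r : E → H} (hf : ExpGrowth f)
    (hg : ExpGrowth g) {A : ℝ} (hA : 0 ≤ A) (h : ∀ x, ‖r x‖ ≤ A * ‖f x‖ * ‖g x‖) :
    ExpGrowth r := by
  obtain ⟨C, hC, hf⟩ := hf
  obtain ⟨D, hD, hg⟩ := hg
  refine ⟨A + C + D, by positivity, fun x => (h x).trans ?_⟩
  rw [add_mul, add_mul, exp_add, exp_add]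
  have := le_exp_mul_one_add hA (norm_nonneg x)
  gcongr
  · exact hf x
  · exact hg x

lemma ExpGrowth.comp {f : F → G} {φ : E → F} (hf : ExpGrowth f) {A : ℝ} (hA : 0 ≤ A)
    (hφ : ∀ x, ‖φ x‖ ≤ A * (1 + ‖x‖)) : ExpGrowth (fun x => f (φ x)) := by
  obtain ⟨C, hC, hf⟩ := hf
  refine ⟨C * (1 + A), by positivity, fun x => (hf _).trans (exp_le_exp.2 ?_)⟩
  rw [mul_assoc]
  gcongr
  nlinarith [hφ x, norm_nonneg x]

/-- `f` is positive and decays at most exponentially. -/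
def ExpLower (f : E → ℝ) : Prop :=
  ∃ C : ℝ, 0 ≤ C ∧ ∀ x, exp (-(C * (1 + ‖x‖))) ≤ f x

lemma ExpLower.pos {f : E → ℝ} (hf : ExpLower f) (x : E) : 0 < f x := by
  obtain ⟨C, -, hC⟩ := hf
  exact (exp_pos _).trans_le (hC x)

lemma abs_log_le_of_growth {f : E → ℝ} (hf : ExpGrowth f) (hl : ExpLower f) :
    ∃ C : ℝ, 0 ≤ C ∧ ∀ x, |Real.log (f x)| ≤ C * (1 + ‖x‖) := by
  have hpos := hl.pos
  obtain ⟨C, hC, hf⟩ := hf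
  obtain ⟨D, hD, hl⟩ := hl
  refine ⟨C + D, by positivity, fun x => abs_le.2 ⟨?_, ?_⟩⟩
  · have := (Real.le_log_iff_exp_le (hpos x)).2 (hl x)
    nlinarith [mul_nonneg hC (norm_nonneg x)]
  · have := (Real.log_le_iff_le_exp (hpos x)).2 ((le_abs_self _).trans (hf x))
    nlinarith [mul_nonneg hD (norm_nonneg x)]

lemma ExpLower.rpow {f : E → ℝ} (hf : ExpGrowth f) (hl : ExpLower f) (r : ℝ) :
    ExpLower (fun x => f x ^ r) := by
  obtain ⟨C, hC, h⟩ := abs_log_le_of_growth hf hl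
  refine ⟨C * |r|, by positivity, fun x => ?_⟩
  simp only [Real.rpow_def_of_pos (hl.pos x), exp_le_exp]
  have h1 := neg_abs_le (Real.log (f x) * r)
  rw [abs_mul] at h1
  nlinarith [mul_le_mul_of_nonneg_right (h x) (abs_nonneg r)]

lemma ExpGrowth.rpow {f : E → ℝ} (hf : ExpGrowth f) (hl : ExpLower f) (r : ℝ) :
    ExpGrowth (fun x => f x ^ r) := by
  obtain ⟨C, hC, h⟩ := abs_log_le_of_growth hf hl
  refine ⟨C * |r|, by positivity, fun x => ?_⟩
  simp only [Real.rpow_def_of_pos (hl.pos x), Real.norm_eq_abs, abs_of_pos (exp_pos _), exp_le_exp]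
  have h1 := le_abs_self (Real.log (f x) * r)
  rw [abs_mul] at h1
  nlinarith [mul_le_mul_of_nonneg_right (h x) (abs_nonneg r)]

end ExpGrowth

section ExpSmooth

variable {E F G H : Type} [NormedAddCommGroup E] [NormedSpace ℝ E] [NormedAddCommGroup F]
  [NormedSpace ℝ F] [NormedAddCommGroup G] [NormedSpace ℝ G] [NormedAddCommGroup H]
  [NormedSpace ℝ H]

lemma ExpSmooth.growth {k : ℕ} {f : E → F} (hf : ExpSmooth k f) : ExpGrowth f := by
  cases k with
  | zero => exact hf.2
  | succ k => exact hf.2.1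

lemma ExpSmooth.continuous {k : ℕ} {f : E → F} (hf : ExpSmooth k f) : Continuous f := by
  cases k with
  | zero => exact hf.1
  | succ k => exact hf.1.continuous

lemma ExpSmooth.of_succ {k : ℕ} {f : E → F} (hf : ExpSmooth (k + 1) f) : ExpSmooth k f := by
  induction k generalizing F with
  | zero => exact ⟨hf.continuous, hf.growth⟩
  | succ k ih => exact ⟨hf.1, hf.2.1, ih hf.2.2⟩

lemma ExpSmooth.const (k : ℕ) (c : F) : ExpSmooth k (fun _ : E => c) := by
  induction k generalizing F with
  | zero => exact ⟨continuous_const, .const c⟩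
  | succ k ih => exact ⟨differentiable_const c, .const c, by
    rw [show fderiv ℝ (fun _ : E => c) = fun _ => 0 from funext fun x => fderiv_const_apply c]
    exact ih 0⟩

lemma ExpSmooth.add {k : ℕ} {f g : E → F} (hf : ExpSmooth k f) (hg : ExpSmooth k g) :
    ExpSmooth k (fun x => f x + g x) := by
  induction k generalizing F with
  | zero => exact ⟨hf.1.add hg.1, hf.2.add hg.2⟩
  | succ k ih =>
    refine ⟨hf.1.add hg.1, hf.2.1.add hg.2.1, ?_⟩
    have : fderiv ℝ (fun x => f x + g x) = fun x => fderiv ℝ f x + fderiv ℝ g x :=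
      funext fun x => fderiv_add (hf.1 x) (hg.1 x)
    rw [this]
    exact ih hf.2.2 hg.2.2

lemma ExpSmooth.clm (k : ℕ) (L : E →L[ℝ] F) : ExpSmooth k (fun x => L x) := by
  have hL : ExpGrowth (fun x => L x) := by
    refine .of_linear (norm_nonneg L) fun x => (L.le_opNorm x).trans ?_
    nlinarith [norm_nonneg L, norm_nonneg x]
  cases k with
  | zero => exact ⟨L.continuous, hL⟩
  | succ k =>
    refine ⟨L.differentiable, hL, ?_⟩
    have : fderiv ℝ (fun x => L x) = fun _ => L := funext fun x => L.fderiv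
    rw [this]
    exact .const _ _

lemma ExpSmooth.clm_comp {k : ℕ} {f : E → F} (hf : ExpSmooth k f) (L : F →L[ℝ] G) :
    ExpSmooth k (fun x => L (f x)) := by
  have hL : ExpGrowth (fun x => L (f x)) :=
    hf.growth.mul_bound (.const (1 : ℝ)) (norm_nonneg L) fun x => by
      simpa using L.le_opNorm (f x)
  induction k generalizing F G with
  | zero => exact ⟨L.continuous.comp hf.1, hL⟩
  | succ k ih =>
    refine ⟨L.differentiable.comp hf.1, hL, ?_⟩
    have : fderiv ℝ (fun x => L (f x)) =
        fun x => ContinuousLinearMap.compL ℝ E F G L (fderiv ℝ f x) :=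
      funext fun x => (L.hasFDerivAt.comp x (hf.1 x).hasFDerivAt).fderiv
    rw [this]
    refine ih hf.2.2 _ (hf.2.2.growth.mul_bound (.const (1 : ℝ)) (norm_nonneg
      (ContinuousLinearMap.compL ℝ E F G L)) fun x => ?_)
    simpa using ContinuousLinearMap.le_opNorm (ContinuousLinearMap.compL ℝ E F G L) (fderiv ℝ f x)

lemma ExpGrowth.bilin {E : Type} [NormedAddCommGroup E] {f : E → F} {g : E → G}
    (hf : ExpGrowth f) (hg : ExpGrowth g) (B : F →L[ℝ] G →L[ℝ] H) :
    ExpGrowth (fun x => B (f x) (g x)) :=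
  hf.mul_bound hg (norm_nonneg B) fun _ => B.le_opNorm₂ _ _

lemma ExpSmooth.bilin {k : ℕ} {f : E → F} {g : E → G} (hf : ExpSmooth k f) (hg : ExpSmooth k g)
    (B : F →L[ℝ] G →L[ℝ] H) : ExpSmooth k (fun x => B (f x) (g x)) := by
  induction k generalizing F G H with
  | zero => exact ⟨(B.continuous.comp hf.1).clm_apply hg.1, hf.2.bilin hg.2 B⟩
  | succ k ih =>
    have hd : ∀ x, HasFDerivAt (fun x => B (f x) (g x))
        (B.precompR E (f x) (fderiv ℝ g x) + B.precompL E (fderiv ℝ f x) (g x)) x := fun x =>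
      B.hasFDerivAt_of_bilinear (hf.1 x).hasFDerivAt (hg.1 x).hasFDerivAt
    refine ⟨fun x => (hd x).differentiableAt, hf.2.1.bilin hg.2.1 B, ?_⟩
    rw [show fderiv ℝ (fun x => B (f x) (g x)) = _ from funext fun x => (hd x).fderiv]
    exact .add (ih hf.of_succ hg.2.2 _) (ih hf.2.2 hg.of_succ _)

lemma ExpSmooth.smul {k : ℕ} {f : E → ℝ} {g : E → F} (hf : ExpSmooth k f) (hg : ExpSmooth k g) :
    ExpSmooth k (fun x => f x • g x) :=
  hf.bilin hg (ContinuousLinearMap.lsmul ℝ ℝ)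

lemma ExpSmooth.comp {k : ℕ} {f : F → G} {φ : E → F} (hf : ExpSmooth k f) (hφ : ExpSmooth k φ)
    {A : ℝ} (hA : 0 ≤ A) (hb : ∀ x, ‖φ x‖ ≤ A * (1 + ‖x‖)) : ExpSmooth k (fun x => f (φ x)) := by
  induction k generalizing G with
  | zero => exact ⟨hf.1.comp hφ.1, hf.2.comp hA hb⟩
  | succ k ih =>
    refine ⟨hf.1.comp hφ.1, hf.2.1.comp hA hb, ?_⟩
    have : fderiv ℝ (fun x => f (φ x)) =
        fun x => ContinuousLinearMap.compL ℝ E F G (fderiv ℝ f (φ x)) (fderiv ℝ φ x) :=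
      funext fun x => ((hf.1 (φ x)).hasFDerivAt.comp x (hφ.1 x).hasFDerivAt).fderiv
    rw [this]
    exact (ih hf.2.2 hφ.of_succ).bilin hφ.2.2 _

lemma ExpSmooth.rpow {k : ℕ} {f : E → ℝ} (hf : ExpSmooth k f) (hl : ExpLower f) (r : ℝ) :
    ExpSmooth k (fun x => f x ^ r) := by
  induction k generalizing r with
  | zero => exact ⟨hf.1.rpow_const fun x => .inl (hl.pos x).ne', hf.2.rpow hl r⟩
  | succ k ih =>
    have hd : ∀ x, HasFDerivAt (fun x => f x ^ r) ((r * f x ^ (r - 1)) • fderiv ℝ f x) x :=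
      fun x => (hf.1 x).hasFDerivAt.rpow_const (.inl (hl.pos x).ne')
    refine ⟨fun x => (hd x).differentiableAt, hf.2.1.rpow hl r, ?_⟩
    rw [show fderiv ℝ (fun x => f x ^ r) = _ from funext fun x => (hd x).fderiv]
    exact ((ExpSmooth.const k r).smul (ih hf.of_succ (r - 1))).smul hf.2.2

lemma ExpSmooth.exp_clm (k : ℕ) (L : E →L[ℝ] ℝ) : ExpSmooth k (fun x => exp (L x)) := by
  have hg : ExpGrowth (fun x => exp (L x)) := by
    refine ⟨‖L‖, norm_nonneg _, fun x => ?_⟩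
    rw [Real.norm_eq_abs, abs_of_pos (exp_pos _), exp_le_exp]
    have := (le_abs_self _).trans (L.le_opNorm x)
    nlinarith [norm_nonneg L, norm_nonneg x]
  induction k with
  | zero => exact ⟨by fun_prop, hg⟩
  | succ k ih =>
    have hd : ∀ x, HasFDerivAt (fun x => exp (L x)) (exp (L x) • L) x := fun x =>
      L.hasFDerivAt.exp
    refine ⟨fun x => (hd x).differentiableAt, hg, ?_⟩
    rw [show fderiv ℝ (fun x => exp (L x)) = _ from funext fun x => (hd x).fderiv]
    exact ih.smul (.const k L)

lemma expSmooth_cos_sin (k : ℕ) : ExpSmooth k Real.cos ∧ ExpSmooth k Real.sin := by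
  have hc : ExpGrowth Real.cos :=
    (ExpGrowth.const (1 : ℝ)).of_le fun x => by simpa using Real.abs_cos_le_one x
  have hs : ExpGrowth Real.sin :=
    (ExpGrowth.const (1 : ℝ)).of_le fun x => by simpa using Real.abs_sin_le_one x
  induction k with
  | zero => exact ⟨⟨Real.continuous_cos, hc⟩, Real.continuous_sin, hs⟩
  | succ k ih =>
    refine ⟨⟨Real.differentiable_cos, hc, ?_⟩, Real.differentiable_sin, hs, ?_⟩
    · rw [show fderiv ℝ Real.cos = fun x => Real.sin x • (-(1 : ℝ →L[ℝ] ℝ)) from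
        funext fun x => by
          rw [(Real.hasDerivAt_cos x).hasFDerivAt.fderiv]
          ext
          simp]
      exact ih.2.smul (.const k _)
    · rw [show fderiv ℝ Real.sin = fun x => Real.cos x • (1 : ℝ →L[ℝ] ℝ) from
        funext fun x => by
          rw [(Real.hasDerivAt_sin x).hasFDerivAt.fderiv]
          ext
          simp]
      exact ih.1.smul (.const k _)

end ExpSmooth

lemma integrable_exp_mul_abs_gaussian (C : ℝ) :
    Integrable (fun z : ℝ => exp (C * |z|)) (gaussianReal 0 1) :=
  integrable_exp_mul_abs (X := fun z => z) (integrable_exp_mul_gaussianReal C)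
    (integrable_exp_mul_gaussianReal (-C))

section GaussianAverage

variable {E F : Type} [NormedAddCommGroup E] [NormedAddCommGroup F]

lemma exp_norm_prod_le {C : ℝ} (hC : 0 ≤ C) (y : E) (z : ℝ) :
    exp (C * (1 + ‖(y, z)‖)) ≤ exp (C * (1 + ‖y‖)) * exp (C * |z|) := by
  rw [← exp_add, exp_le_exp, ← mul_add]
  have : ‖(y, z)‖ ≤ ‖y‖ + |z| := by
    rw [Prod.norm_def, Real.norm_eq_abs]
    exact max_le_add_of_nonneg (norm_nonneg _) (abs_nonneg _)
  exact mul_le_mul_of_nonneg_left (by linarith) hC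

lemma ExpGrowth.exists_bound_slice {g : E × ℝ → F} (hg : ExpGrowth g) :
    ∃ C : ℝ, 0 ≤ C ∧ ∀ y z, ‖g (y, z)‖ ≤ exp (C * (1 + ‖y‖)) * exp (C * |z|) := by
  obtain ⟨C, hC, h⟩ := hg
  exact ⟨C, hC, fun y z => (h _).trans (exp_norm_prod_le hC y z)⟩

lemma ExpGrowth.integrable {g : ℝ → F} (hg : ExpGrowth g) (hc : Continuous g) :
    Integrable g (gaussianReal 0 1) := by
  obtain ⟨C, hC, h⟩ := hg
  refine ((integrable_exp_mul_abs_gaussian C).const_mul (exp C)).mono' hc.aestronglyMeasurable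
    (.of_forall fun z => (h z).trans_eq ?_)
  rw [← exp_add, Real.norm_eq_abs]
  ring_nf

lemma ExpGrowth.slice {g : E × ℝ → F} (hg : ExpGrowth g) (y : E) :
    ExpGrowth (fun z => g (y, z)) :=
  hg.comp (A := 1 + ‖y‖) (by positivity) fun z => by
    rw [Prod.norm_def]
    refine max_le ?_ ?_ <;> nlinarith [norm_nonneg y, norm_nonneg z]

lemma ExpLower.integral {g : E × ℝ → ℝ} (hg : ExpGrowth g) (hc : Continuous g)
    (hl : ExpLower g) : ExpLower (fun y => ∫ z, g (y, z) ∂gaussianReal 0 1) := by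
  obtain ⟨C, hC, h⟩ := hl
  set c := ∫ z, exp (-C * |z|) ∂gaussianReal 0 1 with hcdef
  have hcpos : 0 < c := integral_exp_pos (integrable_exp_mul_abs_gaussian (-C))
  refine ⟨C + |Real.log c|, by positivity, fun y => ?_⟩
  calc exp (-((C + |Real.log c|) * (1 + ‖y‖)))
      ≤ exp (-(C * (1 + ‖y‖))) * exp (Real.log c) := by
        rw [← exp_add, exp_le_exp]
        nlinarith [neg_abs_le (Real.log c), mul_nonneg (abs_nonneg (Real.log c)) (norm_nonneg y)]
    _ = ∫ z, exp (-(C * (1 + ‖y‖))) * exp (-C * |z|) ∂gaussianReal 0 1 := by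
        rw [exp_log hcpos, integral_const_mul]
    _ ≤ _ := by
        refine integral_mono ((integrable_exp_mul_abs_gaussian (-C)).const_mul _)
          ((hg.slice y).integrable (by fun_prop)) fun z => (le_trans ?_ (h (y, z)))
        have := exp_norm_prod_le hC y z
        have h1 : exp (-(C * (1 + ‖y‖))) * exp (-C * |z|)
            = (exp (C * (1 + ‖y‖)) * exp (C * |z|))⁻¹ := by
          rw [← exp_add, ← exp_add, ← exp_neg]
          ring_nf
        change exp (-(C * (1 + ‖y‖))) * exp (-C * |z|) ≤ exp (-(C * (1 + ‖(y, z)‖)))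
        rw [h1, exp_neg]
        gcongr

variable [NormedSpace ℝ F]

lemma ExpGrowth.integral {g : E × ℝ → F} (hg : ExpGrowth g) :
    ExpGrowth (fun y => ∫ z, g (y, z) ∂gaussianReal 0 1) := by
  obtain ⟨C, hC, h⟩ := hg.exists_bound_slice
  set c := ∫ z, exp (C * |z|) ∂gaussianReal 0 1 with hcdef
  have hcpos : 0 < c := integral_exp_pos (integrable_exp_mul_abs_gaussian C)
  refine ⟨C + |Real.log c|, by positivity, fun y => ?_⟩
  calc _ ≤ ∫ z, exp (C * (1 + ‖y‖)) * exp (C * |z|) ∂gaussianReal 0 1 :=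
        norm_integral_le_of_norm_le ((integrable_exp_mul_abs_gaussian C).const_mul _)
          (.of_forall (h y))
    _ = exp (C * (1 + ‖y‖)) * exp (Real.log c) := by rw [exp_log hcpos, integral_const_mul]
    _ ≤ _ := by
        rw [← exp_add, exp_le_exp]
        nlinarith [le_abs_self (Real.log c), mul_nonneg (abs_nonneg (Real.log c)) (norm_nonneg y)]

variable [NormedSpace ℝ E]

lemma ExpSmooth.continuous_integral {g : E × ℝ → F} (hg : ExpSmooth 0 g) :
    Continuous (fun y => ∫ z, g (y, z) ∂gaussianReal 0 1) := by
  obtain ⟨C, hC, h⟩ := hg.2.exists_bound_slice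
  have hc := hg.1
  refine continuous_iff_continuousAt.2 fun y₀ => continuousAt_of_dominated
    (bound := fun z => exp (C * (2 + ‖y₀‖)) * exp (C * |z|))
    (.of_forall fun y => (by fun_prop : Continuous fun z => g (y, z)).aestronglyMeasurable) ?_
    ((integrable_exp_mul_abs_gaussian C).const_mul _) (.of_forall fun z => by fun_prop)
  filter_upwards [Metric.ball_mem_nhds y₀ one_pos] with y hy
  refine .of_forall fun z => (h y z).trans ?_
  have := norm_le_norm_add_norm_sub' y y₀
  rw [mem_ball_iff_norm] at hy
  gcongr ?_ * _
  rw [exp_le_exp]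
  exact mul_le_mul_of_nonneg_left (by linarith) hC

lemma ExpSmooth.hasFDerivAt_integral {g : E × ℝ → F} (hg : ExpSmooth 1 g) (y₀ : E) :
    HasFDerivAt (fun y => ∫ z, g (y, z) ∂gaussianReal 0 1)
      (∫ z, (fderiv ℝ g (y₀, z)).comp (.inl ℝ E ℝ) ∂gaussianReal 0 1) y₀ := by
  obtain ⟨C, hC, h⟩ := hg.2.2.2.exists_bound_slice
  have hc := hg.1.continuous
  have hc' := hg.2.2.1
  refine hasFDerivAt_integral_of_dominated_of_fderiv_le
    (bound := fun z => exp (C * (2 + ‖y₀‖)) * exp (C * |z|))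
    (F' := fun y z => (fderiv ℝ g (y, z)).comp (.inl ℝ E ℝ))
    (Metric.ball_mem_nhds y₀ one_pos)
    (.of_forall fun y => (by fun_prop : Continuous fun z => g (y, z)).aestronglyMeasurable)
    ((hg.2.1.slice y₀).integrable (by fun_prop))
    (Continuous.aestronglyMeasurable (by fun_prop)) (.of_forall fun z y hy => ?_)
    ((integrable_exp_mul_abs_gaussian C).const_mul _) (.of_forall fun z y hy => ?_)
  · have h1 : ‖(fderiv ℝ g (y, z)).comp (.inl ℝ E ℝ)‖ ≤ ‖fderiv ℝ g (y, z)‖ := by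
      refine (ContinuousLinearMap.opNorm_comp_le _ _).trans ?_
      exact mul_le_of_le_one_right (norm_nonneg _) (ContinuousLinearMap.norm_inl_le_one ℝ E ℝ)
    refine (h1.trans (h y z)).trans ?_
    have := norm_le_norm_add_norm_sub' y y₀
    rw [mem_ball_iff_norm] at hy
    gcongr ?_ * _
    rw [exp_le_exp]
    exact mul_le_mul_of_nonneg_left (by linarith) hC
  · exact (hg.1 (y, z)).hasFDerivAt.comp y (hasFDerivAt_prodMk_left y z)

lemma ExpSmooth.integral {k : ℕ} {g : E × ℝ → F} (hg : ExpSmooth k g) :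
    ExpSmooth k (fun y => ∫ z, g (y, z) ∂gaussianReal 0 1) := by
  induction k generalizing F with
  | zero => exact ⟨hg.continuous_integral, hg.2.integral⟩
  | succ k ih =>
    have h1 : ExpSmooth 1 g := ⟨hg.1, hg.2.1, hg.2.2.continuous, hg.2.2.growth⟩
    refine ⟨fun y => (h1.hasFDerivAt_integral y).differentiableAt, hg.2.1.integral, ?_⟩
    rw [show fderiv ℝ (fun y => ∫ z, g (y, z) ∂gaussianReal 0 1) = _ from
      funext fun y => (h1.hasFDerivAt_integral y).fderiv]
    exact ih (hg.2.2.clm_comp ((ContinuousLinearMap.compL ℝ E (E × ℝ) F).flip (.inl ℝ E ℝ)))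

end GaussianAverage

lemma hasDerivAt_gaussianPDFReal (z : ℝ) :
    HasDerivAt (gaussianPDFReal 0 1) (-z * gaussianPDFReal 0 1 z) z := by
  have h : HasDerivAt (fun z : ℝ => (√(2 * π * (1 : NNReal)))⁻¹ *
      exp (-(z - 0) ^ 2 / (2 * (1 : NNReal))))
      ((√(2 * π * (1 : NNReal)))⁻¹ * (exp (-(z - 0) ^ 2 / (2 * (1 : NNReal))) *
        (-(2 * (z - 0)) / (2 * (1 : NNReal))))) z := by
    refine (HasDerivAt.exp ?_).const_mul _
    refine (HasDerivAt.neg ?_).div_const _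
    simpa using HasDerivAt.fun_pow ((hasDerivAt_id' z).sub_const 0) 2
  rw [gaussianPDFReal_def]
  convert h using 1
  simp
  ring

lemma integrable_gaussian_iff {g : ℝ → ℝ} :
    Integrable g (gaussianReal 0 1) ↔ Integrable (fun z => gaussianPDFReal 0 1 z * g z) := by
  rw [gaussianReal_of_var_ne_zero _ one_ne_zero, gaussianPDF_def,
    integrable_withDensity_iff_integrable_smul' (by fun_prop) (by simp)]
  simp [ENNReal.toReal_ofReal (gaussianPDFReal_nonneg _ _ _)]

/-- Gaussian integration by parts. -/
lemma integral_mul_gaussian_eq {g g' : ℝ → ℝ} (hd : ∀ z, HasDerivAt g (g' z) z)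
    (hg : Integrable g (gaussianReal 0 1)) (hg' : Integrable g' (gaussianReal 0 1))
    (hzg : Integrable (fun z => z * g z) (gaussianReal 0 1)) :
    ∫ z, z * g z ∂gaussianReal 0 1 = ∫ z, g' z ∂gaussianReal 0 1 := by
  have h := integral_eq_zero_of_hasDerivAt_of_integrable
    (f := fun z => gaussianPDFReal 0 1 z * g z)
    (f' := fun z => gaussianPDFReal 0 1 z * g' z - gaussianPDFReal 0 1 z * (z * g z))
    (fun z => ((hasDerivAt_gaussianPDFReal z).fun_mul (hd z)).congr_deriv (by ring))
    ((integrable_gaussian_iff.1 hg').sub (integrable_gaussian_iff.1 hzg))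
    (integrable_gaussian_iff.1 hg)
  rw [integral_sub (integrable_gaussian_iff.1 hg') (integrable_gaussian_iff.1 hzg)] at h
  simp only [integral_gaussianReal_eq_integral_smul one_ne_zero, smul_eq_mul]
  linarith

/-- A smooth amplitude `s` with values in `[-1, 1]`, derivative `s'`, whose square has derivative
`ε * sin (2 θ)`. -/
structure IsScale (s s' : ℝ → ℝ) (ε : ℝ) : Prop where
  smooth : ExpSmooth 2 s
  abs_le_one : ∀ θ, |s θ| ≤ 1
  hasDerivAt : ∀ θ, HasDerivAt s (s' θ) θ
  mul_deriv : ∀ θ, s θ * s' θ = ε * (Real.sin (2 * θ) / 2)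

lemma isScale_cos : IsScale Real.cos (fun θ => -Real.sin θ) (-1) where
  smooth := (expSmooth_cos_sin 2).1
  abs_le_one := Real.abs_cos_le_one
  hasDerivAt := Real.hasDerivAt_cos
  mul_deriv θ := by rw [Real.sin_two_mul]; ring

lemma isScale_sin : IsScale Real.sin Real.cos 1 where
  smooth := (expSmooth_cos_sin 2).2
  abs_le_one := Real.abs_sin_le_one
  hasDerivAt := Real.hasDerivAt_sin
  mul_deriv θ := by rw [Real.sin_two_mul]; ring

section Average

variable {V F : Type} [NormedAddCommGroup V] [NormedSpace ℝ V] [NormedAddCommGroup F]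
  [NormedSpace ℝ F]

lemma ExpSmooth.fderiv_apply {E F : Type} [NormedAddCommGroup E] [NormedSpace ℝ E]
    [NormedAddCommGroup F] [NormedSpace ℝ F] {k : ℕ} {w : E → F} (hw : ExpSmooth (k + 1) w)
    (e : E) :
    ExpSmooth k (fun y => fderiv ℝ w y e) :=
  hw.2.2.clm_comp (ContinuousLinearMap.apply ℝ F e)

/-- Translate the space variable of `y = (θ, x)` by `s θ * z` in the direction `v`. -/
def spaceShift (s : ℝ → ℝ) (v : V) (p : (ℝ × V) × ℝ) : ℝ × V :=
  p.1 + (s p.1.1 * p.2) • ((0 : ℝ), v)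

/-- Average over a Gaussian translation of amplitude `s θ` in the direction `v`. -/
def gaussAvg (s : ℝ → ℝ) (v : V) (w : ℝ × V → F) (y : ℝ × V) : F :=
  ∫ z, w (spaceShift s v (y, z)) ∂gaussianReal 0 1

variable {s s' : ℝ → ℝ} {ε : ℝ} (v : V)

lemma IsScale.norm_spaceShift_le (hs : IsScale s s' ε) (p : (ℝ × V) × ℝ) :
    ‖spaceShift s v p‖ ≤ (1 + ‖v‖) * (1 + ‖p‖) := by
  have h1 : ‖p.1‖ ≤ ‖p‖ := le_max_left _ _
  have h2 : ‖p.2‖ ≤ ‖p‖ := le_max_right _ _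
  have h3 : ‖((0 : ℝ), v)‖ = ‖v‖ := by simp [Prod.norm_def]
  calc ‖spaceShift s v p‖ ≤ ‖p.1‖ + |s p.1.1| * ‖p.2‖ * ‖v‖ := by
        refine (norm_add_le _ _).trans ?_
        rw [norm_smul, norm_mul, h3, Real.norm_eq_abs]
    _ ≤ ‖p‖ + 1 * ‖p‖ * ‖v‖ := by
        gcongr
        exact hs.abs_le_one _
    _ ≤ _ := by nlinarith [norm_nonneg v, norm_nonneg p]

lemma IsScale.expSmooth_spaceShift (hs : IsScale s s' ε) : ExpSmooth 2 (spaceShift s v) := by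
  have h1 : ExpSmooth 2 (fun p : (ℝ × V) × ℝ => s p.1.1) :=
    hs.smooth.comp (.clm 2 ((ContinuousLinearMap.fst ℝ ℝ V).comp
      (ContinuousLinearMap.fst ℝ (ℝ × V) ℝ))) zero_le_one fun p => by
        have h1 : ‖p.1.1‖ ≤ ‖p.1‖ := le_max_left _ _
        have h2 : ‖p.1‖ ≤ ‖p‖ := le_max_left _ _
        exact (h1.trans h2).trans (by linarith)
  have h2 := (ExpSmooth.clm 2 (ContinuousLinearMap.fst ℝ (ℝ × V) ℝ)).add (h1.smul
    (.clm 2 ((ContinuousLinearMap.snd ℝ (ℝ × V) ℝ).smulRight ((0 : ℝ), v))))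
  refine (congrArg (ExpSmooth 2) (funext fun p => ?_)).mp h2
  simp [spaceShift, mul_smul]

lemma IsScale.comp_spaceShift (hs : IsScale s s' ε) {k : ℕ} (hk : k ≤ 2) {w : ℝ × V → F}
    (hw : ExpSmooth k w) :
    ExpSmooth k (fun p => w (spaceShift s v p)) := by
  have h2 := hs.expSmooth_spaceShift v
  have hk' : ExpSmooth k (spaceShift s v) := by
    interval_cases k
    exacts [h2.of_succ.of_succ, h2.of_succ, h2]
  exact hw.comp hk' (by positivity) (hs.norm_spaceShift_le v)

lemma IsScale.integrable (hs : IsScale s s' ε) {w : ℝ × V → F} {k : ℕ} (hk : k ≤ 2)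
    (hw : ExpSmooth k w) (y : ℝ × V) :
    Integrable (fun z => w (spaceShift s v (y, z))) (gaussianReal 0 1) := by
  have h := hs.comp_spaceShift v hk hw
  exact (h.growth.slice y).integrable (h.continuous.comp (Continuous.prodMk_right y))

lemma IsScale.integrable_mul (hs : IsScale s s' ε) {w : ℝ × V → ℝ} {k : ℕ} (hk : k ≤ 2)
    (hw : ExpSmooth k w) (y : ℝ × V) : Integrable (fun z => z * w (spaceShift s v (y, z))) (gaussianReal 0 1) := by
  have h := (ExpSmooth.clm k (ContinuousLinearMap.snd ℝ (ℝ × V) ℝ)).smul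
    (hs.comp_spaceShift v hk hw)
  exact (h.growth.slice y).integrable (h.continuous.comp (Continuous.prodMk_right y))

lemma IsScale.expSmooth_gaussAvg (hs : IsScale s s' ε) [CompleteSpace F] {k : ℕ} (hk : k ≤ 2)
    {w : ℝ × V → F} (hw : ExpSmooth k w) : ExpSmooth k (gaussAvg s v w) :=
  (hs.comp_spaceShift v hk hw).integral

lemma IsScale.hasFDerivAt_comp_spaceShift (hs : IsScale s s' ε) {w : ℝ × V → F}
    (hw : ExpSmooth 1 w) (y : ℝ × V) (z : ℝ) :
    HasFDerivAt (fun y => w (spaceShift s v (y, z)))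
      ((fderiv ℝ w (spaceShift s v (y, z))).comp (ContinuousLinearMap.id ℝ (ℝ × V) +
        ((s' y.1 * z) • ContinuousLinearMap.fst ℝ ℝ V).smulRight ((0 : ℝ), v))) y := by
  have h : HasFDerivAt (fun y : ℝ × V => spaceShift s v (y, z))
      (ContinuousLinearMap.id ℝ (ℝ × V) +
        ((s' y.1 * z) • ContinuousLinearMap.fst ℝ ℝ V).smulRight ((0 : ℝ), v)) y := by
    refine (hasFDerivAt_id y).add (HasFDerivAt.smul_const ?_ _)
    have h1 := ((hs.hasDerivAt y.1).comp_hasFDerivAt y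
      (hasFDerivAt_fst (𝕜 := ℝ) (E := ℝ) (F := V))).mul_const z
    refine h1.congr_fderiv ?_
    rw [smul_smul, mul_comm z]
  exact (hw.1 _).hasFDerivAt.comp y h

lemma IsScale.fderiv_gaussAvg (hs : IsScale s s' ε) [CompleteSpace F] {w : ℝ × V → F}
    (hw : ExpSmooth 1 w) (y e : ℝ × V) : fderiv ℝ (gaussAvg s v w) y e =
      ∫ z, fderiv ℝ w (spaceShift s v (y, z)) (e + (s' y.1 * z * e.1) • ((0 : ℝ), v))
        ∂gaussianReal 0 1 := by
  have hg := hs.comp_spaceShift v one_le_two hw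
  have hi := ((hg.2.2.clm_comp ((ContinuousLinearMap.compL ℝ (ℝ × V) ((ℝ × V) × ℝ) F).flip
    (.inl ℝ (ℝ × V) ℝ))))
  have hi2 := (hi.growth.slice y).integrable (hi.continuous.comp (Continuous.prodMk_right y))
  refine (congrArg (· e) (hg.hasFDerivAt_integral y).fderiv).trans ?_
  refine (ContinuousLinearMap.integral_apply hi2 e).trans
    (integral_congr_ae (.of_forall fun z => ?_))
  have h1 := ((hg.1 (y, z)).hasFDerivAt.comp (f := fun y => (y, z)) y
    (hasFDerivAt_prodMk_left y z)).unique
    (hs.hasFDerivAt_comp_spaceShift v hw y z)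
  refine (congrArg (· e) h1).trans ?_
  simp

lemma IsScale.fderiv_gaussAvg_space (hs : IsScale s s' ε) [CompleteSpace F] {w : ℝ × V → F}
    (hw : ExpSmooth 1 w) (y : ℝ × V) (a : V) : fderiv ℝ (gaussAvg s v w) y (0, a) =
      gaussAvg s v (fun y => fderiv ℝ w y (0, a)) y := by
  rw [hs.fderiv_gaussAvg v hw]
  simp [gaussAvg]

lemma IsScale.fderiv_fderiv_gaussAvg (hs : IsScale s s' ε) [CompleteSpace F] {w : ℝ × V → F}
    (hw : ExpSmooth 2 w) (y : ℝ × V) (a b : V) : fderiv ℝ (fderiv ℝ (gaussAvg s v w)) y (0, a) (0, b) =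
      gaussAvg s v (fun y => fderiv ℝ (fderiv ℝ w) y (0, a) (0, b)) y := by
  have hW := hs.expSmooth_gaussAvg v le_rfl hw
  have happ : ∀ {f : ℝ × V → F}, ExpSmooth 2 f → ∀ y, fderiv ℝ (fderiv ℝ f) y (0, a) (0, b) =
      fderiv ℝ (fun y => fderiv ℝ f y (0, b)) y (0, a) := fun hf y => by
    rw [fderiv_clm_apply (hf.2.2.1 y) (differentiableAt_const _)]
    simp
  rw [happ hW, funext fun y => hs.fderiv_gaussAvg_space v hw.of_succ y b,
    hs.fderiv_gaussAvg_space v (hw.fderiv_apply _)]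
  simp only [happ hw]

lemma IsScale.fderiv_gaussAvg_time (hs : IsScale s s' ε) {w : ℝ × V → ℝ} (hw : ExpSmooth 2 w)
    (y : ℝ × V) :
    fderiv ℝ (gaussAvg s v w) y (1, 0) = gaussAvg s v (fun y => fderiv ℝ w y (1, 0)) y +
      ε * (Real.sin (2 * y.1) / 2) *
        gaussAvg s v (fun y => fderiv ℝ (fderiv ℝ w) y (0, v) (0, v)) y := by
  have h1 := hw.fderiv_apply ((1 : ℝ), (0 : V))
  have h2 := hw.fderiv_apply ((0 : ℝ), v)
  have h3 := (hw.2.2.fderiv_apply ((0 : ℝ), v)).clm_comp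
    (ContinuousLinearMap.apply ℝ ℝ ((0 : ℝ), v))
  have hibp := integral_mul_gaussian_eq
    (g := fun z => fderiv ℝ w (spaceShift s v (y, z)) (0, v))
    (g' := fun z => s y.1 * fderiv ℝ (fderiv ℝ w) (spaceShift s v (y, z)) (0, v) (0, v))
    (fun z => by
      have ha : HasDerivAt (fun z => spaceShift s v (y, z)) (s y.1 • ((0 : ℝ), v)) z := by
        refine HasDerivAt.const_add y (HasDerivAt.smul_const ?_ _)
        simpa using (hasDerivAt_id z).const_mul (s y.1)
      have hb := (hw.2.2.1 (spaceShift s v (y, z))).hasFDerivAt.comp_hasDerivAt z ha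
      have hc := hb.clm_apply (hasDerivAt_const z ((0 : ℝ), v))
      refine hc.congr_deriv ?_
      rw [map_zero, add_zero, map_smul, smul_apply, smul_eq_mul])
    (hs.integrable v one_le_two h2 y) ((hs.integrable v zero_le_two h3 y).const_mul _)
    (hs.integrable_mul v one_le_two h2 y)
  rw [hs.fderiv_gaussAvg v hw.of_succ]
  simp only [map_add, map_smul, smul_eq_mul, mul_one]
  rw [integral_add (hs.integrable v one_le_two h1 y)]
  · simp only [mul_assoc (s' y.1)]
    rw [integral_const_mul, hibp, integral_const_mul, ← mul_assoc, ← hs.mul_deriv,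
      mul_comm (s' y.1)]
    rfl
  · simp only [mul_assoc (s' y.1)]
    exact (hs.integrable_mul v one_le_two h2 y).const_mul _

end Average

section HeatSubsolution

variable {S : Type} [Fintype S] [DecidableEq S]

/-- The coordinate direction `σ` in the space variable. -/
def spaceDir (σ : S) : ℝ × (S → ℝ) := (0, Pi.single σ 1)

/-- The heat operator `∂_θ + (sin (2 θ) / 2) ∑ M σ τ ∂_σ ∂_τ`. -/
def heatOp (M : S → S → ℝ) (w : ℝ × (S → ℝ) → ℝ) (y : ℝ × (S → ℝ)) : ℝ :=
  fderiv ℝ w y (1, 0) + Real.sin (2 * y.1) / 2 *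
    ∑ σ, ∑ τ, M σ τ * fderiv ℝ (fderiv ℝ w) y (spaceDir σ) (spaceDir τ)

/-- Positive functions of `(θ, x)`, nondecreasing in each coordinate of `x`, that are subsolutions
of the heat equation attached to `M` for `θ ∈ [0, π / 2]`. -/
structure HeatSubsolution (M : S → S → ℝ) (w : ℝ × (S → ℝ) → ℝ) : Prop where
  smooth : ExpSmooth 2 w
  lower : ExpLower w
  mono : ∀ y σ, 0 ≤ fderiv ℝ w y (spaceDir σ)
  heat : ∀ y : ℝ × (S → ℝ), y.1 ∈ Set.Icc 0 (π / 2) → 0 ≤ heatOp M w y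

lemma sum_mul_spaceDir {G : Type} [NormedAddCommGroup G] [NormedSpace ℝ G]
    (L : ℝ × (S → ℝ) →L[ℝ] G) (v : S → ℝ) : L (0, v) = ∑ σ, v σ • L (spaceDir σ) := by
  have h : ((0 : ℝ), v) = ∑ σ, v σ • spaceDir σ := by
    ext σ
    · simp [spaceDir, Prod.fst_sum]
    · simp [spaceDir, Prod.snd_sum, Finset.sum_apply, Pi.single_apply]
  rw [h, map_sum]
  simp

lemma heatOp_add_rankOne (M : S → S → ℝ) (ε : ℝ) (v : S → ℝ) (w : ℝ × (S → ℝ) → ℝ)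
    (y : ℝ × (S → ℝ)) : heatOp (fun σ τ => M σ τ + ε * (v σ * v τ)) w y =
      heatOp M w y + Real.sin (2 * y.1) / 2 * ε * fderiv ℝ (fderiv ℝ w) y (0, v) (0, v) := by
  have h : fderiv ℝ (fderiv ℝ w) y (0, v) (0, v) =
      ∑ σ, ∑ τ, v σ * v τ * fderiv ℝ (fderiv ℝ w) y (spaceDir σ) (spaceDir τ) := by
    rw [sum_mul_spaceDir (fderiv ℝ (fderiv ℝ w) y) v, sum_apply]
    refine Finset.sum_congr rfl fun σ _ => ?_
    rw [smul_apply, sum_mul_spaceDir, smul_eq_mul, Finset.mul_sum]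
    exact Finset.sum_congr rfl fun τ _ => by rw [smul_eq_mul, mul_assoc]
  have h' : ∑ σ, ∑ τ, ε * (v σ * v τ) * fderiv ℝ (fderiv ℝ w) y (spaceDir σ) (spaceDir τ) =
      ε * fderiv ℝ (fderiv ℝ w) y (0, v) (0, v) := by
    simp only [h, Finset.mul_sum, mul_assoc]
  simp only [heatOp, add_mul, Finset.sum_add_distrib, h']
  ring

variable {M : S → S → ℝ} {w : ℝ × (S → ℝ) → ℝ}

lemma heatOp_gaussAvg {s s' : ℝ → ℝ} {ε : ℝ} (hs : IsScale s s' ε) (v : S → ℝ)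
    (hw : ExpSmooth 2 w) (y : ℝ × (S → ℝ)) : heatOp M (gaussAvg s v w) y =
      gaussAvg s v (heatOp (fun σ τ => M σ τ + ε * (v σ * v τ)) w) y := by
  have hD : ∀ a b : S → ℝ, ExpSmooth 0 (fun y => fderiv ℝ (fderiv ℝ w) y (0, a) (0, b)) :=
    fun a b => (hw.2.2.fderiv_apply ((0 : ℝ), a)).clm_comp
      (ContinuousLinearMap.apply ℝ ℝ ((0 : ℝ), b))
  have hi := fun a b => hs.integrable v zero_le_two (hD a b) y
  have ht := hs.integrable v one_le_two (hw.fderiv_apply ((1 : ℝ), (0 : S → ℝ))) y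
  have hfst : ∀ z, (spaceShift s v (y, z)).1 = y.1 := fun z => by simp [spaceShift]
  have hsum : ∀ σ τ, Integrable (fun z => M σ τ * fderiv ℝ (fderiv ℝ w) (spaceShift s v (y, z))
      (spaceDir σ) (spaceDir τ)) (gaussianReal 0 1) := fun σ τ => (hi _ _).const_mul _
  have hint : gaussAvg s v (heatOp M w) y = gaussAvg s v (fun y => fderiv ℝ w y (1, 0)) y +
      Real.sin (2 * y.1) / 2 * ∑ σ, ∑ τ, M σ τ *
        gaussAvg s v (fun y => fderiv ℝ (fderiv ℝ w) y (spaceDir σ) (spaceDir τ)) y := by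
    simp only [gaussAvg, heatOp, hfst]
    rw [integral_add ht ((integrable_finsetSum _ fun σ _ => integrable_finsetSum _ fun τ _ =>
        hsum σ τ).const_mul _), integral_const_mul,
      integral_finsetSum _ fun σ _ => integrable_finsetSum _ fun τ _ => hsum σ τ]
    congr 2
    refine Finset.sum_congr rfl fun σ _ => ?_
    rw [integral_finsetSum _ fun τ _ => hsum σ τ]
    exact Finset.sum_congr rfl fun τ _ => integral_const_mul _ _
  have hM : Integrable (fun z => heatOp M w (spaceShift s v (y, z))) (gaussianReal 0 1) := by
    simp only [heatOp, hfst]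
    exact ht.add ((integrable_finsetSum _ fun σ _ => integrable_finsetSum _ fun τ _ =>
        hsum σ τ).const_mul _)
  have hadd : gaussAvg s v (heatOp (fun σ τ => M σ τ + ε * (v σ * v τ)) w) y =
      gaussAvg s v (heatOp M w) y + Real.sin (2 * y.1) / 2 * ε *
        gaussAvg s v (fun y => fderiv ℝ (fderiv ℝ w) y (0, v) (0, v)) y := by
    simp only [gaussAvg, heatOp_add_rankOne, hfst]
    rw [integral_add hM ((hi v v).const_mul _), integral_const_mul]
  rw [hadd, hint, heatOp, hs.fderiv_gaussAvg_time v hw]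
  simp only [spaceDir, hs.fderiv_fderiv_gaussAvg v hw]
  ring

lemma HeatSubsolution.gaussAvg {s s' : ℝ → ℝ} {ε : ℝ} (hs : IsScale s s' ε) (v : S → ℝ)
    (hw : HeatSubsolution (fun σ τ => M σ τ + ε * (v σ * v τ)) w) :
    HeatSubsolution M (gaussAvg s v w) where
  smooth := hs.expSmooth_gaussAvg v le_rfl hw.smooth
  lower := by
    have h := hs.comp_spaceShift v le_rfl hw.smooth
    refine ExpLower.integral (g := fun p => w (spaceShift s v p)) h.growth h.continuous ?_
    obtain ⟨C, hC, hl⟩ := hw.lower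
    refine ⟨C * (1 + (1 + ‖v‖)), by positivity, fun p => le_trans ?_ (hl _)⟩
    rw [exp_le_exp, neg_le_neg_iff, mul_assoc]
    gcongr
    nlinarith [hs.norm_spaceShift_le v p, norm_nonneg p]
  mono y σ := by
    rw [spaceDir, hs.fderiv_gaussAvg_space v hw.smooth.of_succ]
    exact integral_nonneg fun z => hw.mono _ σ
  heat y hy := by
    rw [heatOp_gaussAvg hs v hw.smooth]
    exact integral_nonneg fun z => hw.heat _ (by simpa [spaceShift] using hy)

lemma sin_two_mul_div_two_nonneg {θ : ℝ} (hθ : θ ∈ Set.Icc 0 (π / 2)) :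
    0 ≤ Real.sin (2 * θ) / 2 :=
  div_nonneg (Real.sin_nonneg_of_nonneg_of_le_pi (by linarith [hθ.1]) (by linarith [hθ.2]))
    zero_le_two

lemma HeatSubsolution.rpow (hw : HeatSubsolution M w) (hM : ∀ σ τ, M σ τ ≤ 0) {r : ℝ}
    (hr0 : 0 < r) (hr1 : r ≤ 1) : HeatSubsolution M (fun y => w y ^ r) := by
  have hpos := hw.lower.pos
  have hd : ∀ r : ℝ, fderiv ℝ (fun y => w y ^ r) = fun y => (r * w y ^ (r - 1)) • fderiv ℝ w y :=
    fun r => funext fun y =>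
      ((hw.smooth.1 y).hasFDerivAt.rpow_const (.inl (hpos y).ne')).fderiv
  have hd2 : ∀ y a b, fderiv ℝ (fderiv ℝ (fun y => w y ^ r)) y a b =
      r * w y ^ (r - 1) * fderiv ℝ (fderiv ℝ w) y a b +
        r * (r - 1) * w y ^ (r - 1 - 1) * (fderiv ℝ w y a * fderiv ℝ w y b) := fun y a b => by
    have h1 := ((hw.smooth.1 y).hasFDerivAt.rpow_const (p := r - 1)
      (.inl (hpos y).ne')).const_mul r
    have h2 := (hw.smooth.2.2.1 y).hasFDerivAt
    rw [hd, (h1.fun_smul h2).fderiv]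
    simp
    ring
  refine ⟨hw.smooth.rpow hw.lower r, hw.lower.rpow hw.smooth.growth r, fun y σ => ?_,
    fun y hy => ?_⟩
  · rw [hd]
    exact mul_nonneg (mul_nonneg hr0.le (rpow_pos_of_pos (hpos y) _).le) (hw.mono y σ)
  · have hsq : ∑ σ, ∑ τ, M σ τ * (fderiv ℝ w y (spaceDir σ) * fderiv ℝ w y (spaceDir τ)) ≤ 0 :=
      Finset.sum_nonpos fun σ _ => Finset.sum_nonpos fun τ _ =>
        mul_nonpos_of_nonpos_of_nonneg (hM σ τ) (mul_nonneg (hw.mono y σ) (hw.mono y τ))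
    have heq : heatOp M (fun y => w y ^ r) y = r * w y ^ (r - 1) * heatOp M w y +
        (1 - r) * r * w y ^ (r - 1 - 1) * (Real.sin (2 * y.1) / 2) *
          -∑ σ, ∑ τ, M σ τ * (fderiv ℝ w y (spaceDir σ) * fderiv ℝ w y (spaceDir τ)) := by
      have : ∑ σ, ∑ τ, M σ τ * fderiv ℝ (fderiv ℝ (fun y => w y ^ r)) y (spaceDir σ) (spaceDir τ) =
          r * w y ^ (r - 1) *
            ∑ σ, ∑ τ, M σ τ * fderiv ℝ (fderiv ℝ w) y (spaceDir σ) (spaceDir τ) +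
          r * (r - 1) * w y ^ (r - 1 - 1) *
            ∑ σ, ∑ τ, M σ τ * (fderiv ℝ w y (spaceDir σ) * fderiv ℝ w y (spaceDir τ)) := by
        simp only [hd2, Finset.mul_sum, ← Finset.sum_add_distrib]
        refine Finset.sum_congr rfl fun σ _ => Finset.sum_congr rfl fun τ _ => ?_
        ring
      rw [heatOp, this, heatOp, hd]
      simp only [smul_apply, smul_eq_mul]
      ring
    rw [heq]
    have h1 := (rpow_pos_of_pos (hpos y) (r - 1)).le
    have h2 := (rpow_pos_of_pos (hpos y) (r - 1 - 1)).le
    have h3 := hw.heat y hy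
    have h4 := sin_two_mul_div_two_nonneg hy
    have h5 := sub_nonneg.2 hr1
    have h6 := neg_nonneg.2 hsq
    positivity

/-- The partition function associated with the energies `x`. -/
def expSum (y : ℝ × (S → ℝ)) : ℝ := ∑ σ, exp (y.2 σ)

/-- Evaluation of the space variable at `σ`. -/
def spaceEval (σ : S) : ℝ × (S → ℝ) →L[ℝ] ℝ :=
  (ContinuousLinearMap.proj σ).comp (ContinuousLinearMap.snd ℝ ℝ (S → ℝ))

lemma expSmooth_expSum (k : ℕ) : ExpSmooth k (expSum (S := S)) := by
  have : ∀ t : Finset S, ExpSmooth k (fun y : ℝ × (S → ℝ) => ∑ σ ∈ t, exp (spaceEval σ y)) := by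
    intro t
    induction t using Finset.induction_on with
    | empty => simpa using ExpSmooth.const k (0 : ℝ)
    | insert σ t hσ ih =>
      simp only [Finset.sum_insert hσ]
      exact (ExpSmooth.exp_clm k _).add ih
  exact this Finset.univ

lemma heatSubsolution_expSum [Nonempty S] (hM : ∀ σ, 0 ≤ M σ σ) :
    HeatSubsolution M (expSum (S := S)) := by
  have hd : fderiv ℝ (expSum (S := S)) = fun y => ∑ σ, exp (spaceEval σ y) • spaceEval σ :=
    funext fun y => (HasFDerivAt.fun_sum fun σ _ => (spaceEval σ).hasFDerivAt.exp).fderiv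
  have hd2 : ∀ y a b, fderiv ℝ (fderiv ℝ (expSum (S := S))) y a b =
      ∑ σ, exp (spaceEval σ y) * (spaceEval σ a * spaceEval σ b) := fun y a b => by
    have h1 : HasFDerivAt (fun y => ∑ σ : S, spaceEval σ b * exp (spaceEval σ y))
        (∑ σ : S, spaceEval σ b • exp (spaceEval σ y) • spaceEval σ) y :=
      HasFDerivAt.fun_sum fun σ _ => ((spaceEval σ).hasFDerivAt.exp).const_mul _
    have h2 := fderiv_clm_apply ((expSmooth_expSum (S := S) 2).2.2.1 y)
      (differentiableAt_const b)
    have h3 : fderiv ℝ (fun y => fderiv ℝ (expSum (S := S)) y b) y a =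
        ∑ σ, exp (spaceEval σ y) * (spaceEval σ a * spaceEval σ b) := by
      have : (fun y => fderiv ℝ (expSum (S := S)) y b) =
          fun y => ∑ σ : S, spaceEval σ b * exp (spaceEval σ y) := by
        rw [hd]
        ext y
        simp [mul_comm]
      rw [this, h1.fderiv, sum_apply]
      refine Finset.sum_congr rfl fun σ _ => ?_
      simp only [smul_apply, smul_eq_mul]
      ring
    rw [← h3, h2]
    simp
  have he : ∀ σ τ : S, spaceEval σ (spaceDir τ) = if σ = τ then 1 else 0 := fun σ τ => by
    simp [spaceEval, spaceDir, Pi.single_apply]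
  refine ⟨expSmooth_expSum 2, ?_, fun y σ => ?_, fun y hy => ?_⟩
  · obtain ⟨σ⟩ := ‹Nonempty S›
    refine ⟨1, zero_le_one, fun y => le_trans ?_
      (Finset.single_le_sum (f := fun σ => exp (y.2 σ)) (fun τ _ => (exp_pos _).le)
        (Finset.mem_univ σ))⟩
    rw [exp_le_exp]
    have h1 := (norm_le_pi_norm y.2 σ).trans (le_max_right ‖y.1‖ ‖y.2‖)
    have h2 := neg_abs_le (y.2 σ)
    rw [Real.norm_eq_abs] at h1
    change |y.2 σ| ≤ ‖y‖ at h1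
    linarith
  · rw [hd]
    simp only [sum_apply, smul_apply, he, smul_eq_mul]
    exact Finset.sum_nonneg fun τ _ => mul_nonneg (exp_pos _).le (by split_ifs <;> simp)
  · have h0 : fderiv ℝ (expSum (S := S)) y (1, 0) = 0 := by
      rw [hd]
      simp [spaceEval]
    rw [heatOp, h0, zero_add]
    refine mul_nonneg (sin_two_mul_div_two_nonneg hy)
      (Finset.sum_nonneg fun σ _ => Finset.sum_nonneg fun τ _ => ?_)
    rw [hd2]
    simp only [he]
    by_cases h : σ = τ
    · subst h
      exact mul_nonneg (hM σ) (Finset.sum_nonneg fun ρ _ =>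
        mul_nonneg (exp_pos _).le (mul_self_nonneg _))
    · rw [Finset.sum_eq_zero fun ρ _ => ?_, mul_zero]
      by_cases h1 : ρ = σ
      · subst h1
        simp [h]
      · simp [h1]

lemma HeatSubsolution.le_of_zero (hw : HeatSubsolution (fun _ _ => 0) w) (x : S → ℝ) :
    w (0, x) ≤ w (π / 2, x) := by
  have hd : ∀ θ, HasDerivAt (fun θ => w (θ, x)) (fderiv ℝ w (θ, x) (1, 0)) θ := fun θ =>
    (hw.smooth.1 (θ, x)).hasFDerivAt.comp_hasDerivAt θ
      ((hasDerivAt_id θ).prodMk (hasDerivAt_const θ x))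
  refine monotoneOn_of_deriv_nonneg (convex_Icc 0 (π / 2))
    (fun θ _ => (hd θ).continuousAt.continuousWithinAt)
    (fun θ _ => (hd θ).differentiableAt.differentiableWithinAt) (fun θ hθ => ?_)
    (Set.left_mem_Icc.2 (by positivity)) (Set.right_mem_Icc.2 (by positivity)) (by positivity)
  rw [(hd θ).deriv]
  simpa [heatOp] using hw.heat (θ, x) (interior_subset hθ)

end HeatSubsolution

section GaussianVector

variable {S : Type} [Fintype S] [DecidableEq S] {s s' : ℝ → ℝ} {ε : ℝ}

lemma HeatSubsolution.exists_gaussAvg_fin (hs : IsScale s s' ε) {d : ℕ} (v : Fin d → S → ℝ)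
    {M : S → S → ℝ} {w : ℝ × (S → ℝ) → ℝ}
    (hw : HeatSubsolution (fun σ τ => M σ τ + ε * ∑ i, v i σ * v i τ) w) :
    ∃ W, HeatSubsolution M W ∧ ∀ y : ℝ × (S → ℝ),
      Integrable (fun z => w (y.1, y.2 + ∑ i, (s y.1 * z i) • v i))
        (Measure.pi fun _ : Fin d => gaussianReal 0 1) ∧
      W y = ∫ z, w (y.1, y.2 + ∑ i, (s y.1 * z i) • v i)
        ∂Measure.pi fun _ : Fin d => gaussianReal 0 1 := by
  induction d generalizing w with
  | zero => exact ⟨w, by simpa using hw, fun y => by simp⟩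
  | succ d ih =>
    have hw' : HeatSubsolution (fun σ τ => (M σ τ + ε * ∑ i : Fin d, v i.succ σ * v i.succ τ) +
        ε * (v 0 σ * v 0 τ)) w := by
      refine (congrArg (HeatSubsolution · w) (funext fun σ => funext fun τ => ?_)).mp hw
      rw [Fin.sum_univ_succ]
      ring
    obtain ⟨W, hW, h⟩ := ih (fun i => v i.succ) (hw'.gaussAvg hs (v 0))
    refine ⟨W, hW, fun y => ?_⟩
    obtain ⟨hi, he⟩ := h y
    set μ : Measure (Fin d → ℝ) := Measure.pi fun _ => gaussianReal 0 1
    let g : ℝ × (Fin d → ℝ) → ℝ := fun p =>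
      w (spaceShift s (v 0) ((y.1, y.2 + ∑ i : Fin d, (s y.1 * p.2 i) • v i.succ), p.1))
    have hgc : Continuous g := by
      have := hw.smooth.continuous
      simp only [g, spaceShift]
      fun_prop
    have hslice : ∀ z : Fin d → ℝ, Integrable (fun t => g (t, z)) (gaussianReal 0 1) := fun z =>
      hs.integrable (v 0) le_rfl hw.smooth (y.1, y.2 + ∑ i : Fin d, (s y.1 * z i) • v i.succ)
    have hg : Integrable g ((gaussianReal 0 1).prod μ) := by
      refine (integrable_prod_iff' hgc.aestronglyMeasurable).2 ⟨.of_forall hslice, ?_⟩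
      refine hi.congr (.of_forall fun z => ?_)
      refine integral_congr_ae (.of_forall fun t => ?_)
      exact (abs_of_pos (hw.lower.pos _)).symm
    have hmp := measurePreserving_piFinSuccAbove (fun _ : Fin (d + 1) => gaussianReal 0 1) 0
    have hcomp : (fun z : Fin (d + 1) → ℝ => w (y.1, y.2 + ∑ i, (s y.1 * z i) • v i)) =
        fun z => g (MeasurableEquiv.piFinSuccAbove (fun _ => ℝ) 0 z) := by
      funext z
      simp only [g, spaceShift, Fin.sum_univ_succ, MeasurableEquiv.piFinSuccAbove_apply,
        Fin.insertNthEquiv_symm_apply, Fin.removeNth, Fin.zero_succAbove]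
      congr 1
      ext <;> simp
      ring
    rw [hcomp]
    refine ⟨(hmp.integrable_comp_emb (MeasurableEquiv.measurableEmbedding _)).2 hg, ?_⟩
    rw [hmp.integral_comp' (g := g), integral_prod_symm _ hg, he]
    rfl

lemma HeatSubsolution.exists_gaussAvg (hs : IsScale s s' ε) {ι : Type} [Fintype ι]
    (v : ι → S → ℝ) {M : S → S → ℝ} {w : ℝ × (S → ℝ) → ℝ}
    (hw : HeatSubsolution (fun σ τ => M σ τ + ε * ∑ i, v i σ * v i τ) w) :
    ∃ W, HeatSubsolution M W ∧ ∀ y : ℝ × (S → ℝ),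
      W y = ∫ z, w (y.1, y.2 + ∑ i, (s y.1 * z i) • v i)
        ∂Measure.pi fun _ : ι => gaussianReal 0 1 := by
  let e := Fintype.equivFin ι
  obtain ⟨W, hW, h⟩ := HeatSubsolution.exists_gaussAvg_fin hs (fun i => v (e.symm i)) (M := M)
    (w := w) (by
      refine (congrArg (HeatSubsolution · w) (funext fun σ => funext fun τ => ?_)).mp hw
      rw [e.symm.sum_comp fun i => v i σ * v i τ])
  refine ⟨W, hW, fun y => (h y).2.trans ?_⟩
  have hmp := measurePreserving_piCongrLeft (fun _ : Fin (Fintype.card ι) => gaussianReal 0 1) e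
  rw [← hmp.integral_comp']
  refine integral_congr_ae (.of_forall fun z => ?_)
  simp only
  rw [← e.sum_comp]
  congr 3
  refine Finset.sum_congr rfl fun i _ => ?_
  simp [MeasurableEquiv.piCongrLeft, Equiv.piCongrLeft_apply_apply]

/-- Averaging over a Gaussian vector that is switched off at `θ = π / 2`. -/
lemma HeatSubsolution.exists_gaussAvg_cos {ι : Type} [Fintype ι]
    (v : ι → S → ℝ) {M : S → S → ℝ} {w : ℝ × (S → ℝ) → ℝ}
    (hw : HeatSubsolution (fun σ τ => M σ τ - ∑ i, v i σ * v i τ) w) :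
    ∃ W, HeatSubsolution M W ∧
      (∀ x, W (0, x) = ∫ z, w (0, x + ∑ i, z i • v i)
        ∂Measure.pi fun _ : ι => gaussianReal 0 1) ∧
      ∀ x, W (π / 2, x) = w (π / 2, x) := by
  obtain ⟨W, hW, h⟩ := HeatSubsolution.exists_gaussAvg isScale_cos v (M := M) (w := w)
    (by simpa only [neg_one_mul, ← sub_eq_add_neg] using hw)
  exact ⟨W, hW, fun x => by simp [h], fun x => by simp [h]⟩

/-- Averaging over a Gaussian vector that is switched off at `θ = 0`. -/
lemma HeatSubsolution.exists_gaussAvg_sin {ι : Type} [Fintype ι]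
    (v : ι → S → ℝ) {M : S → S → ℝ} {w : ℝ × (S → ℝ) → ℝ}
    (hw : HeatSubsolution (fun σ τ => M σ τ + ∑ i, v i σ * v i τ) w) :
    ∃ W, HeatSubsolution M W ∧ (∀ x, W (0, x) = w (0, x)) ∧
      ∀ x, W (π / 2, x) = ∫ z, w (π / 2, x + ∑ i, z i • v i)
        ∂Measure.pi fun _ : ι => gaussianReal 0 1 := by
  obtain ⟨W, hW, h⟩ := HeatSubsolution.exists_gaussAvg isScale_sin v (M := M) (w := w)
    (by simpa only [one_mul] using hw)
  exact ⟨W, hW, fun x => by simp [h], fun x => by simp [h]⟩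

end GaussianVector

section Directions

lemma spinVal_mul_self (b : Bool) : spinVal b * spinVal b = 1 := by
  cases b <;> norm_num [spinVal]

lemma sum_ite_lt_mul {N : ℕ} (a : Fin N → ℝ) :
    ∑ p : Fin N × Fin N, (if p.1 < p.2 then a p.1 * a p.2 else 0) =
      ((∑ i, a i) ^ 2 - ∑ i, a i ^ 2) / 2 := by
  have hswap : ∑ p : Fin N × Fin N, (if p.2 < p.1 then a p.1 * a p.2 else 0) =
      ∑ p : Fin N × Fin N, (if p.1 < p.2 then a p.1 * a p.2 else 0) := by
    rw [← (Equiv.prodComm (Fin N) (Fin N)).sum_comp]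
    simp [mul_comm]
  have hdiag : ∑ p : Fin N × Fin N, (if p.1 = p.2 then a p.1 * a p.2 else 0) = ∑ i, a i ^ 2 := by
    simp [Fintype.sum_prod_type, sq]
  have hall : (∑ i, a i) ^ 2 = ∑ p : Fin N × Fin N, a p.1 * a p.2 := by
    rw [sq, Finset.sum_mul_sum, Fintype.sum_prod_type]
  have hsplit : ∑ p : Fin N × Fin N, a p.1 * a p.2 =
      ∑ p : Fin N × Fin N, (if p.1 < p.2 then a p.1 * a p.2 else 0) +
      ∑ p : Fin N × Fin N, (if p.2 < p.1 then a p.1 * a p.2 else 0) +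
      ∑ p : Fin N × Fin N, (if p.1 = p.2 then a p.1 * a p.2 else 0) := by
    rw [← Finset.sum_add_distrib, ← Finset.sum_add_distrib]
    refine Finset.sum_congr rfl fun p _ => ?_
    rcases lt_trichotomy p.1 p.2 with h | h | h
    · simp [h, h.ne, h.not_gt]
    · simp [h]
    · simp [h, h.ne', h.not_gt]
  rw [hall, hsplit, hswap, hdiag]
  ring

/-- The unnormalised overlap of two configurations. -/
def overlap {N : ℕ} (σ τ : Fin N → Bool) : ℝ := ∑ i, spinVal (σ i) * spinVal (τ i)

lemma overlap_self {N : ℕ} (σ : Fin N → Bool) : overlap σ σ = N := by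
  simp [overlap, spinVal_mul_self]

/-- Energies produced by the coupling `J p` in the Sherrington–Kirkpatrick Hamiltonian. -/
def skDir (N : ℕ) (β : ℝ) (p : Fin N × Fin N) (σ : Fin N → Bool) : ℝ :=
  if p.1 < p.2 then β / √(N : ℝ) * (spinVal (σ p.1) * spinVal (σ p.2)) else 0

lemma sum_skDir_mul (N : ℕ) (β : ℝ) (σ τ : Fin N → Bool) :
    ∑ p, skDir N β p σ * skDir N β p τ = β ^ 2 / (2 * N) * (overlap σ τ ^ 2 - N) := by
  have h := sum_ite_lt_mul fun i => spinVal (σ i) * spinVal (τ i)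
  have h1 : ∑ i, (spinVal (σ i) * spinVal (τ i)) ^ 2 = N := by
    simp [mul_pow, sq (spinVal _), spinVal_mul_self]
  have h2 : ∀ p, skDir N β p σ * skDir N β p τ = β ^ 2 / N *
      (if p.1 < p.2 then spinVal (σ p.1) * spinVal (τ p.1) * (spinVal (σ p.2) * spinVal (τ p.2))
        else 0) := fun p => by
    unfold skDir
    split_ifs
    · rw [← Real.sq_sqrt (Nat.cast_nonneg (α := ℝ) N)]
      simp only [Real.sqrt_sq (Real.sqrt_nonneg _)]
      ring
    · simp
  rw [Finset.sum_congr rfl fun p _ => h2 p, ← Finset.mul_sum, h, h1, overlap]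
  ring

/-- Energies of the spins in the local fields `y`. -/
def fieldEnergy {N : ℕ} (β : ℝ) (y : Fin N → ℝ) (σ : Fin N → Bool) : ℝ :=
  β * ∑ i, spinVal (σ i) * y i

lemma neg_mul_skH (N : ℕ) (β h : ℝ) (J : Fin N × Fin N → ℝ) (σ : Fin N → Bool) :
    -β * skH N h J σ = fieldEnergy β (fun _ => h) σ + ∑ p, J p * skDir N β p σ := by
  simp only [skH, fieldEnergy, skDir, Finset.sum_filter, mul_ite, mul_zero, ← Finset.sum_mul]
  have : ∑ p : Fin N × Fin N, (if p.1 < p.2 then J p * (β / √(N : ℝ) *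
      (spinVal (σ p.1) * spinVal (σ p.2))) else 0) = β / √(N : ℝ) *
      ∑ p : Fin N × Fin N, (if p.1 < p.2 then J p * spinVal (σ p.1) * spinVal (σ p.2) else 0) := by
    rw [Finset.mul_sum]
    refine Finset.sum_congr rfl fun p _ => ?_
    split_ifs <;> ring
  rw [this]
  ring

lemma expSum_skDir (N : ℕ) (β h θ : ℝ) (J : Fin N × Fin N → ℝ) :
    expSum (θ, fieldEnergy β (fun _ => h) + ∑ p, J p • skDir N β p) = skZ N β h J := by
  simp only [expSum, skZ, neg_mul_skH]
  simp [Finset.sum_apply]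

lemma expSum_fieldEnergy {N : ℕ} (β θ : ℝ) (y : Fin N → ℝ) :
    expSum (θ, fieldEnergy β y) = exp (∑ i, (Real.log 2 + Real.log (Real.cosh (β * y i)))) := by
  have h : ∀ i, exp (Real.log 2 + Real.log (Real.cosh (β * y i))) =
      ∑ b : Bool, exp (β * (spinVal b * y i)) := fun i => by
    rw [exp_add, exp_log two_pos, exp_log (cosh_pos _), Real.cosh_eq, Fintype.sum_bool]
    simp only [spinVal, if_true, Bool.false_eq_true, if_false]
    ring_nf
  rw [exp_sum, Finset.prod_congr rfl fun i _ => h i, Fintype.prod_sum]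
  simp [expSum, fieldEnergy, Finset.mul_sum, exp_sum]

end Directions

section ConstantAverage

variable {S : Type} [Fintype S] [DecidableEq S]

/-- Averaging over a common Gaussian shift of all energies. -/
lemma HeatSubsolution.exists_constAvg {M : S → S → ℝ} {w : ℝ × (S → ℝ) → ℝ} {c : ℝ} (hc : 0 ≤ c)
    (hw : HeatSubsolution (fun σ τ => M σ τ - c) w) {A r : ℝ}
    (h0 : ∀ x, w (0, x) = exp A * expSum ((0 : ℝ), x) ^ r) :
    ∃ W, HeatSubsolution M W ∧
      (∀ x, W (0, x) = exp (A + r ^ 2 * c / 2) * expSum ((0 : ℝ), x) ^ r) ∧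
      ∀ x, W (π / 2, x) = w (π / 2, x) := by
  refine ⟨_, HeatSubsolution.gaussAvg isScale_cos (fun _ => √c) (M := M) (w := w) ?_,
    fun x => ?_, fun x => by simp [_root_.gaussAvg, spaceShift]⟩
  · simpa only [Real.mul_self_sqrt hc, neg_one_mul, ← sub_eq_add_neg] using hw
  · have h : ∀ z, w (spaceShift Real.cos (fun _ => √c) (((0 : ℝ), x), z)) =
        exp A * expSum ((0 : ℝ), x) ^ r * exp (r * √c * z) := fun z => by
      have h1 : spaceShift Real.cos (fun _ : S => √c) (((0 : ℝ), x), z) =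
          (0, fun σ => x σ + z * √c) := by
        ext <;> simp [spaceShift]
      have h2 : expSum ((0 : ℝ), fun σ => x σ + z * √c) =
          expSum ((0 : ℝ), x) * exp (z * √c) := by
        simp [expSum, exp_add, Finset.sum_mul]
      have h3 : 0 ≤ expSum ((0 : ℝ), x) := Finset.sum_nonneg fun σ _ => (exp_pos _).le
      rw [h1, h0, h2, Real.mul_rpow h3 (exp_pos _).le, ← Real.exp_mul, mul_assoc]
      ring_nf
    have hmgf : ∫ z, exp (r * √c * z) ∂gaussianReal 0 1 = exp (r ^ 2 * c / 2) := by
      have := mgf_gaussianReal (p := gaussianReal 0 1) (X := id) (μ := 0) (v := 1)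
        Measure.map_id (r * √c)
      simpa [mgf, mul_pow, Real.sq_sqrt hc] using this
    simp only [_root_.gaussAvg, h]
    rw [integral_const_mul, hmgf, exp_add]
    ring

end ConstantAverage

section GuerraBound

/-- The interaction kernel of the interpolation when the replica overlap is compared with `q`. -/
def overlapKernel (N : ℕ) (β q : ℝ) (σ τ : Fin N → Bool) : ℝ :=
  -(β ^ 2 / (2 * N)) * (overlap σ τ - N * q) ^ 2

lemma overlapKernel_nonpos (N : ℕ) (β q : ℝ) (σ τ : Fin N → Bool) :
    overlapKernel N β q σ τ ≤ 0 := by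
  have : 0 ≤ β ^ 2 / (2 * (N : ℝ)) * (overlap σ τ - N * q) ^ 2 := by positivity
  rw [overlapKernel]
  linarith

/-- One level of the Gaussian recursion, for a subsolution with explicit values at the endpoints:
the overlap level decreases from `q₁` to `q₀`. -/
lemma exists_subsolution_level {N : ℕ} (hN : 0 < N) {β q₀ q₁ A m : ℝ} (hm : 0 < m)
    (hq0 : 0 ≤ q₀) (hq : q₀ ≤ q₁) {f₀ f₁ : ℝ → ℝ}
    (hf : ∀ y, f₀ y = (1 / m) * Real.log (∫ z, exp (m * f₁ (y + √(q₁ - q₀) * z))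
      ∂gaussianReal 0 1))
    {w : ℝ × ((Fin N → Bool) → ℝ) → ℝ} (hw : HeatSubsolution (overlapKernel N β q₁) w)
    (h0 : ∀ x, w (0, x) = exp A * expSum ((0 : ℝ), x) ^ m)
    (h1 : ∀ y : Fin N → ℝ, w (π / 2, fieldEnergy β y) =
      exp (m * ∑ i, (Real.log 2 + f₁ (y i)))) :
    ∃ W, HeatSubsolution (overlapKernel N β q₀) W ∧
      (∀ x, W (0, x) = exp (A + m ^ 2 * (β ^ 2 * N / 4 * (q₁ ^ 2 - q₀ ^ 2))) *
        expSum ((0 : ℝ), x) ^ m) ∧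
      ∀ y : Fin N → ℝ, W (π / 2, fieldEnergy β y) =
        exp (m * ∑ i, (Real.log 2 + f₀ (y i))) := by
  have hN' : (N : ℝ) ≠ 0 := by positivity
  let v : Fin N → (Fin N → Bool) → ℝ := fun i σ => β * √(q₁ - q₀) * spinVal (σ i)
  set c := β ^ 2 * N / 2 * (q₁ ^ 2 - q₀ ^ 2) with hc
  have hc0 : 0 ≤ c := mul_nonneg (by positivity) (by nlinarith)
  have hv : ∀ σ τ, ∑ i, v i σ * v i τ = β ^ 2 * (q₁ - q₀) * overlap σ τ := fun σ τ => by
    rw [overlap, Finset.mul_sum]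
    refine Finset.sum_congr rfl fun i _ => ?_
    rw [← Real.mul_self_sqrt (sub_nonneg.2 hq)]
    simp only [v]
    ring
  have hker : HeatSubsolution
      (fun σ τ => (overlapKernel N β q₀ σ τ + ∑ i, v i σ * v i τ) - c) w := by
    refine (congrArg (HeatSubsolution · w) (funext fun σ => funext fun τ => ?_)).mp hw
    rw [hv, hc, overlapKernel, overlapKernel]
    field_simp
    ring
  obtain ⟨W₁, hW₁, hW₁0, hW₁1⟩ := hker.exists_constAvg hc0 h0
  obtain ⟨W, hW, hW0, hW1⟩ := hW₁.exists_gaussAvg_sin v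
  refine ⟨W, hW, fun x => ?_, fun y => ?_⟩
  · rw [hW0, hW₁0, hc]
    ring_nf
  · set I : ℝ → ℝ := fun t => ∫ z, exp (m * f₁ (t + √(q₁ - q₀) * z)) ∂gaussianReal 0 1 with hI
    have hprod : ∀ y : Fin N → ℝ, W (π / 2, fieldEnergy β y) =
        ∏ i, (exp (m * Real.log 2) * I (y i)) := fun y => by
      have hshift : ∀ z : Fin N → ℝ, fieldEnergy β y + ∑ i, z i • v i =
          fieldEnergy β (fun i => y i + √(q₁ - q₀) * z i) := fun z => by
        ext σ
        simp only [fieldEnergy, Pi.add_apply, Finset.sum_apply, Pi.smul_apply, smul_eq_mul, v,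
          mul_add, Finset.sum_add_distrib, Finset.mul_sum]
        congr 1
        exact Finset.sum_congr rfl fun i _ => by ring
      rw [hW1]
      simp only [hshift, hW₁1, h1, Finset.mul_sum, exp_sum, mul_add, exp_add]
      rw [integral_fintype_prod_eq_prod (𝕜 := ℝ)
        (f := fun i t => exp (m * Real.log 2) * exp (m * f₁ (y i + √(q₁ - q₀) * t)))]
      simp only [integral_const_mul, hI]
    have hIpos : ∀ t, 0 < I t := fun t => by
      have h := hW.lower.pos (π / 2, fieldEnergy β fun _ : Fin N => t)
      rw [hprod] at h
      have h2 : exp (m * Real.log 2) * I t ≠ 0 := fun h3 => by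
        simp [h3, hN.ne'] at h
      exact (integral_nonneg fun z => (exp_pos _).le).lt_of_ne' (right_ne_zero_of_mul h2)
    rw [hprod, Finset.mul_sum, exp_sum]
    refine Finset.prod_congr rfl fun i _ => ?_
    rw [hf, mul_add, exp_add, ← mul_assoc, mul_one_div_cancel hm.ne', one_mul, exp_log (hIpos _)]

lemma HeatSubsolution.rpow_div {N : ℕ} {β q A m r : ℝ} (hr : 0 < r) (hrm : r ≤ m)
    {g : (Fin N → ℝ) → ℝ} {w : ℝ × ((Fin N → Bool) → ℝ) → ℝ}
    (hw : HeatSubsolution (overlapKernel N β q) w)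
    (h0 : ∀ x, w (0, x) = exp (m * A) * expSum ((0 : ℝ), x) ^ m)
    (h1 : ∀ y : Fin N → ℝ, w (π / 2, fieldEnergy β y) = exp (m * g y)) :
    ∃ W, HeatSubsolution (overlapKernel N β q) W ∧
      (∀ x, W (0, x) = exp (r * A) * expSum ((0 : ℝ), x) ^ r) ∧
      ∀ y : Fin N → ℝ, W (π / 2, fieldEnergy β y) = exp (r * g y) := by
  have hm : 0 < m := hr.trans_le hrm
  refine ⟨_, hw.rpow (overlapKernel_nonpos N β q) (div_pos hr hm) ((div_le_one hm).2 hrm),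
    fun x => ?_, fun y => ?_⟩
  · have h : 0 ≤ expSum ((0 : ℝ), x) := Finset.sum_nonneg fun σ _ => (exp_pos _).le
    simp only [h0]
    rw [Real.mul_rpow (exp_pos _).le (Real.rpow_nonneg h _), ← Real.exp_mul, ← Real.rpow_mul h]
    congr 2 <;> field_simp
  · simp only [h1]
    rw [← Real.exp_mul]
    congr 1
    field_simp

variable {n β h : ℝ} {K : ℕ} {q m : ℕ → ℝ} {f : ℕ → ℝ → ℝ}

lemma exists_subsolution_parisi (hn : n ∈ Set.Ioc (0 : ℝ) 1)
    (hq0 : q 0 = 0) (hqK : q K = 1) (hqmono : ∀ a < K, q a ≤ q (a + 1))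
    (hm1 : n ≤ m 1) (hmmono : ∀ a, 1 ≤ a → a < K → m a ≤ m (a + 1)) (hmK : m K ≤ 1)
    (hfK : ∀ y, f K y = Real.log (Real.cosh (β * y)))
    (hfrec : ∀ a, 1 ≤ a → a ≤ K → ∀ y,
      f (a - 1) y = (1 / m a) *
        Real.log (∫ z, Real.exp (m a * f a (y + Real.sqrt (q a - q (a - 1)) * z))
          ∂ gaussianReal 0 1))
    {N : ℕ} (hN : 0 < N) {a : ℕ} (ha : a ≤ K) :
    ∀ r : ℝ, 0 < r → r ≤ 1 → (a < K → r ≤ m (a + 1)) →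
      ∃ w, HeatSubsolution (overlapKernel N β (q a)) w ∧
        (∀ x, w (0, x) = exp (r * (β ^ 2 * N / 4 *
          ∑ b ∈ Finset.Ico a K, m (b + 1) * (q (b + 1) ^ 2 - q b ^ 2))) *
            expSum ((0 : ℝ), x) ^ r) ∧
        ∀ y : Fin N → ℝ, w (π / 2, fieldEnergy β y) =
          exp (r * ∑ i, (Real.log 2 + f a (y i))) := by
  have hqpos : ∀ a ≤ K, 0 ≤ q a := fun a => by
    induction a with
    | zero => simp [hq0]
    | succ a ih => exact fun h => (ih (by omega)).trans (hqmono a (by omega))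
  have hmn : ∀ a < K, n ≤ m (a + 1) := fun a => by
    induction a with
    | zero => simpa using fun _ => hm1
    | succ a ih => exact fun h => (ih (by omega)).trans (hmmono (a + 1) (by omega) (by omega))
  have hN' : (N : ℝ) ≠ 0 := by positivity
  induction ha using Nat.decreasingInduction with
  | self =>
    intro r hr hr1 _
    refine HeatSubsolution.rpow_div (m := 1) hr hr1 (w := expSum)
      (heatSubsolution_expSum fun σ => ?_) (fun x => by simp)
      (fun y => by rw [expSum_fieldEnergy]; simp [hfK])
    simp [overlapKernel, overlap_self, hqK]
  | of_succ a ha ih =>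
    intro r hr _ hrm
    have hmpos : 0 < m (a + 1) := hn.1.trans_le (hmn a ha)
    have hm1 : ∀ b, a + 1 + b ≤ K → m (a + 1) ≤ m (a + 1 + b) := fun b => by
      induction b with
      | zero => simp
      | succ b ih => exact fun h => (ih (by omega)).trans (hmmono (a + 1 + b) (by omega) (by omega))
    have hmle1 : m (a + 1) ≤ 1 := by
      have := hm1 (K - (a + 1)) (by omega)
      rw [show a + 1 + (K - (a + 1)) = K by omega] at this
      exact this.trans hmK
    obtain ⟨w, hw, h0, h1⟩ := ih (m (a + 1)) hmpos hmle1 fun h => hmmono (a + 1) (by omega) h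
    obtain ⟨W, hW, hW0, hW1⟩ := exists_subsolution_level hN hmpos (hqpos a ha.le) (hqmono a ha)
      (hfrec (a + 1) (by omega) ha) hw h0 h1
    refine hW.rpow_div hr (hrm ha) (fun x => ?_) hW1
    rw [hW0, Finset.sum_eq_sum_Ico_succ_bot ha]
    ring_nf

/-- Guerra's replica symmetry breaking bound at finite volume. -/
lemma log_integral_skZ_rpow_le (hn : n ∈ Set.Ioc (0 : ℝ) 1)
    (hq0 : q 0 = 0) (hqK : q K = 1) (hqmono : ∀ a < K, q a ≤ q (a + 1))
    (hm1 : n ≤ m 1) (hmmono : ∀ a, 1 ≤ a → a < K → m a ≤ m (a + 1)) (hmK : m K ≤ 1)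
    (hfK : ∀ y, f K y = Real.log (Real.cosh (β * y)))
    (hfrec : ∀ a, 1 ≤ a → a ≤ K → ∀ y,
      f (a - 1) y = (1 / m a) *
        Real.log (∫ z, Real.exp (m a * f a (y + Real.sqrt (q a - q (a - 1)) * z))
          ∂ gaussianReal 0 1))
    {N : ℕ} (hN : 0 < N) :
    Real.log (∫ J, skZ N β h J ^ n ∂skMuJ N) ≤ N * n * (Real.log 2 + f 0 h -
      β ^ 2 / 4 * ∑ a ∈ Finset.range K, m (a + 1) * (q (a + 1) ^ 2 - q a ^ 2)) := by
  obtain ⟨w, hw, h0, h1⟩ := exists_subsolution_parisi hn hq0 hqK hqmono hm1 hmmono hmK hfK hfrec hN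
    (Nat.zero_le K) n hn.1 hn.2 fun _ => hm1
  set D := ∑ b ∈ Finset.Ico 0 K, m (b + 1) * (q (b + 1) ^ 2 - q b ^ 2) with hD
  have hker : HeatSubsolution
      (fun σ τ => (0 - ∑ p, skDir N β p σ * skDir N β p τ) - β ^ 2 / 2) w := by
    refine (congrArg (HeatSubsolution · w) (funext fun σ => funext fun τ => ?_)).mp hw
    rw [overlapKernel, sum_skDir_mul, hq0]
    field_simp
    ring
  obtain ⟨W₁, hW₁, hW₁0, hW₁1⟩ := hker.exists_constAvg (by positivity) h0
  obtain ⟨W, hW, hW0, hW1⟩ := hW₁.exists_gaussAvg_cos (skDir N β) (M := fun _ _ => 0)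
  have hle := hW.le_of_zero (fieldEnergy β fun _ => h)
  have hpos := hW.lower.pos ((0 : ℝ), fieldEnergy β fun _ => h)
  rw [hW1, hW₁1, h1, hW0] at hle
  rw [hW0] at hpos
  simp only [hW₁0, expSum_skDir] at hle hpos
  rw [integral_const_mul] at hle hpos
  have hJ := (pos_iff_pos_of_mul_pos hpos).1 (exp_pos _)
  have hlog := Real.log_le_log hpos hle
  rw [Real.log_mul (exp_pos _).ne' hJ.ne', Real.log_exp, Real.log_exp] at hlog
  have hnn : 0 ≤ n ^ 2 * (β ^ 2 / 2) / 2 := by positivity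
  rw [Finset.range_eq_Ico, ← hD]
  simp only [Finset.sum_const, Finset.card_univ, Fintype.card_fin, nsmul_eq_mul] at hlog
  unfold skMuJ
  linarith

end GuerraBound

section Superadditivity

variable {N₁ N₂ : ℕ}

lemma sum_append_mul (F : (Fin N₁ → Bool) → ℝ) (G : (Fin N₂ → Bool) → ℝ) :
    ∑ σ : Fin (N₁ + N₂) → Bool, F (fun i => σ (Fin.castAdd N₂ i)) *
      G (fun i => σ (Fin.natAdd N₁ i)) = (∑ σ, F σ) * ∑ σ, G σ := by
  rw [← (Fin.appendEquiv N₁ N₂).sum_comp, Finset.sum_mul_sum, Fintype.sum_prod_type]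
  simp [Fin.appendEquiv]

lemma overlap_add (σ τ : Fin (N₁ + N₂) → Bool) : overlap σ τ =
    overlap (fun i => σ (Fin.castAdd N₂ i)) (fun i => τ (Fin.castAdd N₂ i)) +
    overlap (fun i => σ (Fin.natAdd N₁ i)) (fun i => τ (Fin.natAdd N₁ i)) :=
  Fin.sum_univ_add _

lemma fieldEnergy_add (β h : ℝ) (σ : Fin (N₁ + N₂) → Bool) :
    fieldEnergy β (fun _ => h) σ =
      fieldEnergy β (fun _ => h) (fun i => σ (Fin.castAdd N₂ i)) +
      fieldEnergy β (fun _ => h) (fun i => σ (Fin.natAdd N₁ i)) := by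
  simp only [fieldEnergy, Fin.sum_univ_add, mul_add]

lemma expSum_skDir_add (β h θ : ℝ) (J₁ : Fin N₁ × Fin N₁ → ℝ) (J₂ : Fin N₂ × Fin N₂ → ℝ) :
    expSum (θ, fieldEnergy β (fun _ : Fin (N₁ + N₂) => h) +
      (∑ p, J₂ p • fun σ => skDir N₂ β p (fun i => σ (Fin.natAdd N₁ i))) +
      ∑ p, J₁ p • fun σ => skDir N₁ β p (fun i => σ (Fin.castAdd N₂ i))) =
      skZ N₁ β h J₁ * skZ N₂ β h J₂ := by
  rw [skZ, skZ, ← sum_append_mul]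
  refine Finset.sum_congr rfl fun σ _ => ?_
  rw [← exp_add, neg_mul_skH, neg_mul_skH]
  simp only [Pi.add_apply, Finset.sum_apply, Pi.smul_apply, smul_eq_mul, fieldEnergy_add]
  ring_nf

lemma integral_skZ_rpow_mul_le {n : ℝ} (hn : n ∈ Set.Ioc (0 : ℝ) 1) (β h : ℝ)
    (hN₁ : 0 < N₁) (hN₂ : 0 < N₂) :
    0 < (∫ J, skZ N₁ β h J ^ n ∂skMuJ N₁) * ∫ J, skZ N₂ β h J ^ n ∂skMuJ N₂ ∧
    (∫ J, skZ N₁ β h J ^ n ∂skMuJ N₁) * ∫ J, skZ N₂ β h J ^ n ∂skMuJ N₂ ≤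
      ∫ J, skZ (N₁ + N₂) β h J ^ n ∂skMuJ (N₁ + N₂) := by
  let v₁ : Fin N₁ × Fin N₁ → (Fin (N₁ + N₂) → Bool) → ℝ :=
    fun p σ => skDir N₁ β p (fun i => σ (Fin.castAdd N₂ i))
  let v₂ : Fin N₂ × Fin N₂ → (Fin (N₁ + N₂) → Bool) → ℝ :=
    fun p σ => skDir N₂ β p (fun i => σ (Fin.natAdd N₁ i))
  let M : (Fin (N₁ + N₂) → Bool) → (Fin (N₁ + N₂) → Bool) → ℝ := fun σ τ =>
    (0 + ∑ p, skDir (N₁ + N₂) β p σ * skDir (N₁ + N₂) β p τ) - ∑ p, v₂ p σ * v₂ p τ -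
      ∑ p, v₁ p σ * v₁ p τ - β ^ 2 / 2
  have h1 : (0 : ℝ) < N₁ := by positivity
  have h2 : (0 : ℝ) < N₂ := by positivity
  have hM : ∀ σ τ, M σ τ = -(β ^ 2 / (2 * N₁ * N₂ * (N₁ + N₂))) *
      (N₂ * overlap (fun i => σ (Fin.castAdd N₂ i)) (fun i => τ (Fin.castAdd N₂ i)) -
        N₁ * overlap (fun i => σ (Fin.natAdd N₁ i)) (fun i => τ (Fin.natAdd N₁ i))) ^ 2 :=
    fun σ τ => by
      simp only [M, v₁, v₂, sum_skDir_mul, overlap_add, Nat.cast_add]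
      field_simp
      ring
  have hbase : HeatSubsolution M expSum := heatSubsolution_expSum fun σ => by
    rw [hM, overlap_self, overlap_self]
    simp [mul_comm]
  have hpow : HeatSubsolution M (fun y => expSum y ^ n) :=
    hbase.rpow (fun σ τ => by
      rw [hM, neg_mul]
      exact neg_nonpos.2 (by positivity)) hn.1 hn.2
  obtain ⟨W₁, hW₁, hW₁0, hW₁1⟩ :=
    hpow.exists_constAvg (A := 0) (r := n) (by positivity) fun x => by simp
  obtain ⟨W₂, hW₂, hW₂0, hW₂1⟩ := hW₁.exists_gaussAvg_cos v₁
  obtain ⟨W₃, hW₃, hW₃0, hW₃1⟩ := hW₂.exists_gaussAvg_cos v₂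
  obtain ⟨W, hW, hW0, hW1⟩ := hW₃.exists_gaussAvg_sin (skDir (N₁ + N₂) β) (M := fun _ _ => 0)
  have hle := hW.le_of_zero (fieldEnergy β fun _ => h)
  have hpos := hW.lower.pos ((0 : ℝ), fieldEnergy β fun _ => h)
  have hval : W (0, fieldEnergy β fun _ => h) = exp (0 + n ^ 2 * (β ^ 2 / 2) / 2) *
      ((∫ J, skZ N₁ β h J ^ n ∂skMuJ N₁) * ∫ J, skZ N₂ β h J ^ n ∂skMuJ N₂) := by
    have hZ : ∀ N J, 0 ≤ skZ N β h J := fun N J => Finset.sum_nonneg fun σ _ => (exp_pos _).le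
    rw [hW0, hW₃0]
    simp only [hW₂0, hW₁0, v₁, v₂, expSum_skDir_add, Real.mul_rpow (hZ _ _) (hZ _ _)]
    simp only [integral_const_mul, integral_mul_const, skMuJ]
  have hval1 : W (π / 2, fieldEnergy β fun _ => h) =
      ∫ J, skZ (N₁ + N₂) β h J ^ n ∂skMuJ (N₁ + N₂) := by
    rw [hW1]
    simp only [hW₃1, hW₂1, hW₁1, expSum_skDir, skMuJ]
  rw [hval, hval1] at hle
  rw [hval] at hpos
  have hP := (pos_iff_pos_of_mul_pos hpos).1 (exp_pos _)
  have hone : 1 ≤ exp (0 + n ^ 2 * (β ^ 2 / 2) / 2) := Real.one_le_exp (by positivity)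
  exact ⟨hP, (le_mul_of_one_le_left hP.le hone).trans hle⟩

lemma integral_skZ_rpow_zero (n β h : ℝ) : ∫ J, skZ 0 β h J ^ n ∂skMuJ 0 = 1 := by
  simp [skZ, skH, skMuJ]

lemma log_integral_skZ_rpow_add_le {n : ℝ} (hn : n ∈ Set.Ioc (0 : ℝ) 1) (β h : ℝ) (N₁ N₂ : ℕ) :
    Real.log (∫ J, skZ N₁ β h J ^ n ∂skMuJ N₁) + Real.log (∫ J, skZ N₂ β h J ^ n ∂skMuJ N₂) ≤
      Real.log (∫ J, skZ (N₁ + N₂) β h J ^ n ∂skMuJ (N₁ + N₂)) := by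
  rcases N₁.eq_zero_or_pos with rfl | hN₁
  · rw [integral_skZ_rpow_zero, Real.log_one, zero_add, zero_add]
  rcases N₂.eq_zero_or_pos with rfl | hN₂
  · rw [integral_skZ_rpow_zero, Real.log_one, add_zero, add_zero]
  obtain ⟨hpos, hle⟩ := integral_skZ_rpow_mul_le hn β h hN₁ hN₂
  rw [← Real.log_mul (left_ne_zero_of_mul hpos.ne') (right_ne_zero_of_mul hpos.ne')]
  exact Real.log_le_log hpos hle

lemma exists_tendsto_skPhi {n β h B : ℝ} (hn : n ∈ Set.Ioc (0 : ℝ) 1)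
    (hB : ∀ N : ℕ, 0 < N → skPhi N n β h ≤ B) :
    ∃ L : ℝ, Tendsto (fun N => skPhi N n β h) atTop (𝓝 L) ∧ L ≤ B := by
  have hsub : Subadditive fun N => -(Real.log (∫ J, skZ N β h J ^ n ∂skMuJ N) / n) := fun a b => by
    rw [← neg_add, ← add_div, neg_le_neg_iff]
    exact div_le_div_of_nonneg_right (log_integral_skZ_rpow_add_le hn β h a b) hn.1.le
  have heq : ∀ N : ℕ, -(Real.log (∫ J, skZ N β h J ^ n ∂skMuJ N) / n) / N = -skPhi N n β h :=
    fun N => by rw [skPhi, one_div, mul_inv]; ring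
  have hbdd : BddBelow (Set.range fun N : ℕ =>
      -(Real.log (∫ J, skZ N β h J ^ n ∂skMuJ N) / n) / N) := by
    refine ⟨min 0 (-B), ?_⟩
    rintro _ ⟨N, rfl⟩
    rcases N.eq_zero_or_pos with rfl | hN
    · simp
    · simp only [heq]
      exact (min_le_right _ _).trans (neg_le_neg (hB N hN))
  have hlim := hsub.tendsto_lim hbdd
  simp only [heq] at hlim
  have hlim' := hlim.neg
  simp only [neg_neg] at hlim'
  exact ⟨_, hlim', le_of_tendsto hlim' ((eventually_gt_atTop 0).mono hB)⟩

end Superadditivity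

/-- with the `K`-level Parisi recursion and
`α_P(β,h,x_n) = log 2 + nβ²/4 + f_0(h) - (β²/4) Σ_{a=1}^K m_a (q_a² - q_{a-1}²)`,
the thermodynamic limit `φ(n,β,h) = lim_{N→∞} φ_N(n,β,h)` exists and satisfies
`φ(n,β,h) ≤ α_P(β,h,x_n)`. -/
theorem stmt14 (n β h : ℝ) (hn : n ∈ Set.Ioc (0:ℝ) 1) (hβ : 0 < β)
    (K : ℕ) (hK : 1 ≤ K) (q m : ℕ → ℝ) (f : ℕ → ℝ → ℝ)
    (hq0 : q 0 = 0) (hqK : q K = 1) (hqmono : ∀ a < K, q a ≤ q (a + 1))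
    (hm1 : n ≤ m 1) (hmmono : ∀ a, 1 ≤ a → a < K → m a ≤ m (a + 1)) (hmK : m K ≤ 1)
    (hfK : ∀ y, f K y = Real.log (Real.cosh (β * y)))
    (hfrec : ∀ a, 1 ≤ a → a ≤ K → ∀ y,
      f (a - 1) y = (1 / m a) *
        Real.log (∫ z, Real.exp (m a * f a (y + Real.sqrt (q a - q (a - 1)) * z))
          ∂ gaussianReal 0 1)) :
    ∃ L : ℝ, Tendsto (fun N => skPhi N n β h) atTop (𝓝 L) ∧
      L ≤ Real.log 2 + n * β ^ 2 / 4 + f 0 h -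
            β ^ 2 / 4 * ∑ a ∈ Finset.range K, m (a + 1) * (q (a + 1) ^ 2 - q a ^ 2) := by
  refine exists_tendsto_skPhi hn fun N hN => ?_
  have hNn : 0 < (N : ℝ) * n := mul_pos (Nat.cast_pos.2 hN) hn.1
  have hle := log_integral_skZ_rpow_le hn (h := h) hq0 hqK hqmono hm1 hmmono hmK hfK hfrec hN
  have hslack : 0 ≤ n * β ^ 2 / 4 := div_nonneg (mul_nonneg hn.1.le (sq_nonneg β)) (by norm_num)
  rw [skPhi, one_div_mul_eq_div, div_le_iff₀' hNn]
  refine hle.trans (mul_le_mul_of_nonneg_left ?_ hNn.le)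
  linarith
end
end
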